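/- arXiv:1112.2411 — 2 statements merged into one kernel-verified Lean document; each statement's English description precedes it below -/
import Mathlib

section
/- Let (u_n) and (v_n) be seminormalized basic weakly null sequences in a Banach space X such that (u_n − v_n) is also seminormalized, basic and weakly null. Assume that for some 0 < p < q and constants 0 < c, C < ∞: (u_n) has a spreading model (ũ_n) with ‖Σ_n a_n ũ_n‖ ≥ c·‖(a_n)‖_{f^p} for all (a_n) ∈ c₀₀; (v_n) has a spreading model (ṽ_n) with ‖Σ_n a_n ṽ_n‖ ≥ c·‖(a_n)‖_{f^p} for all (a_n) ∈ c₀₀; and (u_n − v_n) has a spreading model (w̃_n) with ‖Σ_n a_n w̃_n‖ ≤ C·|||(a_n)|||_{f^q} for all (a_n) ∈ c₀₀. Then there is a subsequence (n_k) of ℕ such that (u_{n_k}) and (v_{n_k}) are equivalent, i.e. there are constants 0 < c' ≤ C' with c'·‖Σ_k a_k u_{n_k}‖ ≤ ‖Σ_k a_k v_{n_k}‖ ≤ C'·‖Σ_k a_k u_{n_k}‖ for all (a_k) ∈ c₀₀. -/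
/-- `f(x) = log₂(x+1)`; note `flog 0 = 0`. -/
noncomputable def flog (x : ℝ) : ℝ := Real.logb 2 (x + 1)

/-- The `n`-th largest value (1-indexed) of the sequence `(|x i|)`, i.e. the decreasing
rearrangement of `(|x i|)`. -/
noncomputable def drear (x : ℕ →₀ ℝ) (n : ℕ) : ℝ :=
  sSup {t : ℝ | 0 ≤ t ∧ n ≤ (x.support.filter fun i => t ≤ |x i|).card}

/-- The norm `‖x‖_g = sup_{n₁ < … < n_l} (1/g(l)) ∑ |x_{n_i}|`. -/
noncomputable def gnorm (g : ℕ → ℝ) (x : ℕ →₀ ℝ) : ℝ :=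
  sSup {r : ℝ | ∃ s : Finset ℕ, s.Nonempty ∧ r = (1 / g s.card) * ∑ i ∈ s, |x i|}

/-- The norm `|||x|||_g = ∑_{i ≥ 1} x_i^# / g(i)`. -/
noncomputable def tnorm (g : ℕ → ℝ) (x : ℕ →₀ ℝ) : ℝ :=
  ∑ i ∈ Finset.range x.support.card, drear x (i + 1) / g (i + 1)

section BanachDefs

variable {X : Type*} [NormedAddCommGroup X] [NormedSpace ℝ X]

/-- A sequence is seminormalized if its norms are bounded away from `0` and `∞`. -/
def Seminormalized (x : ℕ → X) : Prop :=
  ∃ c C : ℝ, 0 < c ∧ ∀ n, c ≤ ‖x n‖ ∧ ‖x n‖ ≤ C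

/-- A sequence of nonzero vectors is basic if partial sums of expansions are uniformly
dominated by longer ones. -/
def IsBasicSeq (x : ℕ → X) : Prop :=
  (∀ n, x n ≠ 0) ∧ ∃ K : ℝ, 1 ≤ K ∧ ∀ (a : ℕ → ℝ) (m n : ℕ), m ≤ n →
    ‖∑ i ∈ Finset.range m, a i • x i‖ ≤ K * ‖∑ i ∈ Finset.range n, a i • x i‖

/-- `(e_n)` is a Schauder basis of `X`: nonzero vectors with dense linear span and uniformly
bounded basis projections. -/
def IsSchauderBasis (e : ℕ → X) : Prop :=
  (∀ n, e n ≠ 0) ∧ Dense (↑(Submodule.span ℝ (Set.range e)) : Set X) ∧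
  ∃ K : ℝ, 1 ≤ K ∧ ∀ (a : ℕ → ℝ) (m n : ℕ), m ≤ n →
    ‖∑ i ∈ Finset.range m, a i • e i‖ ≤ K * ‖∑ i ∈ Finset.range n, a i • e i‖

/-- `(y_n)` is a block sequence of `(e_n)`: nonzero finite linear combinations of the `e_i`
with successive supports `supp y₀ < supp y₁ < …`. -/
def IsBlockSeq (e y : ℕ → X) : Prop :=
  (∀ n, y n ≠ 0) ∧ ∃ (I : ℕ → Finset ℕ) (a : ℕ → ℕ → ℝ),
    (∀ n, y n = ∑ i ∈ I n, a n i • e i) ∧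
    (∀ n m, n < m → ∀ i ∈ I n, ∀ j ∈ I m, i < j)

/-- Two sequences are equivalent: the map `u_n ↦ v_n` extends to an isomorphism between the
closed linear spans. -/
def SeqEquiv (u v : ℕ → X) : Prop :=
  ∃ c C : ℝ, 0 < c ∧ ∀ (a : ℕ → ℝ) (s : Finset ℕ),
    c * ‖∑ n ∈ s, a n • u n‖ ≤ ‖∑ n ∈ s, a n • v n‖ ∧
    ‖∑ n ∈ s, a n • v n‖ ≤ C * ‖∑ n ∈ s, a n • u n‖

/-- The closed linear span of a set. -/
def closedSpan (s : Set X) : Submodule ℝ X :=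
  (Submodule.span ℝ s).topologicalClosure

/-- A sequence is weakly null if it tends to `0` in the weak topology. -/
def WeaklyNull (x : ℕ → X) : Prop :=
  ∀ φ : X →L[ℝ] ℝ, Filter.Tendsto (fun n => φ (x n)) Filter.atTop (nhds 0)

end BanachDefs

/-- `Y` embeds into `Z`: there is a bounded linear injection which is an isomorphism onto its
range (bounded below). -/
def Embeds (Y Z : Type*) [NormedAddCommGroup Y] [NormedSpace ℝ Y]
    [NormedAddCommGroup Z] [NormedSpace ℝ Z] : Prop :=
  ∃ T : Y →L[ℝ] Z, ∃ c : ℝ, 0 < c ∧ ∀ y, c * ‖y‖ ≤ ‖T y‖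

/-- `(xt_n)` (in `E`) is the spreading model of `(x_n)` (in `X`): for every `k` and scalars
`a₁, …, a_k`, `‖∑ a_i x_{n_i}‖ → ‖∑ a_i xt_i‖` as `n₁ → ∞` along `n₁ < … < n_k`. -/
def HasSpreadingModel {X E : Type*} [NormedAddCommGroup X] [NormedSpace ℝ X]
    [NormedAddCommGroup E] [NormedSpace ℝ E] (x : ℕ → X) (xt : ℕ → E) : Prop :=
  ∀ (k : ℕ) (a : Fin k → ℝ) (ε : ℝ), 0 < ε → ∃ N : ℕ, ∀ n : Fin k → ℕ,
    StrictMono n → (∀ i, N ≤ n i) →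
    |‖∑ i, a i • x (n i)‖ - ‖∑ i, a i • xt i‖| ≤ ε


lemma flog_one_le {l : ℕ} (hl : 1 ≤ l) : 1 ≤ flog l := by
  unfold flog
  have h1 : (1:ℝ) = Real.logb 2 2 := by simp
  rw [h1]
  apply Real.logb_le_logb_of_le (by norm_num) (by norm_num)
  have : (1:ℝ) ≤ l := by exact_mod_cast hl
  linarith

lemma flog_mono {l m : ℕ} (hl : l ≤ m) : flog l ≤ flog m := by
  unfold flog
  apply Real.logb_le_logb_of_le (by norm_num) (by positivity)
  have : (l:ℝ) ≤ m := by exact_mod_cast hl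
  linarith

lemma flog_nonneg (l : ℕ) : 0 ≤ flog l := by
  unfold flog
  apply Real.logb_nonneg (by norm_num)
  have : (0:ℝ) ≤ l := by positivity
  linarith

lemma gp_one_le {p : ℝ} (hp : 0 < p) {l : ℕ} (hl : 1 ≤ l) : 1 ≤ flog l ^ p :=
  Real.one_le_rpow (flog_one_le hl) hp.le

lemma gp_mono {p : ℝ} (hp : 0 < p) {l m : ℕ} (hl : l ≤ m) : flog l ^ p ≤ flog m ^ p :=
  Real.rpow_le_rpow (flog_nonneg l) (flog_mono hl) hp.le

/-- finset version of the decreasing rearrangement -/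
noncomputable def drS (y : ℕ → ℝ) (S : Finset ℕ) (n : ℕ) : ℝ :=
  sSup {t : ℝ | 0 ≤ t ∧ n ≤ (S.filter fun i => t ≤ y i).card}

lemma drS_nonneg (y : ℕ → ℝ) (S : Finset ℕ) (n : ℕ) : 0 ≤ drS y S n :=
  Real.sSup_nonneg (fun _ h => h.1)

lemma drS_le (y : ℕ → ℝ) (S : Finset ℕ) (n : ℕ) (hn : 1 ≤ n) {M : ℝ} (hM : 0 ≤ M)
    (h : ∀ i ∈ S, y i ≤ M) : drS y S n ≤ M := by
  apply Real.sSup_le _ hM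
  rintro t ⟨_, ht2⟩
  have : (S.filter fun i => t ≤ y i).Nonempty := by
    rw [← Finset.card_pos]; omega
  obtain ⟨i, hi⟩ := this
  rw [Finset.mem_filter] at hi
  exact hi.2.trans (h i hi.1)

lemma drS_sum_le (y : ℕ → ℝ) (hy : ∀ i, 0 ≤ y i) (S : Finset ℕ) :
    ∑ i ∈ Finset.range S.card, drS y S (i + 1) ≤ ∑ i ∈ S, y i := by
  induction S using Finset.induction_on_min_value y with
  | empty => simp
  | insert a s ha hmin ih =>
    rw [Finset.card_insert_of_notMem ha, Finset.sum_range_succ, Finset.sum_insert ha]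
    have h1 : drS y (insert a s) (s.card + 1) ≤ y a := by
      apply Real.sSup_le _ (hy a)
      rintro t ⟨_, ht2⟩
      by_contra hlt
      have : (insert a s).filter (fun i => t ≤ y i) ⊆ s := by
        intro i hi
        rw [Finset.mem_filter, Finset.mem_insert] at hi
        rcases hi.1 with rfl | h
        · exact absurd hi.2 hlt
        · exact h
      have := Finset.card_le_card this
      omega
    have h2 : ∀ i ∈ Finset.range s.card, drS y (insert a s) (i+1) ≤ drS y s (i+1) := by
      intro i hi
      rw [Finset.mem_range] at hi
      have hbdd : BddAbove {t : ℝ | 0 ≤ t ∧ i + 1 ≤ (s.filter fun i => t ≤ y i).card} := by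
        refine ⟨∑ j ∈ s, y j, ?_⟩
        rintro t ⟨_, ht2⟩
        have : (s.filter fun i => t ≤ y i).Nonempty := by
          rw [← Finset.card_pos]; omega
        obtain ⟨j, hj⟩ := this
        rw [Finset.mem_filter] at hj
        exact hj.2.trans (Finset.single_le_sum (fun j _ => hy j) hj.1)
      apply Real.sSup_le _ (drS_nonneg _ _ _)
      rintro t ⟨ht, ht2⟩
      apply le_csSup hbdd
      refine ⟨ht, ?_⟩
      by_cases hta : t ≤ y a
      · have : s.filter (fun i => t ≤ y i) = s := by
          apply Finset.filter_true_of_mem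
          intro j hj
          exact hta.trans (hmin j hj)
        rw [this]; omega
      · rw [Finset.filter_insert, if_neg hta] at ht2
        exact ht2
    have := Finset.sum_le_sum h2
    linarith

lemma tnorm_le {q : ℝ} (hq : 0 < q) (x : ℕ →₀ ℝ) (M : ℝ) (hM : 0 ≤ M)
    (h : ∀ i, |x i| ≤ M) (R : ℕ) :
    tnorm (fun l => flog l ^ q) x ≤ R * M + (∑ i ∈ x.support, |x i|) / flog (R + 1 : ℕ) ^ q := by
  have hd : ∀ n, drear x n = drS (fun i => |x i|) x.support n := fun n => rfl
  unfold tnorm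
  have hg : (0:ℝ) < flog (R + 1 : ℕ) ^ q := by
    have := gp_one_le hq (l := R+1) (by omega); linarith
  have key : ∀ i ∈ Finset.range x.support.card,
      drear x (i+1) / flog ((i:ℝ) + 1) ^ q ≤ (if i < R then M else 0) +
        drear x (i+1) / flog (R + 1 : ℕ) ^ q := by
    intro i _
    have h0 : 0 ≤ drear x (i+1) := by rw [hd]; exact drS_nonneg _ _ _
    have h1 : (1:ℝ) ≤ flog ((i:ℝ) + 1) ^ q := by
      have := gp_one_le hq (l := i+1) (by omega); push_cast at this; exact this
    split_ifs with hi
    · have : drear x (i+1) / flog ((i:ℝ) + 1) ^ q ≤ M := by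
        apply (div_le_self h0 h1).trans
        rw [hd]
        exact drS_le _ _ _ (by omega) hM (fun i _ => h i)
      have := div_nonneg h0 hg.le
      linarith
    · rw [zero_add]
      apply div_le_div_of_nonneg_left h0 hg
      have := gp_mono hq (l := R+1) (m := i+1) (by omega)
      push_cast at this ⊢; exact this
  have := Finset.sum_le_sum key
  rw [Finset.sum_add_distrib, ← Finset.sum_div] at this
  push_cast at this ⊢
  refine this.trans ?_
  gcongr
  · rw [Finset.sum_ite, Finset.sum_const_zero, add_zero, Finset.sum_const, nsmul_eq_mul]
    gcongr
    have : (Finset.range x.support.card).filter (fun i => i < R) ⊆ Finset.range R := by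
      intro i hi; simp at hi ⊢; exact hi.2
    simpa using Finset.card_le_card this
  · push_cast at hg; exact hg.le
  · have := drS_sum_le (fun i => |x i|) (fun i => abs_nonneg _) x.support
    simpa [hd] using this

lemma gnorm_ge {p : ℝ} (hp : 0 < p) (x : ℕ →₀ ℝ) (s : Finset ℕ) (hs : s.Nonempty) :
    (1 / flog s.card ^ p) * ∑ i ∈ s, |x i| ≤ gnorm (fun l => flog l ^ p) x := by
  apply le_csSup
  · refine ⟨∑ i ∈ x.support, |x i|, ?_⟩
    rintro r ⟨t, ht, rfl⟩
    have h1 := gp_one_le hp (l := t.card) ht.card_pos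
    have h2 : ∑ i ∈ t, |x i| ≤ ∑ i ∈ x.support, |x i| := by
      calc ∑ i ∈ t, |x i| ≤ ∑ i ∈ t ∪ x.support, |x i| :=
            Finset.sum_le_sum_of_subset_of_nonneg Finset.subset_union_left
              (fun _ _ _ => abs_nonneg _)
        _ = ∑ i ∈ x.support, |x i| := by
            symm
            apply Finset.sum_subset Finset.subset_union_right
            intro i _ hi
            simpa using hi
    have h3 : 0 ≤ ∑ i ∈ t, |x i| := Finset.sum_nonneg (fun _ _ => abs_nonneg _)
    calc (1 / flog t.card ^ p) * ∑ i ∈ t, |x i| ≤ 1 * ∑ i ∈ t, |x i| := by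
          gcongr
          rw [div_le_one (by linarith)]; exact h1
      _ ≤ _ := by rw [one_mul]; exact h2
  · exact ⟨s, hs, rfl⟩

/-- extension of a tuple by zero -/
noncomputable def extF {k : ℕ} (a : Fin k → ℝ) : ℕ →₀ ℝ :=
  Finsupp.onFinset (Finset.range k) (fun i => if h : i < k then a ⟨i, h⟩ else 0)
    (by intro i hi; by_contra h; simp at h; simp [not_lt.mpr h] at hi)

lemma extF_fin {k : ℕ} (a : Fin k → ℝ) (i : Fin k) : extF a i = a i := by
  simp [extF]

lemma extF_support {k : ℕ} (a : Fin k → ℝ) : (extF a).support ⊆ Finset.range k :=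
  Finsupp.support_onFinset_subset

lemma extF_sum {k : ℕ} (a : Fin k → ℝ) {E : Type*} [NormedAddCommGroup E] [NormedSpace ℝ E]
    (y : ℕ → E) : ∑ n ∈ (extF a).support, extF a n • y n = ∑ i, a i • y i := by
  rw [Finset.sum_subset (extF_support a) (by intro i _ h; simp at h; simp [h]),
    Finset.sum_range]
  simp [extF_fin]

lemma extF_abs {k : ℕ} (a : Fin k → ℝ) :
    ∑ n ∈ Finset.range k, |extF a n| = ∑ i, |a i| := by
  rw [Finset.sum_range]
  simp [extF_fin]

lemma extF_abs' {k : ℕ} (a : Fin k → ℝ) :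
    ∑ n ∈ (extF a).support, |extF a n| = ∑ i, |a i| := by
  rw [Finset.sum_subset (extF_support a) (by intro i _ h; simp at h; simp [h]), extF_abs]

section
variable {X E : Type*} [NormedAddCommGroup X] [NormedSpace ℝ X]
    [NormedAddCommGroup E] [NormedSpace ℝ E]

lemma sm_uniform (x : ℕ → X) (xt : ℕ → E) (h : HasSpreadingModel x xt) (B : ℝ)
    (hB : ∀ n, ‖x n‖ ≤ B) (k : ℕ) (ε : ℝ) (hε : 0 < ε) :
    ∃ N : ℕ, ∀ n : Fin k → ℕ, StrictMono n → (∀ i, N ≤ n i) → ∀ a : Fin k → ℝ,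
      |‖∑ i, a i • x (n i)‖ - ‖∑ i, a i • xt i‖| ≤ ε * ‖a‖ := by
  classical
  have hB0 : 0 ≤ B := (norm_nonneg _).trans (hB 0)
  set L : ℝ := ∑ i : Fin k, (B + ‖xt i‖) + 1 with hL
  have hLpos : 0 < L := by
    have : 0 ≤ ∑ i : Fin k, (B + ‖xt i‖) := Finset.sum_nonneg (fun i _ => by positivity)
    linarith
  -- Lipschitz
  have lip : ∀ (n : Fin k → ℕ) (a b : Fin k → ℝ),
      |‖∑ i, a i • x (n i)‖ - ‖∑ i, a i • xt i‖| ≤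
      |‖∑ i, b i • x (n i)‖ - ‖∑ i, b i • xt i‖| + L * ‖a - b‖ := by
    intro n a b
    have h1 : |‖∑ i, a i • x (n i)‖ - ‖∑ i, b i • x (n i)‖| ≤ ∑ i : Fin k, ‖a - b‖ * B := by
      refine (abs_norm_sub_norm_le _ _).trans ?_
      rw [← Finset.sum_sub_distrib]
      apply norm_sum_le_of_le
      intro i _
      rw [← sub_smul, norm_smul]
      exact mul_le_mul (norm_le_pi_norm (a - b) i) (hB _) (norm_nonneg _) (norm_nonneg _)
    have h2 : |‖∑ i, a i • xt i‖ - ‖∑ i, b i • xt i‖| ≤ ∑ i : Fin k, ‖a - b‖ * ‖xt i‖ := by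
      refine (abs_norm_sub_norm_le _ _).trans ?_
      rw [← Finset.sum_sub_distrib]
      apply norm_sum_le_of_le
      intro i _
      rw [← sub_smul, norm_smul]
      exact mul_le_mul_of_nonneg_right (norm_le_pi_norm (a - b) i) (norm_nonneg _)
    have h3 : L * ‖a - b‖ = ∑ i : Fin k, ‖a - b‖ * B + ∑ i : Fin k, ‖a - b‖ * ‖xt i‖
        + ‖a - b‖ := by
      rw [hL, add_mul, one_mul, Finset.sum_mul, ← Finset.sum_add_distrib]
      congr 1
      apply Finset.sum_congr rfl; intro i _; ring
    have h4 := norm_nonneg (a - b)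
    rw [h3]
    rw [abs_le] at h1 h2 ⊢
    constructor
    · have := neg_abs_le (‖∑ i, b i • x (n i)‖ - ‖∑ i, b i • xt i‖)
      linarith [h1.1, h2.2]
    · have := le_abs_self (‖∑ i, b i • x (n i)‖ - ‖∑ i, b i • xt i‖)
      linarith [h1.2, h2.1]
  have hcomp : IsCompact (Metric.closedBall (0 : Fin k → ℝ) 1) := isCompact_closedBall _ _
  have hη : 0 < ε / 2 / L := by positivity
  obtain ⟨t, _, htf, hcov⟩ := hcomp.finite_cover_balls hη
  choose N hN using fun a : Fin k → ℝ => h k a (ε/2) (by positivity)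
  refine ⟨htf.toFinset.sup N, fun n hn hnN => ?_⟩
  have key : ∀ a : Fin k → ℝ, ‖a‖ ≤ 1 →
      |‖∑ i, a i • x (n i)‖ - ‖∑ i, a i • xt i‖| ≤ ε := by
    intro a ha
    have : a ∈ Metric.closedBall (0 : Fin k → ℝ) 1 := by simpa using ha
    have := hcov this
    simp only [Set.mem_iUnion] at this
    obtain ⟨b, hbt, hb⟩ := this
    rw [mem_ball_iff_norm] at hb
    have h1 := hN b n hn (fun i => (Finset.le_sup (f := N) (htf.mem_toFinset.mpr hbt)).trans (hnN i))
    have h2 := lip n a b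
    have h3 : L * ‖a - b‖ ≤ ε / 2 := by
      rw [lt_div_iff₀ hLpos] at hb
      linarith
    linarith
  intro a
  by_cases ha : a = 0
  · subst ha; simp
  have hapos : 0 < ‖a‖ := norm_pos_iff.mpr ha
  have h1 := key (‖a‖⁻¹ • a) (by rw [norm_smul, norm_inv, norm_norm, inv_mul_cancel₀ hapos.ne'])
  have e1 : ∑ i, (‖a‖⁻¹ • a) i • x (n i) = ‖a‖⁻¹ • ∑ i, a i • x (n i) := by
    rw [Finset.smul_sum]; simp [mul_smul]
  have e2 : ∑ i, (‖a‖⁻¹ • a) i • xt i = ‖a‖⁻¹ • ∑ i, a i • xt i := by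
    rw [Finset.smul_sum]; simp [mul_smul]
  rw [e1, e2, norm_smul, norm_smul, norm_inv, norm_norm, ← mul_sub, abs_mul, abs_inv,
    abs_norm, inv_mul_le_iff₀ hapos] at h1
  linarith

lemma sum_orderEmb (F : Finset ℕ) {k : ℕ} (hk : F.card = k) {M : Type*} [AddCommMonoid M]
    (g : ℕ → M) : ∑ i ∈ F, g i = ∑ j : Fin k, g (F.orderEmbOfFin hk j) := by
  conv_lhs => rw [← Finset.map_orderEmbOfFin_univ F hk, Finset.sum_map]
  rfl

lemma sm_lower (x : ℕ → X) (xt : ℕ → E) (h : HasSpreadingModel x xt) (B : ℝ)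
    (hB : ∀ n, ‖x n‖ ≤ B) {p c : ℝ} (hp : 0 < p) (hc : 0 < c)
    (hlow : ∀ a : ℕ →₀ ℝ,
      c * gnorm (fun l => flog l ^ p) a ≤ ‖∑ n ∈ a.support, a n • xt n‖) (k : ℕ) :
    ∃ N : ℕ, ∀ F : Finset ℕ, F.card = k → (∀ i ∈ F, N ≤ i) → ∀ a : ℕ → ℝ,
      c / (2 * flog k ^ p) * ∑ i ∈ F, |a i| ≤ ‖∑ i ∈ F, a i • x i‖ := by
  rcases Nat.eq_zero_or_pos k with rfl | hk
  · refine ⟨0, fun F hF _ a => ?_⟩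
    rw [Finset.card_eq_zero] at hF; subst hF; simp
  have hg := gp_one_le hp hk
  obtain ⟨N, hN⟩ := sm_uniform x xt h B hB k (c / (2 * flog k ^ p)) (by positivity)
  refine ⟨N, fun F hF hFN a => ?_⟩
  rw [sum_orderEmb F hF, sum_orderEmb F hF]
  have h1 := hN (F.orderEmbOfFin hF) (F.orderEmbOfFin hF).strictMono
    (fun i => hFN _ (Finset.orderEmbOfFin_mem F hF i)) (fun j => a (F.orderEmbOfFin hF j))
  set b : Fin k → ℝ := fun j => a (F.orderEmbOfFin hF j) with hb
  have h2 := hlow (extF b)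
  rw [extF_sum] at h2
  have h3 := gnorm_ge hp (extF b) (Finset.range k) (by simpa using hk.ne')
  rw [extF_abs, Finset.card_range] at h3
  have h4 : ‖b‖ ≤ ∑ i, |b i| := by
    rw [pi_norm_le_iff_of_nonneg (Finset.sum_nonneg (fun _ _ => abs_nonneg _))]
    intro i
    exact Finset.single_le_sum (f := fun i => |b i|) (fun j _ => abs_nonneg _) (Finset.mem_univ i)
  have h5 := (abs_le.mp h1).1
  have h6 := mul_le_mul_of_nonneg_left h3 hc.le
  have h7 : c / (2 * flog k ^ p) * ‖b‖ ≤ c / (2 * flog k ^ p) * ∑ i, |b i| := by gcongr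
  have h8 : c * (1 / flog k ^ p * ∑ i, |b i|) = 2 * (c / (2 * flog k ^ p) * ∑ i, |b i|) := by
    field_simp
  change c / (2 * flog k ^ p) * ∑ i, |b i| ≤ ‖∑ i, b i • x _‖
  linarith

lemma sm_upper (x : ℕ → X) (xt : ℕ → E) (h : HasSpreadingModel x xt) (B : ℝ)
    (hB : ∀ n, ‖x n‖ ≤ B) {q C : ℝ} (hq : 0 < q) (hC : 0 < C)
    (hup : ∀ a : ℕ →₀ ℝ,
      ‖∑ n ∈ a.support, a n • xt n‖ ≤ C * tnorm (fun l => flog l ^ q) a) (k : ℕ) :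
    ∃ N : ℕ, ∀ F : Finset ℕ, F.card = k → (∀ i ∈ F, N ≤ i) → ∀ a : ℕ → ℝ, ∀ M : ℝ, 0 ≤ M →
      (∀ i ∈ F, |a i| ≤ M) → ∀ R : ℕ,
      ‖∑ i ∈ F, a i • x i‖ ≤ M + C * (R * M + (∑ i ∈ F, |a i|) / flog (R + 1 : ℕ) ^ q) := by
  obtain ⟨N, hN⟩ := sm_uniform x xt h B hB k 1 (by positivity)
  refine ⟨N, fun F hF hFN a M hM haM R => ?_⟩
  rw [sum_orderEmb F hF, sum_orderEmb F hF]
  have h1 := hN (F.orderEmbOfFin hF) (F.orderEmbOfFin hF).strictMono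
    (fun i => hFN _ (Finset.orderEmbOfFin_mem F hF i)) (fun j => a (F.orderEmbOfFin hF j))
  have hbM : ∀ j, |a (F.orderEmbOfFin hF j)| ≤ M :=
    fun j => haM _ (Finset.orderEmbOfFin_mem F hF j)
  set b : Fin k → ℝ := fun j => a (F.orderEmbOfFin hF j) with hb
  have h2 := hup (extF b)
  rw [extF_sum] at h2
  have h3 := tnorm_le hq (extF b) M hM (by
    intro i
    by_cases hi : i < k
    · rw [show i = ((⟨i, hi⟩ : Fin k) : ℕ) from rfl, extF_fin]; exact hbM _
    · simp [extF, hi, hM]) R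
  rw [extF_abs'] at h3
  have h4 : ‖b‖ ≤ M := by
    rw [pi_norm_le_iff_of_nonneg hM]; exact hbM
  have h5 := (abs_le.mp h1).2
  have h6 := mul_le_mul_of_nonneg_left h3 hC.le
  change ‖∑ i, b i • x _‖ ≤ M + C * (R * M + (∑ i, |b i|) / _)
  linarith

end

section
variable {X : Type*} [NormedAddCommGroup X] [NormedSpace ℝ X]

lemma hb_sep (x : ℕ → X) (F : Finset ℕ) (δ : ℝ) (hδ : 0 < δ)
    (h : ∀ a : ℕ → ℝ, δ * ∑ i ∈ F, |a i| ≤ ‖∑ i ∈ F, a i • x i‖) :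
    ∃ f : X →L[ℝ] ℝ, ‖f‖ ≤ 1 ∧ ∀ i ∈ F, δ ≤ f (x i) := by
  classical
  rcases F.eq_empty_or_nonempty with rfl | ⟨i0, hi0⟩
  · exact ⟨0, by simp, by simp⟩
  set S : Set X := {y | ∃ a : ℕ → ℝ, (∀ i, 0 ≤ a i) ∧ ∑ i ∈ F, a i = 1 ∧
    y = ∑ i ∈ F, a i • x i} with hS
  have hconv : Convex ℝ S := by
    rintro y ⟨a, ha, ha1, rfl⟩ z ⟨b, hb, hb1, rfl⟩ s t hs ht hst
    refine ⟨fun i => s * a i + t * b i, fun i => ?_, ?_, ?_⟩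
    · have := ha i; have := hb i; positivity
    · rw [Finset.sum_add_distrib, ← Finset.mul_sum, ← Finset.mul_sum, ha1, hb1]; linarith
    · simp only [add_smul, mul_smul, Finset.sum_add_distrib, Finset.smul_sum]
  have hdisj : Disjoint (Metric.ball (0:X) δ) S := by
    rw [Set.disjoint_left]
    rintro y hy ⟨a, ha, ha1, rfl⟩
    rw [mem_ball_zero_iff] at hy
    have := h a
    simp only [abs_of_nonneg (ha _), ha1, mul_one] at this
    linarith
  obtain ⟨f, r, hf1, hf2⟩ := geometric_hahn_banach_open (convex_ball 0 δ) Metric.isOpen_ball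
    hconv hdisj
  have hr : 0 < r := by simpa using hf1 0 (by simpa using hδ)
  have hnorm : ‖f‖ ≤ r / δ := by
    apply ContinuousLinearMap.opNorm_le_bound _ (by positivity)
    intro y
    by_contra hlt
    push Not at hlt
    have hy : 0 < ‖y‖ := by
      rw [norm_pos_iff]; rintro rfl; simp at hlt
    have hfy : 0 < |f y| := lt_of_le_of_lt (by positivity) hlt
    have key : ∀ z : X, ‖z‖ = ‖y‖ → f z = |f y| → False := by
      intro z hz hfz
      have hb : (r / f z) • z ∈ Metric.ball (0:X) δ := by
        rw [mem_ball_zero_iff, norm_smul, Real.norm_eq_abs, hfz, abs_of_pos (by positivity), hz,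
          div_mul_eq_mul_div, div_lt_iff₀ hfy]
        rw [Real.norm_eq_abs, div_mul_eq_mul_div, div_lt_iff₀ hδ] at hlt
        linarith
      have := hf1 _ hb
      rw [map_smul, smul_eq_mul, hfz, div_mul_cancel₀ _ hfy.ne'] at this
      exact lt_irrefl _ this
    rcases abs_choice (f y) with h1 | h1
    · exact key y rfl h1.symm
    · exact key (-y) (norm_neg _) (by rw [map_neg, h1])
  refine ⟨(δ / r) • f, ?_, fun i hi => ?_⟩
  · rw [norm_smul, Real.norm_eq_abs, abs_of_pos (by positivity)]
    calc δ / r * ‖f‖ ≤ δ / r * (r / δ) := by gcongr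
      _ = 1 := by field_simp
  · have : x i ∈ S := by
      refine ⟨fun j => if j = i then 1 else 0, fun j => by dsimp only; split_ifs <;> simp, ?_, ?_⟩
      · simp [hi]
      · simp [hi]
    have := hf2 _ this
    simp only [smul_apply, smul_eq_mul]
    calc δ = δ / r * r := by field_simp
      _ ≤ δ / r * f (x i) := by gcongr

lemma ultra_lim (g : ℕ → (X →L[ℝ] ℝ)) (hg : ∀ n, ‖g n‖ ≤ 1) :
    ∃ h : X →L[ℝ] ℝ, ‖h‖ ≤ 1 ∧ ∀ x, Filter.Tendsto (fun n => g n x)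
      (Filter.hyperfilter ℕ) (nhds (h x)) := by
  have hc := WeakDual.isCompact_closedBall (𝕜 := ℝ) (E := X) 0 1
  let G : ℕ → WeakDual ℝ X := fun n => StrongDual.toWeakDual (g n)
  have := hc.ultrafilter_le_nhds ((Filter.hyperfilter ℕ).map G) (by
    rw [Filter.le_principal_iff]
    rw [Ultrafilter.mem_coe, Ultrafilter.mem_map]
    apply Filter.Eventually.of_forall
    intro n
    simpa [G] using hg n)
  obtain ⟨h, hh, hlim⟩ := this
  refine ⟨WeakDual.toStrongDual h, by simpa using hh, fun x => ?_⟩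
  have : Filter.Tendsto G (Filter.hyperfilter ℕ) (nhds h) := hlim
  exact ((WeakDual.eval_continuous x).tendsto h).comp this

/-- iterated limits -/
lemma exists_Z (Y : Finset ℕ → (X →L[ℝ] ℝ)) (hY : ∀ F, ‖Y F‖ ≤ 1) :
    ∃ Z : ℕ → Finset ℕ → (X →L[ℝ] ℝ), Z 0 = Y ∧ ∀ j F x,
      Filter.Tendsto (fun n => Z j (insert n F) x) (Filter.hyperfilter ℕ) (nhds (Z (j+1) F x)) := by
  have step : ∀ Y : {Y : Finset ℕ → (X →L[ℝ] ℝ) // ∀ F, ‖Y F‖ ≤ 1},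
      ∃ Y' : {Y : Finset ℕ → (X →L[ℝ] ℝ) // ∀ F, ‖Y F‖ ≤ 1}, ∀ F x,
      Filter.Tendsto (fun n => Y.1 (insert n F) x) (Filter.hyperfilter ℕ) (nhds (Y'.1 F x)) := by
    rintro ⟨Y, hY⟩
    choose Y' h1 h2 using fun F => ultra_lim (fun n => Y (insert n F)) (fun n => hY _)
    exact ⟨⟨Y', h1⟩, h2⟩
  choose next hnext using step
  let W : ℕ → {Y : Finset ℕ → (X →L[ℝ] ℝ) // ∀ F, ‖Y F‖ ≤ 1} :=
    fun j => Nat.rec ⟨Y, hY⟩ (fun _ y => next y) j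
  exact ⟨fun j => (W j).1, rfl, fun j F x => hnext (W j) F x⟩

lemma select (R : Finset ℕ → ℕ → ℕ → Prop) (h : ∀ P s, ∃ n, R P s n) :
    ∃ ψ : ℕ → ℕ, ∀ s, R ((Finset.range s).image ψ) s (ψ s) := by
  classical
  choose nx hnx using h
  let P : ℕ → Finset ℕ := fun s => Nat.rec ∅ (fun s p => insert (nx p s) p) s
  have hP : ∀ s, P s = (Finset.range s).image (fun s => nx (P s) s) := by
    intro s
    induction s with
    | zero => rfl
    | succ s ih =>
      rw [Finset.range_add_one, Finset.image_insert, ← ih]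
  refine ⟨fun s => nx (P s) s, fun s => ?_⟩
  rw [← hP]
  exact hnx _ _

/-- selection of the fast subsequence -/
lemma exists_fast (u : ℕ → X) (hu : WeaklyNull u) (Z : ℕ → Finset ℕ → (X →L[ℝ] ℝ))
    (hZ : ∀ j F x, Filter.Tendsto (fun n => Z j (insert n F) x)
      (Filter.hyperfilter ℕ) (nhds (Z (j+1) F x))) (φ T : ℕ → ℕ) :
    ∃ ψ : ℕ → ℕ, StrictMono ψ ∧ (∀ s, T s ≤ ψ s) ∧
      ∀ s, ∀ F ⊆ (Finset.range s).image ψ, ∀ j ≤ φ s,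
        |Z j F (u (ψ s))| ≤ (1/2:ℝ)^s ∧
        ∀ i ∈ (Finset.range s).image ψ,
          |Z j (insert (ψ s) F) (u i) - Z (j+1) F (u i)| ≤ (1/2:ℝ)^s := by
  obtain ⟨ψ, hψ⟩ := select (fun P s n => (∀ i ∈ P, i < n) ∧ T s ≤ n ∧
      ∀ F ∈ P.powerset, ∀ j ∈ Finset.range (φ s + 1),
        |Z j F (u n)| ≤ (1/2:ℝ)^s ∧
        ∀ i ∈ P, |Z j (insert n F) (u i) - Z (j+1) F (u i)| ≤ (1/2:ℝ)^s) (by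
    intro P s
    have hle : (Filter.hyperfilter ℕ : Filter ℕ) ≤ Filter.atTop := Nat.hyperfilter_le_atTop
    have hpos : (0:ℝ) < (1/2)^s := by positivity
    have : ∀ᶠ n in (Filter.hyperfilter ℕ : Filter ℕ), (∀ i ∈ P, i < n) ∧ T s ≤ n ∧
      ∀ F ∈ P.powerset, ∀ j ∈ Finset.range (φ s + 1),
        |Z j F (u n)| ≤ (1/2:ℝ)^s ∧
        ∀ i ∈ P, |Z j (insert n F) (u i) - Z (j+1) F (u i)| ≤ (1/2:ℝ)^s := by
      refine Filter.Eventually.and ?_ (Filter.Eventually.and ?_ ?_)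
      · rw [Filter.eventually_all_finset]
        intro i _
        exact hle (Filter.eventually_gt_atTop i)
      · exact hle (Filter.eventually_ge_atTop _)
      · rw [Filter.eventually_all_finset]
        intro F _
        rw [Filter.eventually_all_finset]
        intro j _
        refine Filter.Eventually.and ?_ ?_
        · have := (hu (Z j F)).mono_left hle
          have := this.abs
          rw [abs_zero] at this
          exact this.eventually_le_const hpos
        · rw [Filter.eventually_all_finset]
          intro i _
          have := ((hZ j F (u i)).sub_const (Z (j+1) F (u i))).abs
          rw [sub_self, abs_zero] at this
          exact this.eventually_le_const hpos
    exact this.exists)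
  refine ⟨ψ, ?_, fun s => (hψ s).2.1, ?_⟩
  · intro a b hab
    exact (hψ b).1 _ (Finset.mem_image_of_mem ψ (Finset.mem_range.mpr hab))
  · intro s F hF j hj
    exact (hψ s).2.2 F (Finset.mem_powerset.mpr hF) j (Finset.mem_range.mpr (by omega))

lemma fast_small (u : ℕ → X) (Z : ℕ → Finset ℕ → (X →L[ℝ] ℝ)) (φ ψ : ℕ → ℕ)
    (h : ∀ s, ∀ F ⊆ (Finset.range s).image ψ, ∀ j ≤ φ s,
        |Z j F (u (ψ s))| ≤ (1/2:ℝ)^s ∧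
        ∀ i ∈ (Finset.range s).image ψ,
          |Z j (insert (ψ s) F) (u i) - Z (j+1) F (u i)| ≤ (1/2:ℝ)^s)
    (I : Finset ℕ) (hI : ∀ i ∈ I, I.card ≤ φ i) (t : ℕ) (ht : t ∉ I) (htφ : I.card ≤ φ t) :
    |Z 0 (I.image ψ) (u (ψ t))| ≤ 2 * (1/2:ℝ)^t := by
  classical
  have key : ∀ d, |Z (I.card - (I.filter (· < t + 1 + d)).card)
      ((I.filter (· < t + 1 + d)).image ψ) (u (ψ t))| ≤ 2 * (1/2:ℝ)^t - (1/2)^(t+d) := by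
    intro d
    induction d with
    | zero =>
      have e : I.filter (· < t + 1 + 0) = I.filter (· < t) := by
        apply Finset.filter_congr
        intro i hi
        have : i ≠ t := fun h => ht (h ▸ hi)
        omega
      rw [e]
      have := (h t ((I.filter (· < t)).image ψ) (by
        apply Finset.image_subset_image
        intro i hi; simp at hi ⊢; exact hi.2) (I.card - (I.filter (· < t)).card) (by omega)).1
      rw [add_zero]
      linarith
    | succ d ih =>
      have hp : (1/2:ℝ)^(t + (d+1)) = (1/2)^(t+d) - (1/2)^(t+1+d) := by
        rw [show t + (d+1) = t + d + 1 by ring, show t + 1 + d = t + d + 1 by ring, pow_succ]; ring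
      by_cases hs : t + 1 + d ∈ I
      · have e : I.filter (· < t + 1 + (d+1)) = insert (t+1+d) (I.filter (· < t + 1 + d)) := by
          ext i
          simp only [Finset.mem_filter, Finset.mem_insert]
          constructor
          · rintro ⟨h1, h2⟩
            by_cases h3 : i = t+1+d
            · exact Or.inl h3
            · exact Or.inr ⟨h1, by omega⟩
          · rintro (rfl | ⟨h1, h2⟩)
            · exact ⟨hs, by omega⟩
            · exact ⟨h1, by omega⟩
        have hn : t+1+d ∉ I.filter (· < t + 1 + d) := by simp
        have hcard : (insert (t+1+d) (I.filter (· < t + 1 + d))).card ≤ I.card := by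
          rw [← e]; exact Finset.card_filter_le _ _
        rw [e]
        rw [Finset.card_insert_of_notMem hn] at hcard ⊢
        rw [Finset.image_insert]
        have := (h (t+1+d) ((I.filter (· < t + 1 + d)).image ψ) (by
          apply Finset.image_subset_image
          intro i hi; simp at hi ⊢; exact hi.2) (I.card - ((I.filter (· < t + 1 + d)).card + 1))
          (by have := hI _ hs; omega)).2 (ψ t) (Finset.mem_image_of_mem _ (by simp; omega))
        rw [show I.card - ((I.filter (· < t + 1 + d)).card + 1) + 1
          = I.card - (I.filter (· < t + 1 + d)).card by omega] at this
        rw [hp]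
        have h3 := abs_sub_abs_le_abs_sub (Z (I.card - ((I.filter (· < t + 1 + d)).card + 1))
          (insert (ψ (t+1+d)) ((I.filter (· < t + 1 + d)).image ψ)) (u (ψ t)))
          (Z (I.card - (I.filter (· < t + 1 + d)).card)
            ((I.filter (· < t + 1 + d)).image ψ) (u (ψ t)))
        linarith
      · have e : I.filter (· < t + 1 + (d+1)) = I.filter (· < t + 1 + d) := by
          apply Finset.filter_congr
          intro i hi
          have : i ≠ t+1+d := fun h => hs (h ▸ hi)
          omega
        rw [e, hp]
        have : (0:ℝ) ≤ (1/2)^(t+1+d) := by positivity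
        linarith
  have := key (I.sup id)
  have e : I.filter (· < t + 1 + I.sup id) = I := by
    apply Finset.filter_true_of_mem
    intro i hi
    have := Finset.le_sup (f := id) hi
    simp at this
    omega
  rw [e, Nat.sub_self] at this
  have : (0:ℝ) ≤ (1/2)^(t+I.sup id) := by positivity
  linarith

end

section
variable {X : Type*} [NormedAddCommGroup X] [NormedSpace ℝ X]

/-- finset form of the basis inequality -/
def FB (x : ℕ → X) (K : ℝ) : Prop := ∀ (a : ℕ → ℝ) (s : Finset ℕ) (m : ℕ),
  ‖∑ i ∈ s.filter (· < m), a i • x i‖ ≤ K * ‖∑ i ∈ s, a i • x i‖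

lemma fb_of_basic (x : ℕ → X) (K : ℝ) (h : ∀ (a : ℕ → ℝ) (m n : ℕ), m ≤ n →
    ‖∑ i ∈ Finset.range m, a i • x i‖ ≤ K * ‖∑ i ∈ Finset.range n, a i • x i‖) : FB x K := by
  classical
  intro a s m
  have hs : s ⊆ Finset.range (max m (s.sup id + 1)) := by
    intro i hi
    have := Finset.le_sup (f := id) hi
    simp at this ⊢
    omega
  have := h (fun i => if i ∈ s then a i else 0) m (max m (s.sup id + 1)) (le_max_left _ _)
  have e1 : ∑ i ∈ Finset.range m, (if i ∈ s then a i else 0) • x i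
      = ∑ i ∈ s.filter (· < m), a i • x i := by
    simp only [ite_smul, zero_smul]
    rw [← Finset.sum_filter]
    apply Finset.sum_congr _ (fun _ _ => rfl)
    ext i; simp [and_comm]
  have e2 : ∑ i ∈ Finset.range (max m (s.sup id + 1)), (if i ∈ s then a i else 0) • x i
      = ∑ i ∈ s, a i • x i := by
    simp only [ite_smul, zero_smul]
    rw [← Finset.sum_filter]
    apply Finset.sum_congr _ (fun _ _ => rfl)
    ext i
    simp only [Finset.mem_filter]
    exact ⟨fun h => h.2, fun h => ⟨hs h, h⟩⟩
  rw [e1, e2] at this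
  exact this

lemma sum_comp_eq (ψ : ℕ → ℕ) (hψ : StrictMono ψ) (x : ℕ → X) (a : ℕ → ℝ) (s : Finset ℕ) :
    ∑ i ∈ s, a i • x (ψ i) = ∑ n ∈ s.image ψ, Function.extend ψ a 0 n • x n := by
  rw [Finset.sum_image (fun _ _ _ _ h => hψ.injective h)]
  simp [hψ.injective.extend_apply]

lemma FB.comp {x : ℕ → X} {K : ℝ} (h : FB x K) {ψ : ℕ → ℕ} (hψ : StrictMono ψ) :
    FB (fun i => x (ψ i)) K := by
  classical
  intro a s m
  have := h (Function.extend ψ a 0) (s.image ψ) (ψ m)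
  rw [← sum_comp_eq ψ hψ, Finset.filter_image] at this
  simp only [hψ.lt_iff_lt] at this
  rw [← sum_comp_eq ψ hψ] at this
  exact this

lemma FB.coeff {x : ℕ → X} {K : ℝ} (h : FB x K) (a : ℕ → ℝ) (s : Finset ℕ) (i : ℕ) (hi : i ∈ s) :
    |a i| * ‖x i‖ ≤ 2 * K * ‖∑ i ∈ s, a i • x i‖ := by
  classical
  have h1 := h a s i
  have h2 := h a s (i+1)
  have e : s.filter (· < i + 1) = insert i (s.filter (· < i)) := by
    ext j
    simp only [Finset.mem_filter, Finset.mem_insert]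
    constructor
    · rintro ⟨h1, h2⟩
      by_cases h3 : j = i
      · exact Or.inl h3
      · exact Or.inr ⟨h1, by omega⟩
    · rintro (rfl | ⟨h1, h2⟩)
      · exact ⟨hi, by omega⟩
      · exact ⟨h1, by omega⟩
  rw [e, Finset.sum_insert (by simp)] at h2
  rw [← Real.norm_eq_abs, ← norm_smul]
  have : a i • x i = (a i • x i + ∑ j ∈ s.filter (· < i), a j • x j)
    - ∑ j ∈ s.filter (· < i), a j • x j := by abel
  rw [this]
  refine (norm_sub_le _ _).trans ?_
  linarith

lemma sum_half_le (S : Finset ℕ) : ∑ t ∈ S, (1/2:ℝ)^t ≤ 2 := by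
  have := summable_geometric_two.sum_le_tsum S (fun i _ => by positivity)
  rw [tsum_geometric_two] at this
  exact this

lemma extract (u : ℕ → X) (hu : WeaklyNull u) (K : ℝ) (hK : 1 ≤ K) (hFB : FB u K)
    (c0 : ℝ) (hc0 : 0 < c0) (hc0u : ∀ n, c0 ≤ ‖u n‖) (δ : ℕ → ℝ) (hδ : ∀ k, 1 ≤ k → 0 < δ k)
    (hN : ∀ k, ∃ N : ℕ, ∀ F : Finset ℕ, F.card = k → (∀ i ∈ F, N ≤ i) → ∀ a : ℕ → ℝ,
      δ k * ∑ i ∈ F, |a i| ≤ ‖∑ i ∈ F, a i • u i‖) (φ T : ℕ → ℕ) (hφ : Monotone φ) :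
    ∃ ψ : ℕ → ℕ, StrictMono ψ ∧ (∀ s, T s ≤ ψ s) ∧ ∀ (a : ℕ → ℝ) (s I : Finset ℕ), I ⊆ s →
      (∀ i ∈ I, I.card ≤ φ i) → (∀ i ∈ I, 0 ≤ a i) →
      δ I.card * ∑ i ∈ I, a i ≤ (1 + K + 8 * K / c0) * ‖∑ i ∈ s, a i • u (ψ i)‖ := by
  classical
  choose N hN using hN
  have hYex : ∀ F : Finset ℕ, ∃ f : X →L[ℝ] ℝ, ‖f‖ ≤ 1 ∧
      ((∀ i ∈ F, N F.card ≤ i) → ∀ i ∈ F, δ F.card ≤ f (u i)) := by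
    intro F
    by_cases h : F.Nonempty ∧ ∀ i ∈ F, N F.card ≤ i
    · obtain ⟨f, h1, h2⟩ := hb_sep u F (δ F.card) (hδ _ h.1.card_pos) (hN _ F rfl h.2)
      exact ⟨f, h1, fun _ => h2⟩
    · refine ⟨0, by simp, fun h1 i hi => ?_⟩
      exact absurd ⟨⟨i, hi⟩, h1⟩ h
  choose Y hY1 hY2 using hYex
  obtain ⟨Z, hZ0, hZ⟩ := exists_Z Y hY1
  obtain ⟨ψ, hψ, hT, hfast⟩ := exists_fast u hu Z hZ φ
    (fun s => max (T s) ((Finset.range (φ s + 1)).sup N))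
  refine ⟨ψ, hψ, fun s => (le_max_left _ _).trans (hT s), ?_⟩
  intro a s I hIs hIφ haI
  set x := ∑ i ∈ s, a i • u (ψ i) with hx
  have hxn := norm_nonneg x
  rcases I.eq_empty_or_nonempty with rfl | hne
  · simp; positivity
  set i0 := I.min' hne with hi0
  have hi0I : i0 ∈ I := I.min'_mem hne
  have hFB' := hFB.comp hψ
  have h1 := hFB' a s i0
  have hsplit := Finset.sum_filter_add_sum_filter_not s (· < i0) (fun i => a i • u (ψ i))
  set x' := ∑ i ∈ s.filter (fun i => ¬ i < i0), a i • u (ψ i) with hx'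
  have hx'n : ‖x'‖ ≤ (1 + K) * ‖x‖ := by
    have : x' = x - ∑ i ∈ s.filter (· < i0), a i • u (ψ i) := by
      rw [hx, ← hsplit]; abel
    rw [this]
    refine (norm_sub_le _ _).trans ?_
    linarith
  have hcardimg : (I.image ψ).card = I.card := Finset.card_image_of_injective _ hψ.injective
  have hYge : ∀ i ∈ I, δ I.card ≤ Y (I.image ψ) (u (ψ i)) := by
    intro i hi
    have := hY2 (I.image ψ) (by
      intro n hn
      obtain ⟨j, hj, rfl⟩ := Finset.mem_image.mp hn
      rw [hcardimg]
      refine le_trans ?_ ((le_max_right _ _).trans (hT j))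
      apply Finset.le_sup
      rw [Finset.mem_range]
      have := hIφ j hj
      omega) (ψ i) (Finset.mem_image_of_mem _ hi)
    rwa [hcardimg] at this
  have hcoef : ∀ i ∈ s, |a i| ≤ 2 * K / c0 * ‖x‖ := by
    intro i hi
    have h2 := hFB'.coeff a s i hi
    have h3 : |a i| * c0 ≤ |a i| * ‖u (ψ i)‖ := by gcongr; exact hc0u _
    rw [div_mul_eq_mul_div, le_div_iff₀ hc0]
    linarith
  set s' := s.filter (fun i => ¬ i < i0) with hs'
  have hIs' : I ⊆ s' := by
    intro i hi
    rw [hs', Finset.mem_filter]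
    refine ⟨hIs hi, ?_⟩
    have := I.min'_le i hi
    omega
  have hval : Y (I.image ψ) x' = ∑ i ∈ s' \ I, a i * Y (I.image ψ) (u (ψ i))
      + ∑ i ∈ I, a i * Y (I.image ψ) (u (ψ i)) := by
    rw [Finset.sum_sdiff hIs', hx', map_sum]
    simp
  have hmain : δ I.card * ∑ i ∈ I, a i ≤ ∑ i ∈ I, a i * Y (I.image ψ) (u (ψ i)) := by
    rw [Finset.mul_sum]
    apply Finset.sum_le_sum
    intro i hi
    rw [mul_comm]
    exact mul_le_mul_of_nonneg_left (hYge i hi) (haI i hi)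
  have herr : |∑ i ∈ s' \ I, a i * Y (I.image ψ) (u (ψ i))| ≤ 2 * K / c0 * ‖x‖ * 4 := by
    refine (Finset.abs_sum_le_sum_abs _ _).trans ?_
    calc ∑ i ∈ s' \ I, |a i * Y (I.image ψ) (u (ψ i))|
        ≤ ∑ i ∈ s' \ I, 2 * K / c0 * ‖x‖ * 2 * (1/2:ℝ)^i := by
          apply Finset.sum_le_sum
          intro i hi
          rw [Finset.mem_sdiff, hs', Finset.mem_filter] at hi
          rw [abs_mul]
          have h5 := fast_small u Z φ ψ hfast I hIφ i hi.2
            ((hIφ i0 hi0I).trans (hφ (by omega)))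
          rw [hZ0] at h5
          have h6 := hcoef i hi.1.1
          calc _ ≤ (2 * K / c0 * ‖x‖) * (2 * (1/2:ℝ)^i) :=
                mul_le_mul h6 h5 (abs_nonneg _) ((abs_nonneg _).trans h6)
            _ = _ := by ring
      _ = 2 * K / c0 * ‖x‖ * 2 * ∑ i ∈ s' \ I, (1/2:ℝ)^i := by rw [Finset.mul_sum]
      _ ≤ 2 * K / c0 * ‖x‖ * 2 * 2 := by
          gcongr
          exact sum_half_le _
      _ = _ := by ring
  have hub : Y (I.image ψ) x' ≤ (1 + K) * ‖x‖ := by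
    refine (le_abs_self _).trans ?_
    have := (Y (I.image ψ)).le_opNorm x'
    rw [Real.norm_eq_abs] at this
    have h7 : ‖Y (I.image ψ)‖ * ‖x'‖ ≤ 1 * ‖x'‖ := by gcongr; exact hY1 _
    linarith
  have h8 := (abs_le.mp herr).1
  have h9 : (1 + K + 8 * K / c0) * ‖x‖ = (1 + K) * ‖x‖ + 2 * K / c0 * ‖x‖ * 4 := by ring
  rw [h9]
  linarith

lemma extract_signed (u : ℕ → X) (hu : WeaklyNull u) (K : ℝ) (hK : 1 ≤ K) (hFB : FB u K)
    (c0 : ℝ) (hc0 : 0 < c0) (hc0u : ∀ n, c0 ≤ ‖u n‖) {p c : ℝ} (hp : 0 < p) (hc : 0 < c)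
    (hN : ∀ k, ∃ N : ℕ, ∀ F : Finset ℕ, F.card = k → (∀ i ∈ F, N ≤ i) → ∀ a : ℕ → ℝ,
      c / (2 * flog k ^ p) * ∑ i ∈ F, |a i| ≤ ‖∑ i ∈ F, a i • u i‖)
    (φ T : ℕ → ℕ) (hφ : Monotone φ) :
    ∃ ψ : ℕ → ℕ, StrictMono ψ ∧ (∀ s, T s ≤ ψ s) ∧ ∀ (a : ℕ → ℝ) (s I : Finset ℕ), I ⊆ s →
      (∀ i ∈ I, I.card ≤ φ i) →
      ∑ i ∈ I, |a i| ≤ 4 * (1 + K + 8 * K / c0) / c * flog I.card ^ p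
        * ‖∑ i ∈ s, a i • u (ψ i)‖ := by
  classical
  obtain ⟨ψ, h1, h2, h3⟩ := extract u hu K hK hFB c0 hc0 hc0u (fun k => c / (2 * flog k ^ p))
    (fun k hk => by have := gp_one_le hp hk; positivity) hN φ T hφ
  refine ⟨ψ, h1, h2, fun a s I hI hIφ => ?_⟩
  have half : ∀ (b : ℕ → ℝ) (J : Finset ℕ), J ⊆ I → (∀ i ∈ J, 0 ≤ b i) →
      ∑ i ∈ J, b i ≤ 2 * (1 + K + 8 * K / c0) / c * flog I.card ^ p
        * ‖∑ i ∈ s, b i • u (ψ i)‖ := by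
    intro b J hJ hb
    have hg0 : 0 ≤ flog I.card ^ p := Real.rpow_nonneg (flog_nonneg _) _
    rcases J.eq_empty_or_nonempty with rfl | hne
    · simp; positivity
    have hc1 := Finset.card_le_card hJ
    have h4 := h3 b s J (hJ.trans hI) (fun i hi => hc1.trans (hIφ i (hJ hi))) hb
    have hg := gp_one_le hp (l := J.card) hne.card_pos
    have hg2 := gp_mono hp hc1
    have h5 : ∑ i ∈ J, b i ≤ 2 * (1 + K + 8 * K / c0) / c * flog J.card ^ p
        * ‖∑ i ∈ s, b i • u (ψ i)‖ := by
      rw [div_mul_eq_mul_div, div_le_iff₀ (by positivity)] at h4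
      rw [div_mul_eq_mul_div, div_mul_eq_mul_div, le_div_iff₀ hc]
      linarith
    refine h5.trans ?_
    gcongr
  have hP := half a (I.filter (fun i => 0 ≤ a i)) (Finset.filter_subset _ _)
    (fun i hi => (Finset.mem_filter.mp hi).2)
  have hM := half (fun i => - a i) (I.filter (fun i => ¬ 0 ≤ a i)) (Finset.filter_subset _ _)
    (fun i hi => by have := (Finset.mem_filter.mp hi).2; linarith)
  have e1 : ∑ i ∈ s, (- a i) • u (ψ i) = - ∑ i ∈ s, a i • u (ψ i) := by
    simp
  rw [e1, norm_neg] at hM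
  rw [← Finset.sum_filter_add_sum_filter_not I (fun i => 0 ≤ a i)]
  have e2 : ∑ i ∈ I.filter (fun i => 0 ≤ a i), |a i| = ∑ i ∈ I.filter (fun i => 0 ≤ a i), a i :=
    Finset.sum_congr rfl (fun i hi => abs_of_nonneg (Finset.mem_filter.mp hi).2)
  have e3 : ∑ i ∈ I.filter (fun i => ¬ 0 ≤ a i), |a i|
      = ∑ i ∈ I.filter (fun i => ¬ 0 ≤ a i), - a i :=
    Finset.sum_congr rfl (fun i hi => abs_of_neg (not_le.mp (Finset.mem_filter.mp hi).2))
  rw [e2, e3]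
  refine (add_le_add hP hM).trans (le_of_eq ?_)
  ring

lemma exists_level (t : ℝ) (h0 : 0 < t) (h1 : t ≤ 1/4) :
    ∃ m : ℕ, (1/4:ℝ)^(2^(m+1)) < t ∧ t ≤ (1/4:ℝ)^(2^m) := by
  classical
  have hex : ∃ m : ℕ, (1/4:ℝ)^(2^(m+1)) < t := by
    obtain ⟨n, hn⟩ := exists_pow_lt_of_lt_one h0 (by norm_num : (1/4:ℝ) < 1)
    refine ⟨n, lt_of_le_of_lt ?_ hn⟩
    apply pow_le_pow_of_le_one (by norm_num) (by norm_num)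
    exact (Nat.lt_two_pow_self).le.trans (Nat.pow_le_pow_right (by norm_num) (by omega))
  refine ⟨Nat.find hex, Nat.find_spec hex, ?_⟩
  rcases h : Nat.find hex with _ | m
  · simpa using h1
  · have := Nat.find_min hex (m := m) (by omega)
    exact not_lt.mp this

lemma exists_r (D p : ℝ) (hD : 0 < D) :
    ∃ r : ℕ, 8 ≤ r ∧ ∀ z : ℝ, (r:ℝ) ≤ z → D * (2 * z)^p < (2:ℝ)^(z/2) := by
  have h := isLittleO_rpow_exp_pos_mul_atTop p (b := Real.log 2 / 4)
    (by have := Real.log_pos (by norm_num : (1:ℝ) < 2); positivity)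
  have h2 := h.bound (c := 1 / (2 * D)) (by positivity)
  rw [Filter.eventually_atTop] at h2
  obtain ⟨z0, hz0⟩ := h2
  refine ⟨max 8 (Nat.ceil z0), le_max_left _ _, fun z hz => ?_⟩
  have hz8 : (8:ℝ) ≤ z := le_trans (by exact_mod_cast le_max_left _ _) hz
  have hzz : z0 ≤ z := (Nat.le_ceil z0).trans (le_trans (by exact_mod_cast le_max_right _ _) hz)
  have := hz0 (2 * z) (by linarith)
  rw [Real.norm_of_nonneg (by positivity), Real.norm_of_nonneg (by positivity)] at this
  have e : (2:ℝ)^(z/2) = Real.exp (Real.log 2 / 4 * (2 * z)) := by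
    rw [Real.rpow_def_of_pos (by norm_num)]; congr 1; ring
  rw [e]
  calc D * (2*z)^p ≤ D * (1 / (2 * D) * Real.exp (Real.log 2 / 4 * (2 * z))) := by gcongr
    _ = Real.exp (Real.log 2 / 4 * (2 * z)) / 2 := by field_simp
    _ < _ := by
      have := Real.exp_pos (Real.log 2 / 4 * (2 * z))
      linarith

lemma flog_phi (r m : ℕ) (hr : 8 ≤ r) : flog ((2^(r * 2^m) : ℕ)) ≤ 2 * (r * 2^m) := by
  unfold flog
  have h1 : ((2^(r*2^m) : ℕ) : ℝ) + 1 ≤ (2:ℝ)^(r*2^m+1) := by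
    push_cast
    rw [pow_succ]
    have : (1:ℝ) ≤ 2^(r*2^m) := one_le_pow₀ (by norm_num)
    linarith
  have h2 := Real.logb_le_logb_of_le (b := 2) (by norm_num) (by positivity) h1
  refine h2.trans ?_
  rw [Real.logb_pow, Real.logb_self_eq_one (by norm_num)]
  have h3 : 1 ≤ r * 2^m := Nat.one_le_iff_ne_zero.mpr (by positivity)
  have : (1:ℝ) ≤ r * 2^m := by exact_mod_cast h3
  push_cast
  linarith

lemma flog_R (m : ℕ) : (2:ℝ)^m ≤ flog ((2^(2^m) + 1 : ℕ)) := by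
  unfold flog
  have h2 := Real.logb_le_logb_of_le (b := 2) (x := (2:ℝ)^(2^m)) (y := ((2^(2^m)+1 : ℕ):ℝ) + 1)
    (by norm_num) (by positivity) (by push_cast; linarith)
  rw [Real.logb_pow, Real.logb_self_eq_one (by norm_num)] at h2
  simpa using h2

end

section
variable {X E G : Type*} [NormedAddCommGroup X] [NormedSpace ℝ X]
    [NormedAddCommGroup E] [NormedSpace ℝ E] [NormedAddCommGroup G] [NormedSpace ℝ G]

lemma dominate (u w : ℕ → X) (ut : ℕ → E) (wt : ℕ → G)
    (K : ℝ) (hK : 1 ≤ K) (hFB : FB u K) (c0 B W : ℝ) (hc0 : 0 < c0)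
    (hc0u : ∀ n, c0 ≤ ‖u n‖) (hB : ∀ n, ‖u n‖ ≤ B) (hW : ∀ n, ‖w n‖ ≤ W)
    (hu : WeaklyNull u) (hus : HasSpreadingModel u ut) (hws : HasSpreadingModel w wt)
    (p q : ℝ) (hp : 0 < p) (hpq : p < q) (c C : ℝ) (hc : 0 < c) (hC : 0 < C)
    (hulow : ∀ a : ℕ →₀ ℝ,
      c * gnorm (fun l => flog l ^ p) a ≤ ‖∑ n ∈ a.support, a n • ut n‖)
    (hwup : ∀ a : ℕ →₀ ℝ,
      ‖∑ n ∈ a.support, a n • wt n‖ ≤ C * tnorm (fun l => flog l ^ q) a) :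
    ∃ ψ : ℕ → ℕ, StrictMono ψ ∧ ∃ D : ℝ, 0 ≤ D ∧ ∀ (a : ℕ → ℝ) (s : Finset ℕ),
      ‖∑ i ∈ s, a i • w (ψ i)‖ ≤ D * ‖∑ i ∈ s, a i • u (ψ i)‖ := by
  classical
  have hW0 : 0 ≤ W := (norm_nonneg _).trans (hW 0)
  have hq : 0 < q := hp.trans hpq
  set D0 : ℝ := 4 * (1 + K + 8 * K / c0) / c with hD0
  have hD0p : 0 < D0 := by positivity
  set η : ℝ := c0 / (8 * K) with hη
  have hηp : 0 < η := by positivity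
  set D1 : ℝ := D0 * η with hD1
  have hD1p : 0 < D1 := by positivity
  obtain ⟨r, hr8, hr⟩ := exists_r D1 p hD1p
  set φ : ℕ → ℕ := fun m => 2^(r * 2^m) with hφ
  have hφmono : Monotone φ := by
    intro a b hab
    apply Nat.pow_le_pow_right (by norm_num)
    apply Nat.mul_le_mul_left
    exact Nat.pow_le_pow_right (by norm_num) hab
  choose Nw hNw using sm_upper w wt hws W hW hq hC hwup
  obtain ⟨ψ, hψ, hT, hex⟩ := extract_signed u hu K hK hFB c0 hc0 hc0u hp hc
    (sm_lower u ut hus B hB hp hc hulow) φ (fun s => (Finset.range (φ s + 1)).sup Nw) hφmono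
  set β : ℕ → ℝ := fun m => (W + 1 + C) * (1/2:ℝ)^m
    + C * (D1 * (2 * r : ℝ)^p) * ((2:ℝ)^(p-q))^m with hβ
  have hβ0 : ∀ m, 0 ≤ β m := fun m => by positivity
  have hβs : Summable β := by
    apply Summable.add
    · exact summable_geometric_two.mul_left _
    · apply Summable.mul_left
      apply summable_geometric_of_lt_one (by positivity)
      exact Real.rpow_lt_one_of_one_lt_of_neg (by norm_num) (by linarith)
  -- main estimate
  have main : ∀ (a : ℕ → ℝ) (s : Finset ℕ), ‖∑ i ∈ s, a i • u (ψ i)‖ ≤ η →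
      ‖∑ i ∈ s, a i • w (ψ i)‖ ≤ ∑' m, β m := by
    intro a s hx
    have hcoef : ∀ i ∈ s, |a i| ≤ 1/4 := by
      intro i hi
      have h2 := (hFB.comp hψ).coeff a s i hi
      have h3 : |a i| * c0 ≤ |a i| * ‖u (ψ i)‖ := by gcongr; exact hc0u _
      have h4 : 2 * K * ‖∑ i ∈ s, a i • u (ψ i)‖ ≤ 2 * K * η := by gcongr
      have h5 : 2 * K * η = c0 / 4 := by rw [hη]; field_simp; norm_num
      have h6 : |a i| * c0 ≤ 1/4 * c0 := by linarith
      exact le_of_mul_le_mul_right h6 hc0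
    have hexx : ∀ I : Finset ℕ, I ⊆ s → (∀ i ∈ I, I.card ≤ φ i) →
        ∑ i ∈ I, |a i| ≤ D1 * flog I.card ^ p := by
      intro I hI hIφ
      have hg0 : 0 ≤ flog I.card ^ p := Real.rpow_nonneg (flog_nonneg _) _
      calc _ ≤ D0 * flog I.card ^ p * ‖∑ i ∈ s, a i • u (ψ i)‖ := hex a s I hI hIφ
        _ ≤ D0 * flog I.card ^ p * η := by gcongr
        _ = _ := by rw [hD1]; ring
    -- levels
    have hlev : ∀ i, ∃ m : ℕ, i ∈ s.filter (fun i => a i ≠ 0) →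
        (1/4:ℝ)^(2^(m+1)) < |a i| ∧ |a i| ≤ (1/4:ℝ)^(2^m) := by
      intro i
      by_cases hi : i ∈ s.filter (fun i => a i ≠ 0)
      · rw [Finset.mem_filter] at hi
        obtain ⟨m, hm⟩ := exists_level (|a i|) (abs_pos.mpr hi.2) (hcoef i hi.1)
        exact ⟨m, fun _ => hm⟩
      · exact ⟨0, fun h => absurd h hi⟩
    choose lev hlev using hlev
    set s0 := s.filter (fun i => a i ≠ 0) with hs0
    have e0 : ∑ i ∈ s, a i • w (ψ i) = ∑ i ∈ s0, a i • w (ψ i) := by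
      symm
      apply Finset.sum_subset (Finset.filter_subset _ _)
      intro i hi hi0
      have : a i = 0 := by
        by_contra h
        exact hi0 (Finset.mem_filter.mpr ⟨hi, h⟩)
      rw [this, zero_smul]
    rw [e0, ← Finset.sum_fiberwise_of_maps_to (g := lev) (t := s0.image lev)
      (fun i hi => Finset.mem_image_of_mem _ hi)]
    refine le_trans ?_ (hβs.sum_le_tsum (s0.image lev) (fun m _ => hβ0 m))
    apply norm_sum_le_of_le
    intro m _
    -- one level
    set F := s0.filter (fun i => lev i = m) with hF
    set M : ℝ := (1/4:ℝ)^(2^m) with hM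
    have hM0 : 0 < M := by positivity
    have hFs : F ⊆ s := (Finset.filter_subset _ _).trans (Finset.filter_subset _ _)
    have hFl : ∀ i ∈ F, (1/4:ℝ)^(2^(m+1)) < |a i| ∧ |a i| ≤ M := by
      intro i hi
      rw [hF, Finset.mem_filter] at hi
      have := hlev i hi.1
      rw [hi.2] at this
      exact this
    rw [← Finset.sum_filter_add_sum_filter_not F (· < m)]
    have hlow : ‖∑ i ∈ F.filter (· < m), a i • w (ψ i)‖ ≤ m * (M * W) := by
      have h1 : ‖∑ i ∈ F.filter (· < m), a i • w (ψ i)‖ ≤ ∑ i ∈ F.filter (· < m), M * W := by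
        apply norm_sum_le_of_le
        intro i hi
        rw [norm_smul, Real.norm_eq_abs]
        exact mul_le_mul (hFl i (Finset.mem_filter.mp hi).1).2 (hW _) (norm_nonneg _) hM0.le
      refine h1.trans ?_
      rw [Finset.sum_const, nsmul_eq_mul]
      gcongr
      have : F.filter (· < m) ⊆ Finset.range m := by
        intro i hi; rw [Finset.mem_range]; exact (Finset.mem_filter.mp hi).2
      simpa using Finset.card_le_card this
    set H := F.filter (fun i => ¬ i < m) with hH
    have hHF : H ⊆ F := Finset.filter_subset _ _
    have hHm : ∀ i ∈ H, m ≤ i := fun i hi => not_lt.mp (Finset.mem_filter.mp hi).2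
    have hflφ : flog (φ m : ℕ) ^ p ≤ (2 * (r * 2^m) : ℝ)^p :=
      Real.rpow_le_rpow (flog_nonneg _) (flog_phi r m hr8) hp.le
    have h2m : (1:ℝ) ≤ 2^m := one_le_pow₀ (by norm_num)
    have hr8' : (8:ℝ) ≤ r := by exact_mod_cast hr8
    have hHcard : H.card ≤ φ m := by
      by_contra hlt
      push Not at hlt
      obtain ⟨I, hIH, hIc⟩ := Finset.exists_subset_card_eq hlt.le
      have h1 := hexx I ((hIH.trans hHF).trans hFs)
        (fun i hi => by rw [hIc]; exact hφmono (hHm i (hIH hi)))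
      have h2 : (φ m : ℝ) * (1/4:ℝ)^(2^(m+1)) ≤ ∑ i ∈ I, |a i| := by
        rw [← hIc, ← nsmul_eq_mul]
        apply Finset.card_nsmul_le_sum
        intro i hi
        exact (hFl i (hHF (hIH hi))).1.le
      rw [hIc] at h1
      have h3 := hr (r * 2^m) (by nlinarith)
      have h4 : (2:ℝ)^((r * 2^m : ℝ)/2) ≤ (φ m : ℝ) * (1/4:ℝ)^(2^(m+1)) := by
        have e1 : (φ m : ℝ) = (2:ℝ)^((r:ℝ) * 2^m) := by
          rw [hφ]; push_cast
          rw [← Real.rpow_natCast]; push_cast; rfl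
        have e2 : (1/4:ℝ)^(2^(m+1)) = (2:ℝ)^(-(4 * 2^m) : ℝ) := by
          rw [show (1/4:ℝ) = (2:ℝ)^(-2:ℝ) by
            rw [Real.rpow_neg (by norm_num)]; norm_num]
          rw [← Real.rpow_mul_natCast (by norm_num)]
          congr 1
          push_cast; rw [pow_succ]; ring
        rw [e1, e2, ← Real.rpow_add (by norm_num)]
        apply Real.rpow_le_rpow_of_exponent_le (by norm_num)
        nlinarith
      have h5 : D1 * flog (φ m : ℕ) ^ p ≤ D1 * (2 * (r * 2^m) : ℝ)^p := by gcongr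
      linarith
    have hHsum : ∑ i ∈ H, |a i| ≤ D1 * (2 * (r * 2^m) : ℝ)^p := by
      refine (hexx H (hHF.trans hFs) (fun i hi => hHcard.trans (hφmono (hHm i hi)))).trans ?_
      have := (gp_mono hp hHcard).trans hflφ
      gcongr
    have hhigh : ‖∑ i ∈ H, a i • w (ψ i)‖ ≤
        M + C * ((2^(2^m) : ℕ) * M + (∑ i ∈ H, |a i|) / flog (2^(2^m) + 1 : ℕ) ^ q) := by
      have h1 := hNw H.card (H.image ψ) (Finset.card_image_of_injective _ hψ.injective)
        (by
          intro n hn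
          obtain ⟨j, hj, rfl⟩ := Finset.mem_image.mp hn
          refine le_trans ?_ (hT j)
          apply Finset.le_sup
          rw [Finset.mem_range]
          have := hHcard.trans (hφmono (hHm j hj))
          omega) (Function.extend ψ a 0) M hM0.le
        (by
          intro n hn
          obtain ⟨j, hj, rfl⟩ := Finset.mem_image.mp hn
          rw [hψ.injective.extend_apply]
          exact (hFl j (hHF hj)).2) (2^(2^m))
      rw [← sum_comp_eq ψ hψ, Finset.sum_image (fun _ _ _ _ h => hψ.injective h)] at h1
      simp only [hψ.injective.extend_apply] at h1
      exact h1
    have hm2 : m ≤ 2^m := Nat.lt_two_pow_self.le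
    have hM1 : M ≤ (1/2:ℝ)^m := by
      calc M ≤ (1/4:ℝ)^m := pow_le_pow_of_le_one (by norm_num) (by norm_num) hm2
        _ ≤ _ := by gcongr; norm_num
    have hM2 : m * M ≤ (1/2:ℝ)^m := by
      calc m * M ≤ (2:ℝ)^m * (1/4:ℝ)^m := by
            gcongr
            · exact_mod_cast hm2
            · exact pow_le_pow_of_le_one (by norm_num) (by norm_num) hm2
        _ = _ := by rw [← mul_pow]; norm_num
    have hM3 : ((2^(2^m) : ℕ):ℝ) * M ≤ (1/2:ℝ)^m := by
      push_cast
      rw [hM, ← mul_pow]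
      norm_num only
      exact pow_le_pow_of_le_one (by norm_num) (by norm_num) hm2
    have hM4 : (∑ i ∈ H, |a i|) / flog (2^(2^m) + 1 : ℕ) ^ q ≤
        D1 * (2 * r : ℝ)^p * ((2:ℝ)^(p-q))^m := by
      have h1 : ((2:ℝ)^m)^q ≤ flog (2^(2^m) + 1 : ℕ) ^ q :=
        Real.rpow_le_rpow (by positivity) (flog_R m) hq.le
      calc _ ≤ (D1 * (2 * (r * 2^m) : ℝ)^p) / ((2:ℝ)^m)^q := by
            apply div_le_div₀ (by positivity) hHsum (by positivity) h1
        _ = _ := by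
            rw [← mul_assoc, Real.mul_rpow (by positivity) (by positivity)]
            rw [Real.rpow_pow_comm (by norm_num), Real.rpow_sub (by positivity)]
            ring
    refine (norm_add_le _ _).trans ((add_le_add hlow hhigh).trans ?_)
    have h9 : (m:ℝ) * (M * W) ≤ W * (1/2:ℝ)^m := by
      calc (m:ℝ) * (M * W) = W * (m * M) := by ring
        _ ≤ _ := by gcongr
    have h10 : C * (((2^(2^m) : ℕ):ℝ) * M + (∑ i ∈ H, |a i|) / flog (2^(2^m) + 1 : ℕ) ^ q)
        ≤ C * ((1/2:ℝ)^m + D1 * (2 * r : ℝ)^p * ((2:ℝ)^(p-q))^m) := by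
      gcongr
    have h11 : β m = W * (1/2:ℝ)^m + ((1/2:ℝ)^m
        + C * ((1/2:ℝ)^m + D1 * (2 * r : ℝ)^p * ((2:ℝ)^(p-q))^m)) := by
      rw [hβ]; ring
    rw [h11]
    linarith
  have hS0 : 0 ≤ ∑' m, β m := tsum_nonneg hβ0
  refine ⟨ψ, hψ, (∑' m, β m) / η, by positivity, fun a s => ?_⟩
  apply le_of_forall_pos_le_add
  intro ε hε
  set S := ∑' m, β m with hS
  set x := ∑ i ∈ s, a i • u (ψ i) with hx
  set t : ℝ := (‖x‖ + ε / (S / η + 1)) / η with ht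
  have htp : 0 < t := by positivity
  have hmain := main (fun i => t⁻¹ * a i) s (by
    simp only [mul_smul]
    rw [← Finset.smul_sum, norm_smul, norm_inv, Real.norm_of_nonneg htp.le,
      inv_mul_le_iff₀ htp, ht, div_mul_cancel₀ _ hηp.ne']
    have : 0 ≤ ε / (S / η + 1) := by positivity
    linarith)
  simp only [mul_smul] at hmain
  rw [← Finset.smul_sum, norm_smul, norm_inv, Real.norm_of_nonneg htp.le,
      inv_mul_le_iff₀ htp] at hmain
  refine hmain.trans ?_
  have e : t * S = S / η * ‖x‖ + (S / η) / (S/η+1) * ε := by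
    rw [ht]; ring
  rw [e]
  have : (S / η) / (S/η+1) ≤ 1 := by
    rw [div_le_one (by positivity)]; linarith
  have : (S / η) / (S/η+1) * ε ≤ 1 * ε := by gcongr
  linarith

lemma HasSpreadingModel.comp {x : ℕ → X} {xt : ℕ → E} (h : HasSpreadingModel x xt) {ψ : ℕ → ℕ}
    (hψ : StrictMono ψ) : HasSpreadingModel (fun n => x (ψ n)) xt := by
  intro k a ε hε
  obtain ⟨N, hN⟩ := h k a ε hε
  exact ⟨N, fun n hn hnN => hN (fun i => ψ (n i)) (hψ.comp hn)
    (fun i => (hnN i).trans (hψ.id_le _))⟩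

end

theorem exists_subseq_equivalent {X E F G : Type*}
    [NormedAddCommGroup X] [NormedSpace ℝ X] [CompleteSpace X]
    [NormedAddCommGroup E] [NormedSpace ℝ E]
    [NormedAddCommGroup F] [NormedSpace ℝ F]
    [NormedAddCommGroup G] [NormedSpace ℝ G]
    (u v : ℕ → X) (ut : ℕ → E) (vt : ℕ → F) (wt : ℕ → G)
    (husn : Seminormalized u) (hvsn : Seminormalized v)
    (hwsn : Seminormalized (fun n => u n - v n))
    (hub : IsBasicSeq u) (hvb : IsBasicSeq v) (hwb : IsBasicSeq (fun n => u n - v n))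
    (huw : WeaklyNull u) (hvw : WeaklyNull v) (hww : WeaklyNull (fun n => u n - v n))
    (hus : HasSpreadingModel u ut) (hvs : HasSpreadingModel v vt)
    (hws : HasSpreadingModel (fun n => u n - v n) wt)
    (p q : ℝ) (hp : 0 < p) (hpq : p < q)
    (c C : ℝ) (hc : 0 < c) (hC : 0 < C)
    (hulow : ∀ a : ℕ →₀ ℝ,
      c * gnorm (fun l => flog l ^ p) a ≤ ‖∑ n ∈ a.support, a n • ut n‖)
    (hvlow : ∀ a : ℕ →₀ ℝ,
      c * gnorm (fun l => flog l ^ p) a ≤ ‖∑ n ∈ a.support, a n • vt n‖)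
    (hwup : ∀ a : ℕ →₀ ℝ,
      ‖∑ n ∈ a.support, a n • wt n‖ ≤ C * tnorm (fun l => flog l ^ q) a) :
    ∃ φ : ℕ → ℕ, StrictMono φ ∧
      SeqEquiv (fun k => u (φ k)) (fun k => v (φ k)) := by
  obtain ⟨cu, Cu, hcu, hu2⟩ := husn
  obtain ⟨cv, Cv, hcv, hv2⟩ := hvsn
  obtain ⟨cw, Cw, hcw, hw2⟩ := hwsn
  obtain ⟨_, Ku, hKu, hub⟩ := hub
  obtain ⟨_, Kv, hKv, hvb⟩ := hvb
  obtain ⟨ψ₁, h₁, D₁, hD₁, hd₁⟩ := dominate u (fun n => u n - v n) ut wt Ku hKu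
    (fb_of_basic u Ku hub) cu Cu Cw hcu (fun n => (hu2 n).1) (fun n => (hu2 n).2)
    (fun n => (hw2 n).2) huw hus hws p q hp hpq c C hc hC hulow hwup
  obtain ⟨ψ₂, h₂, D₂, hD₂, hd₂⟩ := dominate (fun n => v (ψ₁ n)) (fun n => u (ψ₁ n) - v (ψ₁ n))
    vt wt Kv hKv ((fb_of_basic v Kv hvb).comp h₁) cv Cv Cw hcv (fun n => (hv2 _).1)
    (fun n => (hv2 _).2) (fun n => (hw2 _).2) (fun f => (hvw f).comp h₁.tendsto_atTop)
    (hvs.comp h₁) (hws.comp h₁) p q hp hpq c C hc hC hvlow hwup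
  refine ⟨fun k => ψ₁ (ψ₂ k), h₁.comp h₂, 1 / (1 + D₂), 1 + D₁, by positivity, fun a s => ?_⟩
  have hA := hd₁ (Function.extend ψ₂ a 0) (s.image ψ₂)
  rw [← sum_comp_eq ψ₂ h₂ (fun n => u (ψ₁ n) - v (ψ₁ n)),
    ← sum_comp_eq ψ₂ h₂ (fun n => u (ψ₁ n))] at hA
  have hB := hd₂ a s
  simp only [smul_sub, Finset.sum_sub_distrib] at hA hB
  set x := ∑ n ∈ s, a n • u (ψ₁ (ψ₂ n)) with hx
  set y := ∑ n ∈ s, a n • v (ψ₁ (ψ₂ n)) with hy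
  constructor
  · rw [one_div, inv_mul_le_iff₀ (by positivity)]
    have : x = y + (x - y) := by abel
    calc ‖x‖ = ‖y + (x - y)‖ := by rw [← this]
      _ ≤ ‖y‖ + ‖x - y‖ := norm_add_le _ _
      _ ≤ _ := by linarith
  · have : y = x - (x - y) := by abel
    calc ‖y‖ = ‖x - (x - y)‖ := by rw [← this]
      _ ≤ ‖x‖ + ‖x - y‖ := norm_sub_le _ _
      _ ≤ _ := by linarith
end

section
/- There exists an infinite-dimensional Banach space with a Schauder basis such that every block subspace contains a block sequence (y_n)_{n≥1} with (y_{2n})_{n≥1} equivalent to (y_{2n+1})_{n≥1}, and yet no block sequence of the basis is asymptotically unconditional. -/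
/-- A block sequence `(x_n)` of the basis `(e_n)` is asymptotically unconditional: there is
`C ≥ 1` such that for every `k` and all successive blocks `k < z₁ < … < z_k` of `(x_n)`
(with supports, in terms of the basis `(e_n)`, beyond `k`), the sequence `(z_i)` is
`C`-unconditional. -/
def AsympUncondBlockSeq {X : Type*} [NormedAddCommGroup X] [NormedSpace ℝ X]
    (e x : ℕ → X) : Prop :=
  ∃ C : ℝ, 1 ≤ C ∧ ∀ (k : ℕ) (z : Fin k → X),
    (∀ i, z i ≠ 0) →
    -- the `z_i` are successive blocks of `(x_n)`
    (∃ (I : Fin k → Finset ℕ) (a : Fin k → ℕ → ℝ),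
      (∀ i, z i = ∑ j ∈ I i, a i j • x j) ∧
      (∀ i i' : Fin k, i < i' → ∀ s ∈ I i, ∀ t ∈ I i', s < t)) →
    -- with supports (with respect to the basis `(e_n)`) beyond `k`
    (∃ (J : Fin k → Finset ℕ) (b : Fin k → ℕ → ℝ),
      (∀ i, z i = ∑ j ∈ J i, b i j • e j) ∧
      (∀ i i' : Fin k, i < i' → ∀ s ∈ J i, ∀ t ∈ J i', s < t) ∧
      (∀ i, ∀ j ∈ J i, k < j)) →
    ∀ (a εs : Fin k → ℝ), (∀ i, εs i = 1 ∨ εs i = -1) →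
      ‖∑ i, (εs i * a i) • z i‖ ≤ C * ‖∑ i, a i • z i‖


namespace EqPairs

/-! ### Parameters -/

def ee (j : ℕ) : ℕ := 4 ^ (j + 1)
def mm (j : ℕ) : ℕ := 2 ^ ee j
def np : ℕ → ℕ
  | 0 => 1
  | j + 1 => (16 * np j * mm j) ^ (ee j + 2)
def MM (j : ℕ) : ℕ := 16 * np j * mm j
def nn (j : ℕ) : ℕ := MM j ^ (ee j + 2)
def BB (j : ℕ) : ℕ := (7 * np j) ^ ee j

lemma np_succ (j : ℕ) : np (j + 1) = nn j := rfl

lemma mm_pos (j : ℕ) : 0 < mm j := by unfold mm; positivity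

lemma ee_ge (j : ℕ) : 4 ≤ ee j := by
  unfold ee
  calc 4 = 4 ^ 1 := by norm_num
    _ ≤ 4 ^ (j + 1) := Nat.pow_le_pow_right (by norm_num) (by omega)

lemma mm_ge (j : ℕ) : 16 ≤ mm j := by
  unfold mm
  calc 16 = 2 ^ 4 := by norm_num
    _ ≤ 2 ^ ee j := Nat.pow_le_pow_right (by norm_num) (ee_ge j)

lemma mm_mono : Monotone mm := by
  intro a b h
  unfold mm ee
  exact Nat.pow_le_pow_right (by norm_num) (Nat.pow_le_pow_right (by norm_num) (by omega))

lemma le_four_pow (t : ℕ) : t + 1 ≤ 4 ^ t := by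
  induction t with
  | zero => simp
  | succ k ih => rw [pow_succ]; omega

lemma mul_two_pow_le_mm (t : ℕ) : t * 2 ^ t ≤ mm t := by
  unfold mm ee
  calc t * 2 ^ t ≤ 2 ^ t * 2 ^ t := Nat.mul_le_mul_right _ Nat.lt_two_pow_self.le
    _ = 2 ^ (t + t) := by rw [pow_add]
    _ ≤ 2 ^ (4 ^ (t + 1)) := by
      apply Nat.pow_le_pow_right (by norm_num)
      have := le_four_pow t
      rw [pow_succ]; omega

lemma mm_sq_le {j t : ℕ} (h : j < t) : 4 * (t + 1) * mm j ^ 2 ≤ mm t := by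
  obtain ⟨s, rfl⟩ : ∃ s, t = s + 1 := ⟨t - 1, by omega⟩
  have h1 : mm j ≤ mm s := mm_mono (by omega)
  have h2 : 4 * (s + 1 + 1) ≤ 2 ^ (2 * ee s) := by
    have : s + 1 + 1 ≤ 2 ^ (s + 2) := Nat.lt_two_pow_self.le
    calc 4 * (s + 1 + 1) ≤ 2 ^ 2 * 2 ^ (s + 2) := by omega
      _ = 2 ^ (2 + (s + 2)) := by rw [pow_add 2 2]
      _ ≤ _ := by
        apply Nat.pow_le_pow_right (by norm_num)
        have := le_four_pow s
        unfold ee; rw [pow_succ]; omega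
  calc 4 * (s + 1 + 1) * mm j ^ 2 ≤ 2 ^ (2 * ee s) * mm s ^ 2 := by gcongr
    _ = mm (s + 1) := by
      unfold mm
      rw [← pow_mul, ← pow_add]
      congr 1
      unfold ee; ring

lemma np_pos (j : ℕ) : 0 < np j := by
  induction j with
  | zero => simp [np]
  | succ k ih => have := mm_pos k; simp only [np]; positivity

lemma MM_pos (j : ℕ) : 0 < MM j := by
  have := np_pos j; have := mm_pos j; unfold MM; positivity

lemma nn_pos (j : ℕ) : 0 < nn j := by
  have := MM_pos j; unfold nn; positivity

lemma mm_le_MM (j : ℕ) : mm j ≤ MM j := by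
  have := np_pos j
  unfold MM
  exact Nat.le_mul_of_pos_left _ (by positivity)

lemma np_mono : Monotone np := by
  apply monotone_nat_of_le_succ
  intro j
  have h := MM_pos j
  calc np j ≤ MM j := by
        unfold MM
        have := mm_pos j
        nlinarith [np_pos j]
    _ = MM j ^ 1 := by simp
    _ ≤ MM j ^ (ee j + 2) := Nat.pow_le_pow_right h (by omega)
    _ = np (j + 1) := rfl

lemma nn_le_np {t j : ℕ} (h : t < j) : nn t ≤ np j := by
  rw [← np_succ]; exact np_mono h

lemma nn_mul_mm_le {t j : ℕ} (h : t < j) : nn t * mm t ≤ MM j := by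
  unfold MM
  have h1 := nn_le_np h
  have h2 := mm_mono h.le
  calc nn t * mm t ≤ np j * mm j := Nat.mul_le_mul h1 h2
    _ ≤ 16 * np j * mm j := by nlinarith [Nat.zero_le (np j * mm j)]

lemma BB_pos (j : ℕ) : 0 < BB j := by
  have := np_pos j; unfold BB; positivity

lemma two_BB_le (j : ℕ) : 2 * BB j ≤ MM j ^ ee j := by
  have h := ee_ge j
  obtain ⟨s, hs⟩ : ∃ s, ee j = s + 1 := ⟨ee j - 1, by omega⟩
  unfold BB MM
  have hm := mm_pos j
  have h14 : 2 * (7 * np j) ≤ 16 * np j * mm j := by nlinarith [np_pos j]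
  have h7 : 7 * np j ≤ 16 * np j * mm j := by omega
  rw [hs, pow_succ, pow_succ]
  calc 2 * ((7 * np j) ^ s * (7 * np j)) = (7 * np j) ^ s * (2 * (7 * np j)) := by ring
    _ ≤ _ := Nat.mul_le_mul (Nat.pow_le_pow_left h7 s) h14

lemma nn_eq (j : ℕ) : nn j = MM j ^ ee j * (MM j * MM j) := by
  unfold nn; rw [pow_add]; ring

lemma mm_mul_BB_le (j : ℕ) : mm j * BB j ≤ nn j := by
  rw [nn_eq]
  have h1 := two_BB_le j
  have h2 := mm_le_MM j
  have h3 := MM_pos j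
  calc mm j * BB j ≤ MM j * (MM j ^ ee j) := Nat.mul_le_mul h2 (by omega)
    _ ≤ MM j ^ ee j * (MM j * MM j) := by
      nlinarith [Nat.zero_le (MM j * MM j ^ ee j), Nat.mul_le_mul_left (MM j * MM j ^ ee j) h3]

lemma mm_nn_BB_le {t j : ℕ} (h : t < j) : mm j * (mm t * nn t) * (1 + BB j) ≤ nn j := by
  rw [nn_eq j]
  have h1 := two_BB_le j
  have h2 := mm_le_MM j
  have h3 := nn_mul_mm_le h
  have h4 := BB_pos j
  calc mm j * (mm t * nn t) * (1 + BB j) ≤ MM j * MM j * MM j ^ ee j := by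
        apply Nat.mul_le_mul
        · exact Nat.mul_le_mul h2 (by rw [mul_comm]; exact h3)
        · omega
    _ = _ := by ring

lemma mm_sq_le_nn (j : ℕ) : mm j * mm j ≤ nn j := by
  rw [nn_eq]
  have h2 := mm_le_MM j
  have h3 := MM_pos j
  calc mm j * mm j ≤ MM j * MM j := Nat.mul_le_mul h2 h2
    _ ≤ MM j ^ ee j * (MM j * MM j) := Nat.le_mul_of_pos_left _ (by positivity)

/-! ### The norming set -/

def Sc {α : Type*} [Zero α] (f g : ℕ →₀ α) : Prop :=
  ∀ i ∈ f.support, ∀ j ∈ g.support, i < j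

/-- pairwise successive -/
def Blk {α : Type*} [Zero α] (f : ℕ → ℕ →₀ α) : Prop := ∀ i j, i < j → Sc (f i) (f j)

noncomputable def cd : List ((ℕ →₀ ℚ) × ℕ) → ℕ :=
  Classical.choose (exists_injective_nat (List ((ℕ →₀ ℚ) × ℕ)))

lemma cd_inj : Function.Injective cd :=
  Classical.choose_spec (exists_injective_nat (List ((ℕ →₀ ℚ) × ℕ)))

def pre (β : ℕ → ℕ →₀ ℚ) (t : ℕ → ℕ) (i : ℕ) : List ((ℕ →₀ ℚ) × ℕ) :=
  (List.range i).map fun k => (β k, t k)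

def SpecSeq (β : ℕ → ℕ →₀ ℚ) (t : ℕ → ℕ) : Prop :=
  (∀ i, t i % 2 = 0 ∧ (Nat.unpair (t i / 2)).1 = cd (pre β t i)) ∧ Blk β ∧
  ∀ i j, i < j → ∀ p ∈ (β i).support, p ≤ t j

open Classical in
noncomputable def rs (E : Set ℕ) (f : ℕ →₀ ℚ) : ℕ →₀ ℚ := f.filter (· ∈ E)

inductive W : (ℕ →₀ ℚ) → Prop
  | basis (n : ℕ) (s : ℚ) (h : |s| ≤ 1) : W (Finsupp.single n s)
  | typ (t : ℕ) (L : ℕ → ℕ →₀ ℚ) (hL : ∀ r, W (L r)) (hs : Blk L) :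
      W ((mm t : ℚ)⁻¹ • ∑ r ∈ Finset.range (nn t), L r)
  | spec (β : ℕ → ℕ →₀ ℚ) (t : ℕ → ℕ) (L : ℕ → ℕ → ℕ →₀ ℚ) (F : Finset ℕ) (ε : ℕ → ℚ)
      (E : Set ℕ) (hL : ∀ i r, W (L i r)) (hs : ∀ i, Blk (L i))
      (hβ : ∀ i, β i = (mm (t i) : ℚ)⁻¹ • ∑ r ∈ Finset.range (nn (t i)), L i r)
      (hsp : SpecSeq β t) (hε : ∀ n, |ε n| ≤ 1) (hE : E.OrdConnected)
      (hF : ∀ n ∈ F, ∀ p ∈ E, p ∈ (β (2 * n)).support ∪ (β (2 * n + 1)).support → F.card ≤ p) :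
      W (∑ n ∈ F, ε n • (rs E (β (2 * n)) + rs E (β (2 * n + 1))))

def IsTyp (t : ℕ) (f : ℕ →₀ ℚ) : Prop :=
  ∃ L : ℕ → ℕ →₀ ℚ, (∀ r, W (L r)) ∧ Blk L ∧
    f = (mm t : ℚ)⁻¹ • ∑ r ∈ Finset.range (nn t), L r

lemma IsTyp.W {t f} (h : IsTyp t f) : W f := by
  obtain ⟨L, h1, h2, rfl⟩ := h
  exact .typ t L h1 h2

lemma rs_apply (E : Set ℕ) (f : ℕ →₀ ℚ) (k : ℕ) [Decidable (k ∈ E)] :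
    rs E f k = if k ∈ E then f k else 0 := by
  classical
  unfold rs; rw [Finsupp.filter_apply]; congr

lemma mem_rs_support {E : Set ℕ} {f : ℕ →₀ ℚ} {k : ℕ} :
    k ∈ (rs E f).support ↔ k ∈ E ∧ k ∈ f.support := by
  classical
  simp only [Finsupp.mem_support_iff, rs_apply]
  by_cases h : k ∈ E <;> simp [h]

lemma rs_smul (E : Set ℕ) (c : ℚ) (f : ℕ →₀ ℚ) : rs E (c • f) = c • rs E f := by
  classical
  ext k; simp [rs_apply]

lemma rs_add (E : Set ℕ) (f g : ℕ →₀ ℚ) : rs E (f + g) = rs E f + rs E g := by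
  classical
  ext k; simp only [rs_apply, Finsupp.add_apply]; split_ifs <;> simp

lemma rs_zero (E : Set ℕ) : rs E 0 = 0 := by
  classical
  ext k; simp [rs_apply]

lemma rs_sum {ι : Type*} (E : Set ℕ) (s : Finset ι) (f : ι → ℕ →₀ ℚ) :
    rs E (∑ i ∈ s, f i) = ∑ i ∈ s, rs E (f i) := by
  classical
  induction s using Finset.induction_on with
  | empty => simp [rs_zero]
  | insert a s ha ih => rw [Finset.sum_insert ha, Finset.sum_insert ha, rs_add, ih]

lemma rs_rs (E E' : Set ℕ) (f : ℕ →₀ ℚ) : rs E' (rs E f) = rs (E ∩ E') f := by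
  classical
  ext k; simp only [rs_apply, Set.mem_inter_iff]
  by_cases h : k ∈ E <;> by_cases h' : k ∈ E' <;> simp [h, h']

lemma rs_univ (f : ℕ →₀ ℚ) : rs Set.univ f = f := by
  classical
  ext k; simp [rs_apply]

lemma Blk.rs {L : ℕ → ℕ →₀ ℚ} (h : Blk L) (E : Set ℕ) : Blk fun r => rs E (L r) := by
  intro i j hij a ha b hb
  exact h i j hij a (mem_rs_support.1 ha).2 b (mem_rs_support.1 hb).2

lemma W_rs {f : ℕ →₀ ℚ} (h : W f) {E : Set ℕ} (hE : E.OrdConnected) : W (rs E f) := by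
  classical
  induction h with
  | basis n s h =>
    have : rs E (Finsupp.single n s) = Finsupp.single n (if n ∈ E then s else 0) := by
      ext k; rw [rs_apply, Finsupp.single_apply, Finsupp.single_apply]
      by_cases h : n = k
      · subst h; simp
      · simp [h]
    rw [this]
    apply W.basis
    split_ifs <;> simp [h]
  | typ t L hL hs ih =>
    rw [rs_smul, rs_sum]
    exact .typ t _ ih (hs.rs E)
  | spec β t L F ε E' hL hs hβ hsp hε hE' hF ih =>
    rw [rs_sum]
    have : ∀ n, rs E (ε n • (rs E' (β (2 * n)) + rs E' (β (2 * n + 1)))) =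
        ε n • (rs (E' ∩ E) (β (2 * n)) + rs (E' ∩ E) (β (2 * n + 1))) := by
      intro n; rw [rs_smul, rs_add, rs_rs, rs_rs]
    simp only [this]
    exact .spec β t L F ε (E' ∩ E) hL hs hβ hsp hε (hE'.inter hE)
      fun n hn p hp => hF n hn p hp.1

lemma Blk.neg {L : ℕ → ℕ →₀ ℚ} (h : Blk L) : Blk fun r => -(L r) := by
  intro i j hij a ha b hb
  rw [Finsupp.support_neg] at ha hb
  exact h i j hij a ha b hb

lemma W_neg {f : ℕ →₀ ℚ} (h : W f) : W (-f) := by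
  induction h with
  | basis n s h =>
    rw [← Finsupp.single_neg]
    exact .basis n _ (by rwa [abs_neg])
  | typ t L hL hs ih =>
    rw [← smul_neg, ← Finset.sum_neg_distrib]
    exact .typ t _ ih hs.neg
  | spec β t L F ε E' hL hs hβ hsp hε hE' hF ih =>
    rw [← Finset.sum_neg_distrib]
    simp only [← neg_smul]
    exact .spec β t L F (fun n => - ε n) E' hL hs hβ hsp (fun n => by rw [abs_neg]; exact hε n) hE' hF

lemma IsTyp_rs {t f} (h : IsTyp t f) {E : Set ℕ} (hE : E.OrdConnected) : IsTyp t (rs E f) := by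
  obtain ⟨L, h1, h2, rfl⟩ := h
  exact ⟨fun r => rs E (L r), fun r => W_rs (h1 r) hE, h2.rs E, by rw [rs_smul, rs_sum]⟩

/-- Sum of a disjointly supported family is bounded coordinatewise. -/
lemma sum_disj_le {ι : Type*} (s : Finset ι) (g : ι → ℚ)
    (hd : ∀ i ∈ s, ∀ j ∈ s, i ≠ j → g i = 0 ∨ g j = 0) (hb : ∀ i ∈ s, |g i| ≤ 1) :
    |∑ i ∈ s, g i| ≤ 1 := by
  by_cases h : ∃ i ∈ s, g i ≠ 0
  · obtain ⟨i, hi, hi0⟩ := h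
    rw [Finset.sum_eq_single i]
    · exact hb i hi
    · intro j hj hji
      exact (hd j hj i hi hji).resolve_right hi0
    · intro h; exact absurd hi h
  · push Not at h
    rw [Finset.sum_eq_zero h]; simp

lemma Sc_zero {f g : ℕ →₀ ℚ} (h : Sc f g) (k : ℕ) : f k = 0 ∨ g k = 0 := by
  by_contra hc
  push Not at hc
  exact lt_irrefl _ (h k (Finsupp.mem_support_iff.2 hc.1) k (Finsupp.mem_support_iff.2 hc.2))

lemma Blk_zero {L : ℕ → ℕ →₀ ℚ} (h : Blk L) {i j : ℕ} (hij : i ≠ j) (k : ℕ) :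
    L i k = 0 ∨ L j k = 0 := by
  rcases lt_or_gt_of_ne hij with h1 | h1
  · exact Sc_zero (h i j h1) k
  · exact (Sc_zero (h j i h1) k).symm

lemma typ_coord (t : ℕ) (L : ℕ → ℕ →₀ ℚ) (hs : Blk L) (ih : ∀ r k, |L r k| ≤ 1) (k : ℕ) :
    |((mm t : ℚ)⁻¹ • ∑ r ∈ Finset.range (nn t), L r) k| ≤ (mm t : ℚ)⁻¹ := by
  rw [Finsupp.smul_apply, Finsupp.finsetSum_apply, smul_eq_mul, abs_mul, abs_of_nonneg (by positivity)]
  have := sum_disj_le (Finset.range (nn t)) (fun r => L r k)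
    (fun i _ j _ hij => Blk_zero hs hij k) (fun i _ => ih i k)
  calc _ ≤ (mm t : ℚ)⁻¹ * 1 := by gcongr
    _ = _ := by simp

lemma mm_inv_le_one (t : ℕ) : (mm t : ℚ)⁻¹ ≤ 1 := by
  apply inv_le_one_of_one_le₀
  exact_mod_cast mm_pos t

lemma W_coord {f : ℕ →₀ ℚ} (h : W f) (k : ℕ) : |f k| ≤ 1 := by
  classical
  induction h generalizing k with
  | basis n s h =>
    rw [Finsupp.single_apply]; split_ifs <;> simp [h]
  | typ t L hL hs ih =>
    exact (typ_coord t L hs ih k).trans (mm_inv_le_one t)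
  | spec β t L F ε E' hL hs hβ hsp hε hE' hF ih =>
    rw [Finsupp.finsetSum_apply]
    have hb : ∀ i, |β i k| ≤ 1 := fun i => by
      rw [hβ i]; exact (typ_coord (t i) (L i) (hs i) (ih i) k).trans (mm_inv_le_one _)
    have hb' : ∀ i, |rs E' (β i) k| ≤ 1 := fun i => by
      rw [rs_apply]; split_ifs
      · exact hb i
      · simp
    have hB := hsp.2.1.rs E'
    apply sum_disj_le
    · intro i _ j _ hij
      simp only [Finsupp.smul_apply, Finsupp.add_apply]
      have h1 := Blk_zero hB (show 2 * i ≠ 2 * j by omega) k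
      have h2 := Blk_zero hB (show 2 * i ≠ 2 * j + 1 by omega) k
      have h3 := Blk_zero hB (show 2 * i + 1 ≠ 2 * j by omega) k
      have h4 := Blk_zero hB (show 2 * i + 1 ≠ 2 * j + 1 by omega) k
      rcases h1 with h1 | h1 <;> rcases h2 with h2 | h2 <;> rcases h3 with h3 | h3 <;>
        rcases h4 with h4 | h4 <;> simp [h1, h2, h3, h4]
    · intro i _
      simp only [Finsupp.smul_apply, Finsupp.add_apply, smul_eq_mul, abs_mul]
      have h1 : |rs E' (β (2 * i)) k + rs E' (β (2 * i + 1)) k| ≤ 1 := by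
        rcases Blk_zero hB (show 2 * i ≠ 2 * i + 1 by omega) k with h | h <;>
          rw [h] <;> simp [hb']
      calc _ ≤ (1 : ℚ) * 1 := mul_le_mul (hε i) h1 (abs_nonneg _) (by norm_num)
        _ = 1 := by norm_num

lemma IsTyp_coord {t f} (h : IsTyp t f) (k : ℕ) : |f k| ≤ (mm t : ℚ)⁻¹ := by
  obtain ⟨L, h1, h2, rfl⟩ := h
  exact typ_coord t L h2 (fun r k => W_coord (h1 r) k) k

end EqPairs


namespace EqPairs

/-! ### Pairing and norm -/

noncomputable def pr (f : ℕ →₀ ℚ) : (ℕ →₀ ℝ) →ₗ[ℝ] ℝ :=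
  Finsupp.linearCombination ℝ (fun k => (f k : ℝ))

lemma pr_eq (f : ℕ →₀ ℚ) (x : ℕ →₀ ℝ) : pr f x = ∑ k ∈ x.support, x k * (f k : ℝ) := by
  simp [pr, Finsupp.linearCombination_apply, Finsupp.sum]

lemma pr_single (f : ℕ →₀ ℚ) (k : ℕ) (a : ℝ) : pr f (Finsupp.single k a) = a * f k := by
  simp [pr]

lemma pr_add_left (f g : ℕ →₀ ℚ) (x : ℕ →₀ ℝ) : pr (f + g) x = pr f x + pr g x := by
  simp [pr_eq, mul_add, Finset.sum_add_distrib]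

lemma pr_smul_left (c : ℚ) (f : ℕ →₀ ℚ) (x : ℕ →₀ ℝ) : pr (c • f) x = c * pr f x := by
  simp only [pr_eq, Finset.mul_sum, Finsupp.smul_apply, smul_eq_mul, Rat.cast_mul]
  exact Finset.sum_congr rfl fun k _ => by ring

lemma pr_neg_left (f : ℕ →₀ ℚ) (x : ℕ →₀ ℝ) : pr (-f) x = - pr f x := by
  simp [pr_eq]

lemma pr_zero_left (x : ℕ →₀ ℝ) : pr 0 x = 0 := by
  simp [pr_eq]

lemma pr_sum_left {ι : Type*} (s : Finset ι) (f : ι → ℕ →₀ ℚ) (x : ℕ →₀ ℝ) :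
    pr (∑ i ∈ s, f i) x = ∑ i ∈ s, pr (f i) x := by
  classical
  induction s using Finset.induction_on with
  | empty => simp [pr_zero_left]
  | insert a s ha ih => rw [Finset.sum_insert ha, Finset.sum_insert ha, pr_add_left, ih]

lemma pr_ne_zero {f : ℕ →₀ ℚ} {x : ℕ →₀ ℝ} (h : pr f x ≠ 0) :
    ∃ k ∈ f.support, k ∈ x.support := by
  rw [pr_eq] at h
  obtain ⟨k, hk, hk0⟩ := Finset.exists_ne_zero_of_sum_ne_zero h
  refine ⟨k, ?_, hk⟩
  rw [Finsupp.mem_support_iff]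
  intro h0
  simp [h0] at hk0

lemma pr_rs {E : Set ℕ} {f : ℕ →₀ ℚ} {x : ℕ →₀ ℝ} (h : ∀ k ∈ x.support, k ∈ f.support → k ∈ E) :
    pr (rs E f) x = pr f x := by
  classical
  rw [pr_eq, pr_eq]
  refine Finset.sum_congr rfl fun k hk => ?_
  rw [rs_apply]
  by_cases hf : k ∈ f.support
  · rw [if_pos (h k hk hf)]
  · rw [Finsupp.notMem_support_iff.1 hf]; simp

noncomputable def l1 (x : ℕ →₀ ℝ) : ℝ := ∑ k ∈ x.support, |x k|

lemma pr_le_l1 {f : ℕ →₀ ℚ} {c : ℚ} (h : ∀ k, |f k| ≤ c) (x : ℕ →₀ ℝ) :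
    |pr f x| ≤ c * l1 x := by
  rw [pr_eq, l1, Finset.mul_sum]
  refine (Finset.abs_sum_le_sum_abs _ _).trans (Finset.sum_le_sum fun k _ => ?_)
  rw [abs_mul, mul_comm]
  have : |(f k : ℝ)| ≤ c := by exact_mod_cast h k
  gcongr

lemma typ_le_l1 {t f} (h : IsTyp t f) (x : ℕ →₀ ℝ) : |pr f x| ≤ (mm t : ℝ)⁻¹ * l1 x := by
  have := pr_le_l1 (IsTyp_coord h) x
  simpa using this

abbrev Wt := {f : ℕ →₀ ℚ // W f}

abbrev Lp := lp (fun _ : Wt => ℝ) ⊤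

noncomputable def EE (n : ℕ) : Lp :=
  ⟨fun f => (f.1 n : ℝ), memℓp_infty ⟨1, by
    rintro _ ⟨f, rfl⟩
    have := W_coord f.2 n
    simp only [Real.norm_eq_abs]
    exact_mod_cast this⟩⟩

noncomputable def Ph : (ℕ →₀ ℝ) →ₗ[ℝ] Lp := Finsupp.linearCombination ℝ EE

lemma Ph_apply (x : ℕ →₀ ℝ) (f : Wt) : (Ph x : Wt → ℝ) f = pr f.1 x := by
  induction x using Finsupp.induction_linear with
  | zero => simp
  | add x y hx hy => simp [hx, hy]
  | single k a => simp [Ph, pr, EE]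

noncomputable def N (x : ℕ →₀ ℝ) : ℝ := ‖Ph x‖

lemma le_N {f : ℕ →₀ ℚ} (h : W f) (x : ℕ →₀ ℝ) : |pr f x| ≤ N x := by
  have := lp.norm_apply_le_norm (by simp) (Ph x) ⟨f, h⟩
  rwa [Ph_apply, Real.norm_eq_abs] at this

lemma N_nonneg (x : ℕ →₀ ℝ) : 0 ≤ N x := norm_nonneg _

lemma N_le {x : ℕ →₀ ℝ} {c : ℝ} (hc : 0 ≤ c) (h : ∀ f, W f → |pr f x| ≤ c) : N x ≤ c := by
  apply lp.norm_le_of_forall_le hc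
  intro f
  rw [Ph_apply]
  exact h f.1 f.2

lemma N_add_le (x y : ℕ →₀ ℝ) : N (x + y) ≤ N x + N y := by
  unfold N; rw [map_add]; exact norm_add_le _ _

lemma N_sub_le (x y : ℕ →₀ ℝ) : N (x - y) ≤ N x + N y := by
  unfold N; rw [map_sub]; exact norm_sub_le _ _

lemma N_smul (c : ℝ) (x : ℕ →₀ ℝ) : N (c • x) = |c| * N x := by
  unfold N; rw [map_smul, norm_smul, Real.norm_eq_abs]

lemma N_sum_le {ι : Type*} (s : Finset ι) (x : ι → ℕ →₀ ℝ) :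
    N (∑ i ∈ s, x i) ≤ ∑ i ∈ s, N (x i) := by
  unfold N; rw [map_sum]; exact norm_sum_le _ _

lemma N_zero : N 0 = 0 := by simp [N]

lemma coord_le_N (x : ℕ →₀ ℝ) (k : ℕ) : |x k| ≤ N x := by
  have := le_N (W.basis k 1 (by simp)) x
  rw [pr_eq] at this
  rw [Finset.sum_eq_single k] at this
  · simpa using this
  · intro b _ hb
    rw [Finsupp.single_apply, if_neg (Ne.symm hb)]; simp
  · intro h
    rw [Finsupp.notMem_support_iff.1 h]; simp

lemma N_pos {x : ℕ →₀ ℝ} (h : x ≠ 0) : 0 < N x := by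
  by_contra hc
  apply h
  ext k
  have h1 := coord_le_N x k
  have h2 : |x k| = 0 := le_antisymm (h1.trans (not_lt.1 hc)) (abs_nonneg _)
  simpa using h2

lemma Ph_inj : Function.Injective Ph := by
  rw [injective_iff_map_eq_zero]
  intro x hx
  by_contra h
  have := N_pos h
  rw [N, hx] at this
  simp at this

lemma exists_gt {x : ℕ →₀ ℝ} {c : ℝ} (hc : 0 ≤ c) (h : c < N x) :
    ∃ f, W f ∧ c < pr f x ∧
      ∀ k ∈ f.support, ∃ a ∈ x.support, ∃ b ∈ x.support, a ≤ k ∧ k ≤ b := by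
  have h1 : ∃ f, W f ∧ c < |pr f x| := by
    by_contra hcon
    push Not at hcon
    exact absurd (N_le hc hcon) (not_le.2 h)
  have h2 : ∃ f, W f ∧ c < pr f x := by
    obtain ⟨f, hf, hfc⟩ := h1
    rcases lt_abs.1 hfc with h | h
    · exact ⟨f, hf, h⟩
    · exact ⟨-f, W_neg hf, by rwa [pr_neg_left]⟩
  obtain ⟨f, hf, hfc⟩ := h2
  set E : Set ℕ := {k | ∃ a ∈ x.support, ∃ b ∈ x.support, a ≤ k ∧ k ≤ b}
  have hE : E.OrdConnected := by
    constructor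
    rintro u ⟨a, ha, _, _, h1, _⟩ v ⟨_, _, b, hb, _, h2⟩ k hk
    exact ⟨a, ha, b, hb, h1.trans hk.1, hk.2.trans h2⟩
  refine ⟨rs E f, W_rs hf hE, ?_, ?_⟩
  · have h3 : pr (rs E f) x = pr f x :=
      pr_rs (E := E) fun k hk _ => ⟨k, hk, k, hk, le_rfl, le_rfl⟩
    rwa [h3]
  · intro k hk
    exact (mem_rs_support.1 hk).1

/-- Restriction to an initial segment does not increase the norm. -/
lemma N_filter_le (x y : ℕ →₀ ℝ) (m : ℕ) (h1 : ∀ k < m, x k = y k) (h2 : ∀ k, m ≤ k → x k = 0) :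
    N x ≤ N y := by
  apply N_le (N_nonneg _)
  intro f hf
  have : pr f x = pr (rs (Set.Iio m) f) y := by
    classical
    rw [pr_eq, pr_eq]
    rw [Finset.sum_subset (Finset.subset_union_left (s₂ := y.support)),
      Finset.sum_subset (Finset.subset_union_right (s₁ := x.support) (s₂ := y.support))]
    · refine Finset.sum_congr rfl fun k _ => ?_
      rw [rs_apply]
      by_cases hk : k < m
      · simp [hk, h1 k hk]
      · simp [hk, h2 k (not_lt.1 hk)]
    · intro k _ hk; rw [Finsupp.notMem_support_iff.1 hk]; simp
    · intro k _ hk; rw [Finsupp.notMem_support_iff.1 hk]; simp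
  rw [this]
  exact le_N (W_rs hf Set.ordConnected_Iio) y

/-! ### Splitting lemma -/

lemma Blk_cross {L : ℕ → ℕ →₀ ℚ} (hL : Blk L) {w : ℕ → ℕ →₀ ℝ} (hw : Blk w)
    {k k' r r' : ℕ} (hk : k < k') (hr : pr (L r) (w k) ≠ 0) (hr' : pr (L r') (w k') ≠ 0) :
    r ≤ r' := by
  by_contra h
  push Not at h
  obtain ⟨q, hq1, hq2⟩ := pr_ne_zero hr
  obtain ⟨p, hp1, hp2⟩ := pr_ne_zero hr'
  have h1 := hw k k' hk q hq2 p hp2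
  have h2 := hL r' r h p hp1 q hq1
  omega

lemma BG (t : ℕ) {L : ℕ → ℕ →₀ ℚ} (hL : Blk L) {w : ℕ → ℕ →₀ ℝ} (hw : Blk w) (D : Finset ℕ) :
    ∃ D' ⊆ D, D'.card ≤ nn t ∧ ∃ ρ : ℕ → ℕ, ∀ k ∈ D, k ∉ D' → ρ k < nn t ∧
      pr ((mm t : ℚ)⁻¹ • ∑ r ∈ Finset.range (nn t), L r) (w k) =
        (mm t : ℝ)⁻¹ * pr (L (ρ k)) (w k) := by
  classical
  let bad : ℕ → Prop := fun k => ∃ r r', r < r' ∧ r' < nn t ∧ pr (L r) (w k) ≠ 0 ∧ pr (L r') (w k) ≠ 0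
  have hR : ∀ k, ∃ r', bad k → r' < nn t ∧ pr (L r') (w k) ≠ 0 ∧ ∃ r < r', pr (L r) (w k) ≠ 0 := by
    intro k
    by_cases h : bad k
    · obtain ⟨r, r', h1, h2, h3, h4⟩ := h
      exact ⟨r', fun _ => ⟨h2, h4, r, h1, h3⟩⟩
    · exact ⟨0, fun h' => absurd h' h⟩
  choose R hR using hR
  refine ⟨D.filter bad, Finset.filter_subset _ _, ?_, ?_⟩
  · have hlt : ∀ k k', bad k → bad k' → k < k' → R k < R k' := by
      intro k k' hb hb' hk
      obtain ⟨_, h1, _⟩ := hR k hb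
      obtain ⟨_, _, r, hr, h2⟩ := hR k' hb'
      exact lt_of_le_of_lt (Blk_cross hL hw hk h1 h2) hr
    have : (D.filter bad).card ≤ (Finset.range (nn t)).card := by
      apply Finset.card_le_card_of_injOn R
      · intro k hk
        have := (hR k (Finset.mem_filter.1 hk).2).1
        simpa using this
      · intro k hk k' hk' h
        have hb := (Finset.mem_filter.1 hk).2
        have hb' := (Finset.mem_filter.1 hk').2
        rcases lt_trichotomy k k' with h1 | h1 | h1
        · exact absurd h (hlt k k' hb hb' h1).ne
        · exact h1
        · exact absurd h (hlt k' k hb' hb h1).ne'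
    simpa using this
  · have : ∀ k, ∃ r, ¬ bad k → r < nn t ∧ ∀ r' < nn t, r' ≠ r → pr (L r') (w k) = 0 := by
      intro k
      by_cases hz : ∃ r < nn t, pr (L r) (w k) ≠ 0
      · obtain ⟨r, hr, h0⟩ := hz
        refine ⟨r, fun hb => ⟨hr, fun r' hr' hne => ?_⟩⟩
        by_contra hc
        rcases lt_or_gt_of_ne hne with h | h
        · exact hb ⟨r', r, h, hr, hc, h0⟩
        · exact hb ⟨r, r', h, hr', h0, hc⟩
      · push Not at hz
        exact ⟨0, fun _ => ⟨nn_pos t, fun r' hr' _ => hz r' hr'⟩⟩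
    choose ρ hρ using this
    refine ⟨ρ, fun k hk hk' => ?_⟩
    have hb : ¬ bad k := fun h => hk' (Finset.mem_filter.2 ⟨hk, h⟩)
    obtain ⟨h1, h2⟩ := hρ k hb
    refine ⟨h1, ?_⟩
    rw [pr_smul_left, pr_sum_left, Finset.sum_eq_single (ρ k)]
    · simp
    · intro r hr hne
      exact h2 r (Finset.mem_range.1 hr) hne
    · intro h; exact absurd (Finset.mem_range.2 h1) h

/-! ### Averages -/

def IsAvg (M : ℕ) (v : ℕ →₀ ℝ) : Prop :=
  ∃ p : ℕ → ℕ →₀ ℝ, Blk p ∧ (∀ i, N (p i) ≤ 1) ∧ v = (M : ℝ)⁻¹ • ∑ i ∈ Finset.range M, p i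

lemma mm_inv_nonneg (t : ℕ) : (0 : ℝ) ≤ (mm t : ℝ)⁻¹ := by positivity

lemma avg_bound {t M : ℕ} (hM : 0 < M) {f : ℕ →₀ ℚ} (hf : IsTyp t f) {v : ℕ →₀ ℝ}
    (hv : IsAvg M v) : |pr f v| ≤ (mm t : ℝ)⁻¹ + nn t / M := by
  classical
  have hfW := hf.W
  obtain ⟨L, h1, h2, rfl⟩ := hf
  obtain ⟨p, hp, hN, rfl⟩ := hv
  obtain ⟨D', hD', hc, ρ, hρ⟩ := BG t h2 hp (Finset.range M)
  set f := ((mm t : ℚ)⁻¹ • ∑ r ∈ Finset.range (nn t), L r)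
  have hM' : (0 : ℝ) < M := by exact_mod_cast hM
  rw [map_smul, map_sum, smul_eq_mul, abs_mul, abs_of_nonneg (by positivity)]
  have hb : |∑ i ∈ Finset.range M, pr f (p i)| ≤ nn t + M * (mm t : ℝ)⁻¹ := by
    refine (Finset.abs_sum_le_sum_abs _ _).trans ?_
    rw [← Finset.sum_sdiff hD', add_comm]
    apply add_le_add
    · calc ∑ i ∈ D', |pr f (p i)| ≤ ∑ i ∈ D', (1 : ℝ) :=
            Finset.sum_le_sum fun i _ => (le_N hfW _).trans (hN i)
        _ = D'.card := by simp
        _ ≤ nn t := by exact_mod_cast hc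
    · calc ∑ i ∈ Finset.range M \ D', |pr f (p i)| ≤ ∑ i ∈ Finset.range M \ D', (mm t : ℝ)⁻¹ := by
            refine Finset.sum_le_sum fun i hi => ?_
            rw [Finset.mem_sdiff] at hi
            rw [(hρ i hi.1 hi.2).2, abs_mul, abs_of_nonneg (mm_inv_nonneg t)]
            have := (le_N (h1 (ρ i)) (p i)).trans (hN i)
            calc _ ≤ (mm t : ℝ)⁻¹ * 1 := by gcongr
              _ = _ := by simp
        _ = (Finset.range M \ D').card * (mm t : ℝ)⁻¹ := by simp
        _ ≤ M * (mm t : ℝ)⁻¹ := by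
          gcongr
          calc _ ≤ (Finset.range M).card := Finset.card_le_card Finset.sdiff_subset
            _ = M := by simp
  calc (M : ℝ)⁻¹ * |∑ i ∈ Finset.range M, pr f (p i)| ≤ (M : ℝ)⁻¹ * (nn t + M * (mm t : ℝ)⁻¹) := by
        gcongr
    _ = _ := by field_simp; ring

end EqPairs


namespace EqPairs

/-! ### Recursion helpers -/

lemma seq_of_list {β : Type*} (G : List β → β → Prop) (h : ∀ L, ∃ b, G L b) :
    ∃ s : ℕ → β, ∀ n, G ((List.range n).map s) (s n) := by
  choose g hg using h
  let l : ℕ → List β := fun n => Nat.rec [] (fun _ l => l ++ [g l]) n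
  have hl : ∀ n, l n = (List.range n).map fun n => g (l n) := by
    intro n
    induction n with
    | zero => rfl
    | succ k ih =>
      rw [List.range_succ, List.map_append, ← ih]
      rfl
  refine ⟨fun n => g (l n), fun n => ?_⟩
  rw [← hl]
  exact hg _

noncomputable def mx (x : ℕ →₀ ℝ) : ℕ := x.support.sup id

lemma le_mx {x : ℕ →₀ ℝ} {k : ℕ} (h : k ∈ x.support) : k ≤ mx x :=
  Finset.le_sup (f := id) h

lemma far_seq {β : Type*} (v : β → ℕ →₀ ℝ) (G : List β → β → Prop)
    (h : ∀ (L : List β) (p : ℕ), ∃ b, G L b ∧ ∀ k ∈ (v b).support, p < k) :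
    ∃ s : ℕ → β, (∀ n, G ((List.range n).map s) (s n)) ∧ (Blk fun n => v (s n)) ∧
      ∀ n, ∀ k ∈ (v (s n)).support, n < k := by
  obtain ⟨s, hs⟩ := seq_of_list
    (fun L b => G L b ∧ ∀ k ∈ (v b).support, (L.map fun b => mx (v b)).sum + L.length < k)
    (fun L => h L _)
  refine ⟨s, fun n => (hs n).1, ?_, ?_⟩
  · intro i j hij a ha b hb
    have h1 := (hs j).2 b hb
    have h2 : mx (v (s i)) ≤ (((List.range j).map s).map fun b => mx (v b)).sum := by
      apply List.le_sum_of_mem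
      simp only [List.map_map, List.mem_map, List.mem_range, Function.comp]
      exact ⟨i, hij, rfl⟩
    have h3 : a ≤ mx (v (s i)) := le_mx ha
    omega
  · intro n k hk
    have h1 := (hs n).2 k hk
    simp at h1
    omega

/-- subspace containing nonzero vectors with arbitrarily far supports -/
def Far (Z : Submodule ℝ (ℕ →₀ ℝ)) : Prop :=
  ∀ p, ∃ z ∈ Z, z ≠ 0 ∧ ∀ k ∈ z.support, p < k

lemma sum_except {ι : Type*} (G D : Finset ι) (g : ι → ℝ) (c C : ℝ) (n : ℕ)
    (hc : 0 ≤ c) (hC : 0 ≤ C) (h1 : ∀ k ∈ G, k ∉ D → g k ≤ c) (h2 : ∀ k ∈ G, g k ≤ C)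
    (hD : D.card ≤ n) : ∑ k ∈ G, g k ≤ G.card * c + n * C := by
  classical
  rw [← Finset.sum_filter_add_sum_filter_not G (· ∉ D)]
  apply add_le_add
  · calc ∑ k ∈ G with k ∉ D, g k ≤ ∑ k ∈ G with k ∉ D, c :=
          Finset.sum_le_sum fun k hk => by
            rw [Finset.mem_filter] at hk; exact h1 k hk.1 hk.2
      _ = (G.filter (· ∉ D)).card * c := by simp
      _ ≤ _ := by gcongr; exact Finset.filter_subset _ _
  · calc ∑ k ∈ G with ¬ k ∉ D, g k ≤ ∑ k ∈ G with ¬ k ∉ D, C :=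
          Finset.sum_le_sum fun k hk => by
            rw [Finset.mem_filter] at hk; exact h2 k hk.1
      _ = (G.filter (¬ · ∉ D)).card * C := by simp
      _ ≤ _ := by
        gcongr
        refine le_trans (Finset.card_le_card fun k hk => ?_) hD
        rw [Finset.mem_filter] at hk
        exact not_not.1 hk.2

/-! ### Hull functionals -/

def Hul (f : ℕ →₀ ℚ) (x : ℕ →₀ ℝ) : Prop :=
  ∀ k ∈ f.support, ∃ a ∈ x.support, ∃ b ∈ x.support, a ≤ k ∧ k ≤ b

lemma Hul_Blk {f : ℕ → ℕ →₀ ℚ} {u : ℕ → ℕ →₀ ℝ} (h : ∀ r, Hul (f r) (u r)) (hu : Blk u) :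
    Blk f := by
  intro i j hij p hp q hq
  obtain ⟨_, _, b, hb, _, h1⟩ := h i p hp
  obtain ⟨a, ha, _, _, h2, _⟩ := h j q hq
  have := hu i j hij b hb a ha
  omega

lemma Hul_zero {f : ℕ → ℕ →₀ ℚ} {u : ℕ → ℕ →₀ ℝ} (h : ∀ r, Hul (f r) (u r)) (hu : Blk u)
    {r l : ℕ} (hrl : r ≠ l) : pr (f r) (u l) = 0 := by
  by_contra hc
  obtain ⟨k, hk1, hk2⟩ := pr_ne_zero hc
  obtain ⟨a, ha, b, hb, h1, h2⟩ := h r k hk1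
  rcases lt_or_gt_of_ne hrl with h3 | h3
  · have := hu r l h3 b hb k hk2; omega
  · have := hu l r h3 k hk2 a ha; omega

lemma typ_sum (j : ℕ) {f : ℕ → ℕ →₀ ℚ} {u : ℕ → ℕ →₀ ℝ} (hW : ∀ r, W (f r))
    (h : ∀ r, Hul (f r) (u r)) (hu : Blk u) :
    IsTyp j ((mm j : ℚ)⁻¹ • ∑ r ∈ Finset.range (nn j), f r) ∧
    pr ((mm j : ℚ)⁻¹ • ∑ r ∈ Finset.range (nn j), f r) (∑ l ∈ Finset.range (nn j), u l) =
      (mm j : ℝ)⁻¹ * ∑ r ∈ Finset.range (nn j), pr (f r) (u r) := by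
  refine ⟨⟨f, hW, Hul_Blk h hu, rfl⟩, ?_⟩
  rw [pr_smul_left, pr_sum_left]
  simp only [map_sum]
  push_cast
  congr 1
  refine Finset.sum_congr rfl fun r hr => ?_
  rw [Finset.sum_eq_single r]
  · intro l _ hl; exact Hul_zero h hu (Ne.symm hl)
  · intro h; exact absurd hr h

/-! ### James argument -/

noncomputable def avg (u : ℕ → ℕ →₀ ℝ) (n a : ℕ) : ℕ →₀ ℝ :=
  (n : ℝ)⁻¹ • ∑ l ∈ Finset.range n, u (a + l)

lemma avg_mul (u : ℕ → ℕ →₀ ℝ) (M n a : ℕ) :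
    avg u (M * n) a = (M : ℝ)⁻¹ • ∑ i ∈ Finset.range M, avg u n (a + i * n) := by
  unfold avg
  rw [← Finset.smul_sum, smul_smul]
  push_cast
  rw [mul_inv]
  congr 1
  induction M with
  | zero => simp
  | succ k ih =>
    rw [Finset.sum_range_succ, ← ih, Nat.succ_mul, Finset.sum_range_add]
    simp only [add_assoc]

lemma avg_support {u : ℕ → ℕ →₀ ℝ} {n a k : ℕ} (h : k ∈ (avg u n a).support) :
    ∃ l < n, k ∈ (u (a + l)).support := by
  by_contra hc
  push Not at hc
  rw [Finsupp.mem_support_iff] at h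
  apply h
  unfold avg
  rw [Finsupp.smul_apply, Finsupp.finsetSum_apply, Finset.sum_eq_zero]
  · simp
  · intro l hl
    exact Finsupp.notMem_support_iff.1 (hc l (Finset.mem_range.1 hl))

lemma james {u : ℕ → ℕ →₀ ℝ} (hu : Blk u) (h1 : ∀ l, 1 / 2 < N (u l)) (h2 : ∀ l, N (u l) ≤ 1)
    (j : ℕ) : ∃ s a, s < ee j + 2 ∧
      1 / 2 < N ((2 : ℝ) ^ s • avg u (MM j ^ (s + 1)) a) ∧
      N ((2 : ℝ) ^ s • avg u (MM j ^ (s + 1)) a) ≤ 1 ∧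
      IsAvg (MM j) ((2 : ℝ) ^ s • avg u (MM j ^ (s + 1)) a) := by
  let Q : ℕ → Prop := fun s => ∀ a, N (avg u (MM j ^ s) a) ≤ ((2 : ℝ) ^ s)⁻¹
  have hQ0 : Q 0 := by
    intro a
    simp [avg, h2]
  have hQS : ¬ Q (ee j + 2) := by
    intro hQ
    have hex : ∀ l, ∃ f, W f ∧ 1 / 2 < pr f (u l) ∧ Hul f (u l) :=
      fun l => exists_gt (by norm_num) (h1 l)
    choose f hf1 hf2 hf3 using hex
    obtain ⟨ht, hp⟩ := typ_sum j hf1 hf3 hu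
    have h3 := (le_abs_self _).trans ((le_N ht.W (avg u (nn j) 0)).trans (hQ 0))
    have hn : (0 : ℝ) < nn j := by exact_mod_cast nn_pos j
    have hm : (0 : ℝ) < mm j := by exact_mod_cast mm_pos j
    unfold avg at h3
    simp only [zero_add] at h3
    rw [map_smul, hp, smul_eq_mul] at h3
    have h4 : (nn j : ℝ) * (1 / 2) ≤ ∑ r ∈ Finset.range (nn j), pr (f r) (u r) := by
      calc (nn j : ℝ) * (1 / 2) = ∑ r ∈ Finset.range (nn j), (1 / 2 : ℝ) := by simp
        _ ≤ _ := Finset.sum_le_sum fun r _ => (hf2 r).le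
    have h5 : (mm j : ℝ) = 2 ^ ee j := by unfold mm; push_cast; rfl
    have h6 : (mm j : ℝ)⁻¹ * (1 / 2) ≤ ((2 : ℝ) ^ (ee j + 2))⁻¹ := by
      refine le_trans ?_ h3
      calc (mm j : ℝ)⁻¹ * (1 / 2) = (nn j : ℝ)⁻¹ * ((mm j : ℝ)⁻¹ * (nn j * (1 / 2))) := by
            field_simp
        _ ≤ _ := by gcongr
    rw [pow_add, ← h5, mul_inv] at h6
    have h7 : (0 : ℝ) < (mm j : ℝ)⁻¹ := by positivity
    norm_num at h6
    linarith
  have hex : ∃ s, s < ee j + 2 ∧ Q s ∧ ¬ Q (s + 1) := by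
    by_contra hc
    push Not at hc
    have : ∀ s, s ≤ ee j + 2 → Q s := by
      intro s
      induction s with
      | zero => intro _; exact hQ0
      | succ k ih => intro hk; exact hc k (by omega) (ih (by omega))
    exact hQS (this _ le_rfl)
  obtain ⟨s, hs, hQ, hQ'⟩ := hex
  simp only [Q, not_forall, not_le] at hQ'
  obtain ⟨a, ha⟩ := hQ'
  have h2s : (0 : ℝ) < 2 ^ s := by positivity
  have hM : (0 : ℝ) < MM j := by exact_mod_cast MM_pos j
  have hp : ∀ i, N ((2 : ℝ) ^ s • avg u (MM j ^ s) (a + i * MM j ^ s)) ≤ 1 := by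
    intro i
    rw [N_smul, abs_of_pos h2s]
    calc _ ≤ (2 : ℝ) ^ s * ((2 : ℝ) ^ s)⁻¹ := by gcongr; exact hQ _
      _ = 1 := by field_simp
  have hv : (2 : ℝ) ^ s • avg u (MM j ^ (s + 1)) a = (MM j : ℝ)⁻¹ •
      ∑ i ∈ Finset.range (MM j), (2 : ℝ) ^ s • avg u (MM j ^ s) (a + i * MM j ^ s) := by
    rw [pow_succ, mul_comm, avg_mul, ← Finset.smul_sum, smul_comm]
  refine ⟨s, a, hs, ?_, ?_, ?_⟩
  · rw [N_smul, abs_of_pos h2s]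
    calc (1 / 2 : ℝ) = 2 ^ s * ((2 : ℝ) ^ (s + 1))⁻¹ := by rw [pow_succ]; field_simp
      _ < _ := by gcongr
  · rw [hv, N_smul, abs_of_pos (by positivity)]
    calc _ ≤ (MM j : ℝ)⁻¹ * ∑ i ∈ Finset.range (MM j), 1 := by
          gcongr
          exact (N_sum_le _ _).trans (Finset.sum_le_sum fun i _ => hp i)
      _ = 1 := by simp; field_simp
  · refine ⟨_, ?_, hp, hv⟩
    intro i i' hii p hp q hq
    have hp' := Finsupp.support_smul hp
    have hq' := Finsupp.support_smul hq
    obtain ⟨l, hl, hpl⟩ := avg_support hp'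
    obtain ⟨l', hl', hql⟩ := avg_support hq'
    refine hu _ _ ?_ p hpl q hql
    have : (i + 1) * MM j ^ s ≤ i' * MM j ^ s := Nat.mul_le_mul_right _ hii
    rw [Nat.succ_mul] at this
    omega

lemma avg_mem {Z : Submodule ℝ (ℕ →₀ ℝ)} {u : ℕ → ℕ →₀ ℝ} (h : ∀ l, u l ∈ Z) (n a : ℕ) :
    avg u n a ∈ Z :=
  Z.smul_mem _ (Z.sum_mem fun _ _ => h _)

lemma level1 {Z : Submodule ℝ (ℕ →₀ ℝ)} (hZ : Far Z) (p j : ℕ) :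
    ∃ u ∈ Z, (∀ k ∈ u.support, p < k) ∧ 1 / 2 < N u ∧ N u ≤ 1 ∧ IsAvg (MM j) u := by
  have h0 : ∀ p, ∃ u ∈ Z, N u = 1 ∧ ∀ k ∈ u.support, p < k := by
    intro p
    obtain ⟨z, hz, hz0, hs⟩ := hZ p
    refine ⟨(N z)⁻¹ • z, Z.smul_mem _ hz, ?_, fun k hk => hs k (Finsupp.support_smul hk)⟩
    have := N_pos hz0
    rw [N_smul, abs_of_pos (by positivity)]
    field_simp
  obtain ⟨s, hs1, hs2, hs3⟩ := far_seq (fun x : ℕ →₀ ℝ => x) (fun _ u => u ∈ Z ∧ N u = 1)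
    (fun L p => by
      obtain ⟨u, h1, h2, h3⟩ := h0 p
      exact ⟨u, ⟨h1, h2⟩, h3⟩)
  obtain ⟨i, a, _, h1, h2, h3⟩ := james (u := fun l => s (p + l))
    (fun i j hij => hs2 _ _ (by omega)) (fun l => by rw [(hs1 _).2]; norm_num)
    (fun l => by rw [(hs1 _).2]) j
  refine ⟨_, Z.smul_mem _ (avg_mem (fun l => (hs1 _).1) _ _), ?_, h1, h2, h3⟩
  intro k hk
  obtain ⟨l, _, hl⟩ := avg_support (Finsupp.support_smul hk)
  have := hs3 _ k hl
  omega

lemma level2 {Z : Submodule ℝ (ℕ →₀ ℝ)} (hZ : Far Z) (p j : ℕ) :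
    ∃ v ∈ Z, (∀ k ∈ v.support, p < k) ∧ 1 / 2 < N v ∧ N v ≤ 1 ∧
      ∀ t f, t ≠ j → IsTyp t f → |pr f v| ≤ 2 * (mm (min t j) : ℝ)⁻¹ := by
  classical
  obtain ⟨s, hs1, hs2, hs3⟩ := far_seq (fun b : (ℕ →₀ ℝ) × ℕ => b.1)
    (fun L b => (b.1 ∈ Z ∧ 1 / 2 < N b.1 ∧ N b.1 ≤ 1 ∧ IsAvg (MM b.2) b.1) ∧
      ∀ c ∈ L, l1 c.1 ≤ b.2)
    (fun L p => by
      have : ∃ q : ℕ, ∀ c ∈ L, l1 c.1 ≤ q := by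
        induction L with
        | nil => exact ⟨0, by simp⟩
        | cons c L ih =>
          obtain ⟨q, hq⟩ := ih
          obtain ⟨r, hr⟩ := exists_nat_ge (l1 c.1)
          refine ⟨q + r, ?_⟩
          intro d hd
          push_cast
          rcases List.mem_cons.1 hd with rfl | hd
          · have : (0 : ℝ) ≤ q := by positivity
            linarith
          · have := hq d hd
            have : (0 : ℝ) ≤ r := by positivity
            linarith
      obtain ⟨q, hq⟩ := this
      obtain ⟨u, h1, h2, h3⟩ := level1 hZ p q
      exact ⟨(u, q), ⟨⟨h1, h3⟩, hq⟩, h2⟩)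
  have hl1 : ∀ l l', l < l' → l1 (s l).1 ≤ (s l').2 := by
    intro l l' h
    apply (hs1 l').2
    rw [List.mem_map]
    exact ⟨l, List.mem_range.2 h, rfl⟩
  set u : ℕ → ℕ →₀ ℝ := fun l => (s (p + l)).1 with hu
  obtain ⟨i, a, hi, h1, h2, h3⟩ := james (u := u)
    (fun i j hij => hs2 _ _ (by omega)) (fun l => (hs1 _).1.2.1)
    (fun l => (hs1 _).1.2.2.1) j
  refine ⟨_, Z.smul_mem _ (avg_mem (fun l => (hs1 _).1.1) _ _), ?_, h1, h2, ?_⟩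
  · intro k hk
    obtain ⟨l, _, hl⟩ := avg_support (Finsupp.support_smul hk)
    have := hs3 _ k hl
    omega
  have hmpos : ∀ t, (0 : ℝ) < mm t := fun t => by exact_mod_cast mm_pos t
  have hMpos : ∀ t, (0 : ℝ) < MM t := fun t => by exact_mod_cast MM_pos t
  have hnM : ∀ t j, t < j → (nn t : ℝ) / MM j ≤ (mm t : ℝ)⁻¹ := by
    intro t j h
    have : ((nn t * mm t : ℕ) : ℝ) ≤ MM j := by exact_mod_cast nn_mul_mm_le h
    push_cast at this
    rw [div_le_iff₀ (hMpos j), inv_mul_eq_div, le_div_iff₀ (hmpos t)]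
    exact this
  intro t f htj hf
  rcases lt_or_gt_of_ne htj with h | h
  · rw [min_eq_left h.le]
    have := avg_bound (MM_pos j) hf h3
    have := hnM t j h
    linarith
  · rw [min_eq_right h.le]
    have hmt : (4 * (t + 1) * mm j ^ 2 : ℝ) ≤ mm t := by exact_mod_cast mm_sq_le h
    have ht1 : (1 : ℝ) ≤ t := by exact_mod_cast (by omega : 1 ≤ t)
    have hmj := hmpos j
    have hmt' := hmpos t
    set c : ℝ := 1 / (4 * (mm j : ℝ) ^ 2) with hc
    have hc1 : 2 * (mm t : ℝ)⁻¹ ≤ c := by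
      rw [hc, ← div_eq_mul_inv, div_le_div_iff₀ hmt' (by positivity)]
      nlinarith [pow_pos hmj 2]
    have hc2 : (mm t : ℝ)⁻¹ * t ≤ c := by
      rw [hc, inv_mul_eq_div, div_le_div_iff₀ hmt' (by positivity)]
      nlinarith [pow_pos hmj 2]
    set n := MM j ^ (i + 1) with hn
    let D := (Finset.range n).filter fun l =>
      (s (p + (a + l))).2 ≤ t ∧ t < l1 (u (a + l))
    have hD : D.card ≤ 1 := by
      rw [Finset.card_le_one]
      have key : ∀ l ∈ D, ∀ l' ∈ D, ¬ l < l' := by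
        intro l hl l' hl' hlt
        have h4 := (Finset.mem_filter.1 hl).2
        have h5 := (Finset.mem_filter.1 hl').2
        have h6 := hl1 (p + (a + l)) (p + (a + l')) (by omega)
        have h7 : ((s (p + (a + l'))).2 : ℝ) ≤ t := by exact_mod_cast h5.1
        have h8 : (t : ℝ) < l1 (s (p + (a + l))).1 := h4.2
        linarith
      intro l hl l' hl'
      have := key l hl l' hl'
      have := key l' hl' l hl
      omega
    have hsum := sum_except (Finset.range n) D (fun l => |pr f (u (a + l))|) c 1 1
      (by positivity) (by norm_num)
      (by
        intro l hl hlD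
        by_cases h4 : (s (p + (a + l))).2 ≤ t
        · have h5 : ¬ (t < l1 (u (a + l))) := fun h5 => hlD (Finset.mem_filter.2 ⟨hl, h4, h5⟩)
          push Not at h5
          calc _ ≤ (mm t : ℝ)⁻¹ * l1 (u (a + l)) := typ_le_l1 hf _
            _ ≤ (mm t : ℝ)⁻¹ * t := by gcongr
            _ ≤ c := hc2
        · push Not at h4
          have h5 := avg_bound (MM_pos _) hf (hs1 (p + (a + l))).1.2.2.2
          have h6 := hnM t _ h4
          refine le_trans h5 ?_
          linarith)
      (fun l _ => (le_N hf.W _).trans (hs1 _).1.2.2.1) hD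
    rw [Finset.card_range] at hsum
    have hn0 : (0 : ℝ) < n := by rw [hn]; exact_mod_cast Nat.pow_pos (MM_pos j)
    have h2i : (2 : ℝ) ^ i ≤ 2 * mm j := by
      have : (mm j : ℝ) = 2 ^ ee j := by unfold mm; push_cast; rfl
      rw [this, ← pow_succ']
      exact pow_le_pow_right₀ (by norm_num) (by omega)
    have hb : (2 : ℝ) ^ i / n ≤ (mm j : ℝ)⁻¹ := by
      have h5 : (mm j : ℝ) ≤ MM j := by exact_mod_cast mm_le_MM j
      have h6 : (2 : ℝ) ≤ MM j := le_trans (by exact_mod_cast (by have := mm_ge j; omega : 2 ≤ mm j)) h5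
      have h7 : (2 : ℝ) ^ i ≤ (MM j : ℝ) ^ i := pow_le_pow_left₀ (by norm_num) h6 i
      have h8 : (n : ℝ) = (MM j : ℝ) ^ i * MM j := by rw [hn, pow_succ]; push_cast; ring
      rw [div_le_iff₀ hn0, inv_mul_eq_div, le_div_iff₀ hmj, h8]
      exact mul_le_mul h7 h5 hmj.le (by positivity)
    calc |pr f ((2 : ℝ) ^ i • avg u n a)|
        = (2 : ℝ) ^ i / n * |∑ l ∈ Finset.range n, pr f (u (a + l))| := by
          unfold avg
          rw [map_smul, map_smul, map_sum, smul_eq_mul, smul_eq_mul, ← mul_assoc, abs_mul,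
            abs_of_nonneg (by positivity), div_eq_mul_inv]
      _ ≤ (2 : ℝ) ^ i / n * (n * c + (1 : ℕ) * 1) := by
          gcongr
          exact (Finset.abs_sum_le_sum_abs _ _).trans hsum
      _ = 2 ^ i * c + 2 ^ i / n := by push_cast; field_simp
      _ ≤ 2 * mm j * c + (mm j : ℝ)⁻¹ := by gcongr
      _ ≤ 2 * (mm j : ℝ)⁻¹ := by
          have : 2 * mm j * c = (1 / 2) * (mm j : ℝ)⁻¹ := by rw [hc]; field_simp; norm_num
          rw [this]
          have : (0 : ℝ) < (mm j : ℝ)⁻¹ := by positivity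
          linarith

end EqPairs


namespace EqPairs

/-! ### Good sequences -/

structure GoodSeq (w : ℕ → ℕ →₀ ℝ) (jt : ℕ → ℕ) (Ex : ℕ → ℕ → Prop) (C : ℝ) : Prop where
  blk : Blk w
  Cpos : 0 < C
  Nle : ∀ k, N (w k) ≤ C
  ge : ∀ k, ∀ p ∈ (w k).support, k ≤ p
  jt_ge : ∀ k, k ≤ jt k
  jt_supp : ∀ k k', k' < k → ∀ p ∈ (w k').support, p ≤ jt k
  typ : ∀ k t f, ¬ Ex k t → IsTyp t f → |pr f (w k)| ≤ C * (mm (min t (jt k)) : ℝ)⁻¹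
  uniq : ∀ k k' t, Ex k t → Ex k' t → k = k'
  SP : ∀ (β : ℕ → ℕ →₀ ℚ) (t : ℕ → ℕ) (E : Set ℕ), (∀ i, IsTyp (t i) (β i)) → SpecSeq β t →
    E.OrdConnected → ∃ (D : Finset ℕ) (g : ℕ → Prop) , D.card ≤ 3 ∧ ∀ k, k ∉ D →
      (∀ i, g i → ¬ Ex k (t i)) ∧ ∀ n, ∃ c d : ℝ,
        (c = 0 ∨ g (2 * n) ∧ c = pr (rs E (β (2 * n))) (w k)) ∧
        (d = 0 ∨ g (2 * n + 1) ∧ d = pr (rs E (β (2 * n + 1))) (w k)) ∧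
        pr (rs E (β (2 * n)) + rs E (β (2 * n + 1))) (w k) = c + d

lemma mm_inv_anti {a b : ℕ} (h : a ≤ b) : (mm b : ℝ)⁻¹ ≤ (mm a : ℝ)⁻¹ := by
  have h1 : (0 : ℝ) < mm a := by exact_mod_cast mm_pos a
  have h2 : (mm a : ℝ) ≤ mm b := by exact_mod_cast mm_mono h
  gcongr

lemma spec_rem {w jt Ex C} (hw : GoodSeq w jt Ex C) {η : ℝ} (hη : 0 < η) :
    ∃ k0 : ℕ, ∀ (β : ℕ → ℕ →₀ ℚ) (t : ℕ → ℕ) (F : Finset ℕ) (ε : ℕ → ℚ) (E : Set ℕ),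
      (∀ i, IsTyp (t i) (β i)) → SpecSeq β t → (∀ n, |ε n| ≤ 1) → E.OrdConnected →
      (∀ n ∈ F, ∀ p ∈ E, p ∈ (β (2 * n)).support ∪ (β (2 * n + 1)).support → F.card ≤ p) →
      ∃ (D : Finset ℕ) (s : ℕ) (γ : ℕ →₀ ℚ), D.card ≤ 4 ∧ IsTyp s γ ∧ ∀ k, k0 ≤ k → k ∉ D →
        |pr (∑ n ∈ F, ε n • (rs E (β (2 * n)) + rs E (β (2 * n + 1)))) (w k)| ≤
          |pr γ (w k)| + η := by
  classical
  have hC := hw.Cpos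
  obtain ⟨k0, hk0⟩ := exists_pow_lt_of_lt_one (show 0 < η / (2 * C) by positivity)
    (show (1 / 2 : ℝ) < 1 by norm_num)
  refine ⟨k0, fun β t F ε E hβ hsp hε hE hF => ?_⟩
  obtain ⟨D, g, hD, hDg⟩ := hw.SP β t E hβ hsp hE
  have hpair : ∀ k, k ∉ D → ∀ (R : ℕ → ℝ), (∀ i, 0 ≤ R i) →
      (∀ i, i / 2 ∈ F → g i → |pr (rs E (β i)) (w k)| ≤ R i) →
      |pr (∑ n ∈ F, ε n • (rs E (β (2 * n)) + rs E (β (2 * n + 1)))) (w k)| ≤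
        ∑ n ∈ F, (R (2 * n) + R (2 * n + 1)) := by
    intro k hk R hR hRb
    rw [pr_sum_left]
    refine (Finset.abs_sum_le_sum_abs _ _).trans (Finset.sum_le_sum fun n hn => ?_)
    obtain ⟨c, d, hc, hd, hcd⟩ := (hDg k hk).2 n
    rw [pr_smul_left, hcd, abs_mul]
    have h1 : |(ε n : ℝ)| ≤ 1 := by exact_mod_cast hε n
    have h2 : |c| ≤ R (2 * n) := by
      rcases hc with rfl | ⟨h, rfl⟩
      · simpa using hR _
      · exact hRb _ (by rwa [Nat.mul_div_cancel_left _ (by norm_num)]) h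
    have h3 : |d| ≤ R (2 * n + 1) := by
      rcases hd with rfl | ⟨h, rfl⟩
      · simpa using hR _
      · exact hRb _ (by rwa [show (2 * n + 1) / 2 = n by omega]) h
    calc |(ε n : ℝ)| * |c + d| ≤ 1 * |c + d| := by gcongr
      _ ≤ |c| + |d| := by rw [one_mul]; exact abs_add_le _ _
      _ ≤ _ := add_le_add h2 h3
  by_cases hact : ∃ i, i / 2 ∈ F ∧ g i ∧ ∃ k, k0 ≤ k ∧ pr (rs E (β i)) (w k) ≠ 0
  · have hi1 := Nat.find_spec hact
    have hmin := fun i => Nat.find_min hact (m := i)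
    set i1 := Nat.find hact
    obtain ⟨hiF, hgi, k1, hk1, hne⟩ := hi1
    obtain ⟨p, hp1, hp2⟩ := pr_ne_zero hne
    rw [mem_rs_support] at hp1
    have hpk : k1 ≤ p := hw.ge k1 p hp2
    have hFp : F.card ≤ p := by
      apply hF _ hiF p hp1.1
      rw [Finset.mem_union]
      rcases Nat.mod_two_eq_zero_or_one i1 with h | h
      · left; rw [show 2 * (i1 / 2) = i1 by omega]; exact hp1.2
      · right; rw [show 2 * (i1 / 2) + 1 = i1 by omega]; exact hp1.2
    refine ⟨insert k1 D, t i1, rs E (β i1), (Finset.card_insert_le _ _).trans (by omega),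
      IsTyp_rs (hβ i1) hE, fun k hk hkD => ?_⟩
    rw [Finset.mem_insert, not_or] at hkD
    obtain ⟨hkk1, hkD⟩ := hkD
    set r : ℝ := C * (mm p : ℝ)⁻¹ with hr
    have hr0 : 0 ≤ r := by positivity
    set G := |pr (rs E (β i1)) (w k)| with hG
    have hG0 : 0 ≤ G := abs_nonneg _
    refine (hpair k hkD (fun i => (if i = i1 then G else 0) + r)
      (fun i => by positivity) ?_).trans ?_
    · intro i hiF' hgi'
      rcases lt_trichotomy i i1 with h | h | h
      · have : pr (rs E (β i)) (w k) = 0 := by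
          by_contra hc
          exact hmin i h ⟨hiF', hgi', k, hk, hc⟩
        rw [this, if_neg h.ne]; simpa using hr0
      · subst h
        rw [if_pos rfl]; linarith
      · rw [if_neg h.ne', zero_add]
        rcases lt_or_gt_of_ne hkk1 with h2 | h2
        · have : pr (rs E (β i)) (w k) = 0 := by
            by_contra hc
            obtain ⟨q, hq1, hq2⟩ := pr_ne_zero hc
            have h3 := hw.blk k k1 h2 q hq2 p hp2
            have h4 := hsp.2.1 i1 i h p hp1.2 q (mem_rs_support.1 hq1).2
            omega
          rw [this]; simpa using hr0
        · refine (hw.typ k (t i) _ ((hDg k hkD).1 i hgi') (IsTyp_rs (hβ i) hE)).trans ?_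
          have h3 : p ≤ jt k := hw.jt_supp k k1 h2 p hp2
          have h4 : p ≤ t i := hsp.2.2 i1 i h p hp1.2
          have := mm_inv_anti (le_min h4 h3)
          rw [hr]; gcongr
    · have h1 : ∑ n ∈ F, (((if 2 * n = i1 then G else 0) + r) +
          ((if 2 * n + 1 = i1 then G else 0) + r)) ≤
          ∑ n ∈ F, ((if n = i1 / 2 then G else 0) + 2 * r) := by
        refine Finset.sum_le_sum fun n _ => ?_
        split_ifs <;> first | omega | linarith
      refine h1.trans ?_
      rw [Finset.sum_add_distrib, Finset.sum_ite_eq', if_pos hiF]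
      simp only [Finset.sum_const, nsmul_eq_mul]
      have h2 : (F.card : ℝ) ≤ p := by exact_mod_cast hFp
      have h3 : (p : ℝ) * 2 ^ p ≤ mm p := by exact_mod_cast mul_two_pow_le_mm p
      have hm : (0 : ℝ) < mm p := by exact_mod_cast mm_pos p
      have h4 : (p : ℝ) * (mm p : ℝ)⁻¹ ≤ (1 / 2) ^ p := by
        rw [← div_eq_mul_inv, div_le_iff₀ hm, one_div, inv_pow, inv_mul_eq_div,
          le_div_iff₀ (by positivity)]
        exact h3
      have h5 : (1 / 2 : ℝ) ^ p ≤ (1 / 2) ^ k0 :=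
        pow_le_pow_of_le_one (by norm_num) (by norm_num) (by omega)
      have h6 : (F.card : ℝ) * (2 * r) ≤ η := by
        calc (F.card : ℝ) * (2 * r) ≤ p * (2 * r) := by gcongr
          _ = 2 * C * (p * (mm p : ℝ)⁻¹) := by rw [hr]; ring
          _ ≤ 2 * C * (η / (2 * C)) := by gcongr; linarith
          _ = η := by field_simp
      linarith
  · push Not at hact
    refine ⟨D, t 0, β 0, hD.trans (by norm_num), hβ 0, fun k hk hkD => ?_⟩
    refine (hpair k hkD (fun _ => 0) (fun _ => le_rfl) ?_).trans ?_
    · intro i h1 h2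
      rw [hact i h1 h2 k hk]; simp
    · simp only [add_zero, Finset.sum_const_zero]
      positivity

lemma typ_count {w jt Ex C} (hw : GoodSeq w jt Ex C) {j s B : ℕ} {k0 : ℕ} (hk0 : j ≤ k0) {δ : ℝ}
    (hδ : C * (mm j : ℝ)⁻¹ < δ) (hδ2 : C / 2 ^ s ≤ 16 * δ)
    (hB : ∀ f, W f → ∀ D : Finset ℕ, (∀ k ∈ D, k0 ≤ k ∧ C / 2 ^ s < |pr f (w k)|) → D.card ≤ B)
    {t f} (hf : IsTyp t f) (D : Finset ℕ) (hD : ∀ k ∈ D, k0 ≤ k ∧ δ < |pr f (w k)|) :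
    D.card ≤ np j * (1 + B) := by
  classical
  have hC := hw.Cpos
  have hnp := np_pos j
  rcases le_or_gt j t with hjt | hjt
  · have hex : ∀ k ∈ D, Ex k t := by
      intro k hk
      by_contra hc
      have h1 := hw.typ k t f hc hf
      have h2 : j ≤ jt k := by have := hw.jt_ge k; have := (hD k hk).1; omega
      have h3 := mm_inv_anti (le_min hjt h2)
      have h4 : C * (mm (min t (jt k)) : ℝ)⁻¹ ≤ C * (mm j : ℝ)⁻¹ := by gcongr
      have h5 := (hD k hk).2
      linarith
    have : D.card ≤ 1 := by
      rw [Finset.card_le_one]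
      intro k hk k' hk'
      exact hw.uniq k k' t (hex k hk) (hex k' hk')
    nlinarith
  · obtain ⟨L, h1, h2, rfl⟩ := hf
    obtain ⟨D', hD', hc, ρ, hρ⟩ := BG t h2 hw.blk D
    have hsplit : D.card ≤ D'.card + (D \ D').card := by
      rw [Finset.card_sdiff_of_subset hD']; have := Finset.card_le_card hD'; omega
    have hm : (16 : ℝ) ≤ mm t := by exact_mod_cast mm_ge t
    have h3 : (D \ D').card ≤ nn t * B := by
      have := Finset.card_le_mul_card_image_of_maps_to (s := D \ D') (t := Finset.range (nn t))
        (f := ρ) (fun k hk => by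
          rw [Finset.mem_sdiff] at hk
          exact Finset.mem_range.2 (hρ k hk.1 hk.2).1) B (fun r _ => by
          apply hB (L r) (h1 r)
          intro k hk
          rw [Finset.mem_filter, Finset.mem_sdiff] at hk
          obtain ⟨⟨hk1, hk2⟩, rfl⟩ := hk
          refine ⟨(hD k hk1).1, ?_⟩
          have h4 := (hD k hk1).2
          rw [(hρ k hk1 hk2).2, abs_mul, abs_of_nonneg (mm_inv_nonneg t), inv_mul_eq_div,
            lt_div_iff₀ (by linarith)] at h4
          have h5 : 0 < δ := lt_of_le_of_lt (by positivity) hδ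
          nlinarith)
      rw [Finset.card_range] at this
      linarith
    have h4 := nn_le_np hjt
    calc D.card ≤ nn t + nn t * B := by omega
      _ = nn t * (1 + B) := by ring
      _ ≤ _ := Nat.mul_le_mul_right _ h4

lemma count {w jt Ex C} (hw : GoodSeq w jt Ex C) (j : ℕ) :
    ∃ k0 : ℕ, ∀ f, W f → ∀ D : Finset ℕ,
      (∀ k ∈ D, k0 ≤ k ∧ 4 * C * (mm j : ℝ)⁻¹ < |pr f (w k)|) → D.card ≤ BB j := by
  classical
  have hC := hw.Cpos
  have hm : (0 : ℝ) < mm j := by exact_mod_cast mm_pos j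
  obtain ⟨k1, hk1⟩ := spec_rem hw (show 0 < C * (mm j : ℝ)⁻¹ by positivity)
  set η := C * (mm j : ℝ)⁻¹ with hη
  have hη0 : 0 < η := by positivity
  have hnp := np_pos j
  have hmp : (mm j : ℝ) = 2 ^ ee j := by unfold mm; push_cast; rfl
  have hlev : ∀ s, s + 2 ≤ ee j → 4 * η ≤ C / 2 ^ s := by
    intro s hs
    have : (2 : ℝ) ^ (s + 2) ≤ 2 ^ ee j := pow_le_pow_right₀ (by norm_num) hs
    rw [hη, hmp, le_div_iff₀ (by positivity), ← div_eq_mul_inv, mul_div_assoc', div_mul_eq_mul_div,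
      div_le_iff₀ (by positivity)]
    rw [pow_add] at this
    nlinarith
  refine ⟨max k1 j, ?_⟩
  have main : ∀ s, s + 2 ≤ ee j → ∀ f, W f → ∀ D : Finset ℕ,
      (∀ k ∈ D, max k1 j ≤ k ∧ C / 2 ^ s < |pr f (w k)|) → D.card ≤ (7 * np j) ^ s := by
    intro s
    induction s with
    | zero =>
      intro _ f hf D hD
      have : D = ∅ := by
        rw [Finset.eq_empty_iff_forall_notMem]
        intro k hk
        have h1 := (hD k hk).2
        have h2 := (le_N hf (w k)).trans (hw.Nle k)
        simp at h1
        linarith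
      simp [this]
    | succ s ih =>
      intro hs f hf D hD
      have ih' := ih (by omega)
      have hl := hlev (s + 1) hs
      have hpow : C / 2 ^ s = 2 * (C / 2 ^ (s + 1)) := by rw [pow_succ]; field_simp
      set δ := C / 2 ^ (s + 1) with hδ
      set B := (7 * np j) ^ s with hB
      have hBpos : 1 ≤ B := Nat.one_le_pow _ _ (by positivity)
      have hfin : 4 + np j * (1 + B) ≤ (7 * np j) ^ (s + 1) := by
        rw [pow_succ, ← hB]
        nlinarith [Nat.mul_le_mul hnp hBpos, Nat.mul_le_mul_left (np j) hBpos]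
      have htyp : ∀ {t g}, IsTyp t g → ∀ D : Finset ℕ,
          (∀ k ∈ D, max k1 j ≤ k ∧ δ / 2 < |pr g (w k)|) → D.card ≤ np j * (1 + B) :=
        fun hg D hD => typ_count hw (le_max_right _ _) (by linarith) (by linarith) ih' hg D hD
      refine le_trans ?_ hfin
      cases hf with
      | basis n a h =>
        have : D.card ≤ 1 := by
          rw [Finset.card_le_one]
          have key : ∀ k ∈ D, n ∈ (w k).support := by
            intro k hk
            have h1 : pr (Finsupp.single n a) (w k) ≠ 0 := by
              have h1 := (hD k hk).2
              have : 0 < |pr (Finsupp.single n a) (w k)| := by linarith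
              exact abs_pos.1 this
            obtain ⟨q, hq1, hq2⟩ := pr_ne_zero h1
            have := Finsupp.support_single_subset hq1
            rw [Finset.mem_singleton] at this
            rwa [← this]
          intro k hk k' hk'
          rcases lt_trichotomy k k' with h1 | h1 | h1
          · exact absurd (hw.blk _ _ h1 n (key k hk) n (key k' hk')) (lt_irrefl _)
          · exact h1
          · exact absurd (hw.blk _ _ h1 n (key k' hk') n (key k hk)) (lt_irrefl _)
        omega
      | typ t L hL hs =>
        have := htyp (t := t) ⟨L, hL, hs, rfl⟩ D fun k hk => ⟨(hD k hk).1, by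
          have := (hD k hk).2; linarith⟩
        omega
      | spec β t L F ε E hL hs hβ hsp hε hE hF =>
        obtain ⟨D4, s4, γ, h4, hγ, hb⟩ := hk1 β t F ε E (fun i => ⟨L i, hL i, hs i, hβ i⟩)
          hsp hε hE hF
        have h5 := htyp hγ (D \ D4) fun k hk => by
          rw [Finset.mem_sdiff] at hk
          obtain ⟨h6, h7⟩ := hD k hk.1
          have h8 := hb k ((le_max_left _ _).trans h6) hk.2
          exact ⟨h6, by linarith⟩
        have h6 := Finset.le_card_sdiff D4 D
        omega
  intro f hf D hD
  have hee := ee_ge j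
  have h1 := main (ee j - 2) (by omega) f hf D fun k hk => by
    obtain ⟨h2, h3⟩ := hD k hk
    refine ⟨h2, lt_of_le_of_lt (le_of_eq ?_) h3⟩
    rw [hmp]
    have : (2 : ℝ) ^ ee j = 2 ^ (ee j - 2) * 4 := by
      rw [show (4 : ℝ) = 2 ^ 2 by norm_num, ← pow_add]; congr 1; omega
    rw [this]; field_simp
  exact h1.trans (Nat.pow_le_pow_right (by positivity) (by omega))

end EqPairs


namespace EqPairs

lemma sum_bounds {w jt Ex C} (hw : GoodSeq w jt Ex C) (j : ℕ) :
    ∃ K : ℕ, ∃ S : ℕ →₀ ℝ, S = ∑ l ∈ Finset.range (nn j), w (K + l) ∧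
      (∀ f, W f → |pr f S| ≤ 5 * C * (nn j / mm j)) ∧
      (∀ t f, t < j → IsTyp t f → |pr f S| ≤ 5 * C * (nn j / mm j) * (mm t : ℝ)⁻¹) ∧
      (∀ t f, j < t → IsTyp t f → |pr f S| ≤ 2 * C * (nn j / mm j) * (mm j : ℝ)⁻¹) := by
  classical
  have hC := hw.Cpos
  have hmpos : ∀ t, (0 : ℝ) < mm t := fun t => by exact_mod_cast mm_pos t
  have hm := hmpos j
  have hn : (0 : ℝ) < nn j := by exact_mod_cast nn_pos j
  obtain ⟨k0, hk0⟩ := count hw j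
  set K := max k0 (j + 1) with hK
  refine ⟨K, _, rfl, ?_⟩
  have hS : ∑ l ∈ Finset.range (nn j), w (K + l) = ∑ k ∈ Finset.Ico K (K + nn j), w k := by
    rw [Finset.sum_Ico_eq_sum_range]; simp
  rw [hS]
  set G := Finset.Ico K (K + nn j) with hG
  have hGc : (G.card : ℝ) = nn j := by simp [hG]
  have hGk : ∀ k ∈ G, k0 ≤ k ∧ j < k := by
    intro k hk
    have := (Finset.mem_Ico.1 hk).1
    constructor <;> omega
  have hab : ∀ f, |pr f (∑ k ∈ G, w k)| ≤ ∑ k ∈ G, |pr f (w k)| := by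
    intro f; rw [map_sum]; exact Finset.abs_sum_le_sum_abs _ _
  refine ⟨fun f hf => ?_, fun t f ht hf => ?_, fun t f ht hf => ?_⟩
  · have h1 := sum_except G (G.filter fun k => 4 * C * (mm j : ℝ)⁻¹ < |pr f (w k)|)
      (fun k => |pr f (w k)|) (4 * C * (mm j : ℝ)⁻¹) C (BB j) (by positivity) hC.le
      (fun k hk hkD => by
        rw [Finset.mem_filter] at hkD
        push Not at hkD
        exact hkD hk)
      (fun k _ => (le_N hf _).trans (hw.Nle k))
      (hk0 f hf _ fun k hk => by
        rw [Finset.mem_filter] at hk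
        exact ⟨(hGk k hk.1).1, hk.2⟩)
    rw [hGc] at h1
    have h2 : (mm j * BB j : ℝ) ≤ nn j := by exact_mod_cast mm_mul_BB_le j
    have h3 : (BB j : ℝ) ≤ nn j / mm j := by rw [le_div_iff₀ hm]; linarith
    calc _ ≤ _ := hab f
      _ ≤ _ := h1
      _ ≤ nn j * (4 * C * (mm j : ℝ)⁻¹) + (nn j / mm j) * C := by gcongr
      _ = _ := by field_simp; ring
  · have hfW := hf.W
    obtain ⟨L, h1, h2, rfl⟩ := hf
    obtain ⟨D', hD', hc, ρ, hρ⟩ := BG t h2 hw.blk G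
    set f := ((mm t : ℚ)⁻¹ • ∑ r ∈ Finset.range (nn t), L r)
    set c := 4 * C * (mm j : ℝ)⁻¹ with hcdef
    let D2 := (G \ D').filter fun k => c < |pr (L (ρ k)) (w k)|
    have hD2 : D2.card ≤ nn t * BB j := by
      have := Finset.card_le_mul_card_image_of_maps_to (s := D2) (t := Finset.range (nn t))
        (f := ρ) (fun k hk => by
          rw [Finset.mem_filter, Finset.mem_sdiff] at hk
          exact Finset.mem_range.2 (hρ k hk.1.1 hk.1.2).1) (BB j) (fun r _ => by
          apply hk0 (L r) (h1 r)
          intro k hk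
          rw [Finset.mem_filter, Finset.mem_filter, Finset.mem_sdiff] at hk
          obtain ⟨⟨⟨hk1, hk2⟩, hk3⟩, rfl⟩ := hk
          exact ⟨(hGk k hk1).1, hk3⟩)
      rw [Finset.card_range] at this
      linarith
    have hcard : (D' ∪ D2).card ≤ nn t * (1 + BB j) := by
      refine (Finset.card_union_le _ _).trans ?_
      rw [mul_add, mul_one]
      omega
    have hmt := hmpos t
    have h3 := sum_except G (D' ∪ D2) (fun k => |pr f (w k)|) ((mm t : ℝ)⁻¹ * c) C _
      (by positivity) hC.le
      (fun k hk hkD => by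
        rw [Finset.mem_union, not_or] at hkD
        obtain ⟨hk1, hk2⟩ := hkD
        have hle : |pr (L (ρ k)) (w k)| ≤ c := by
          by_contra hcon
          push Not at hcon
          exact hk2 (Finset.mem_filter.2 ⟨Finset.mem_sdiff.2 ⟨hk, hk1⟩, hcon⟩)
        rw [(hρ k hk hk1).2, abs_mul, abs_of_nonneg (mm_inv_nonneg t)]
        gcongr)
      (fun k _ => (le_N hfW _).trans (hw.Nle k)) hcard
    rw [hGc] at h3
    have h4 : (mm j * (mm t * nn t) * (1 + BB j) : ℝ) ≤ nn j := by exact_mod_cast mm_nn_BB_le ht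
    have h5 : ((nn t * (1 + BB j) : ℕ) : ℝ) ≤ nn j / mm j * (mm t : ℝ)⁻¹ := by
      rw [← div_eq_mul_inv, le_div_iff₀ hmt, le_div_iff₀ hm]
      push_cast
      linarith
    calc _ ≤ _ := hab f
      _ ≤ _ := h3
      _ ≤ nn j * ((mm t : ℝ)⁻¹ * c) + (nn j / mm j * (mm t : ℝ)⁻¹) * C := by gcongr
      _ = _ := by rw [hcdef]; field_simp; ring
  · let D := G.filter fun k => Ex k t
    have hD : D.card ≤ 1 := by
      rw [Finset.card_le_one]
      intro k hk k' hk'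
      exact hw.uniq k k' t (Finset.mem_filter.1 hk).2 (Finset.mem_filter.1 hk').2
    have h1 := sum_except G D (fun k => |pr f (w k)|) (C * ((mm j : ℝ)⁻¹ * (mm j : ℝ)⁻¹)) C 1
      (by positivity) hC.le
      (fun k hk hkD => by
        have hex : ¬ Ex k t := fun h => hkD (Finset.mem_filter.2 ⟨hk, h⟩)
        have h2 : j + 1 ≤ min t (jt k) := by
          have := hw.jt_ge k; have := (hGk k hk).2; exact le_min ht (by omega)
        have h3 : (4 * ((j + 1 : ℕ) + 1) * mm j ^ 2 : ℝ) ≤ mm (j + 1) := by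
          exact_mod_cast mm_sq_le (Nat.lt_succ_self j)
        have h4 : (mm j * mm j : ℝ) ≤ mm (j + 1) := by
          push_cast at h3
          have : (0 : ℝ) ≤ j := by positivity
          nlinarith [pow_pos hm 2, mul_nonneg this (pow_pos hm 2).le]
        refine (hw.typ k t f hex hf).trans ?_
        have h5 := mm_inv_anti h2
        rw [← mul_inv]
        have h6 : (mm (j + 1) : ℝ)⁻¹ ≤ (mm j * mm j : ℝ)⁻¹ := by gcongr
        have := h5.trans h6
        gcongr)
      (fun k _ => (le_N hf.W _).trans (hw.Nle k)) hD
    rw [hGc] at h1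
    have h2 : (mm j * mm j : ℝ) ≤ nn j := by exact_mod_cast mm_sq_le_nn j
    have h3 : (1 : ℝ) ≤ nn j / mm j * (mm j : ℝ)⁻¹ := by
      rw [← div_eq_mul_inv, le_div_iff₀ hm, le_div_iff₀ hm]; linarith
    calc _ ≤ _ := hab f
      _ ≤ _ := h1
      _ ≤ nn j * (C * ((mm j : ℝ)⁻¹ * (mm j : ℝ)⁻¹)) + (nn j / mm j * (mm j : ℝ)⁻¹) * C := by
        push_cast
        have : C ≤ (nn j / mm j * (mm j : ℝ)⁻¹) * C := by nlinarith
        linarith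
      _ = _ := by field_simp; ring

lemma level2_seq {Z : Submodule ℝ (ℕ →₀ ℝ)} (hZ : Far Z) (p : ℕ) :
    ∃ (v : ℕ → ℕ →₀ ℝ) (jt : ℕ → ℕ), GoodSeq v jt (fun k t => t = jt k) 2 ∧
      ∀ k, v k ∈ Z ∧ 1 / 2 < N (v k) ∧ ∀ i ∈ (v k).support, p < i := by
  obtain ⟨s, hs1, hs2, hs3⟩ := far_seq (fun b : (ℕ →₀ ℝ) × ℕ => b.1)
    (fun L b => (b.1 ∈ Z ∧ (∀ k ∈ b.1.support, p < k) ∧ 1 / 2 < N b.1 ∧ N b.1 ≤ 1 ∧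
      ∀ t f, t ≠ b.2 → IsTyp t f → |pr f b.1| ≤ 2 * (mm (min t b.2) : ℝ)⁻¹) ∧
      b.2 % 2 = 1 ∧ L.length ≤ b.2 ∧ ∀ c ∈ L, mx c.1 ≤ b.2 ∧ c.2 < b.2)
    (fun L q => by
      have : ∃ r : ℕ, r % 2 = 1 ∧ L.length ≤ r ∧ ∀ c ∈ L, mx c.1 ≤ r ∧ c.2 < r := by
        refine ⟨2 * (L.length + (L.map fun c => mx c.1 + c.2).sum) + 1, by omega, by omega, ?_⟩
        intro c hc
        have : mx c.1 + c.2 ≤ (L.map fun c => mx c.1 + c.2).sum := by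
          apply List.le_sum_of_mem
          exact List.mem_map.2 ⟨c, hc, rfl⟩
        constructor <;> omega
      obtain ⟨r, hr⟩ := this
      obtain ⟨v, h1, h2, h3⟩ := level2 hZ (p + q) r
      exact ⟨(v, r), ⟨⟨h1, fun k hk => by have := h2 k hk; omega, h3⟩, hr⟩,
        fun k hk => by have := h2 k hk; omega⟩)
  have hhist : ∀ k k', k' < k → mx (s k').1 ≤ (s k).2 ∧ (s k').2 < (s k).2 := by
    intro k k' h
    apply (hs1 k).2.2.2
    exact List.mem_map.2 ⟨k', List.mem_range.2 h, rfl⟩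
  refine ⟨fun k => (s k).1, fun k => (s k).2, ?_, fun k => ⟨(hs1 k).1.1, (hs1 k).1.2.2.1,
    (hs1 k).1.2.1⟩⟩
  refine ⟨hs2, by norm_num, fun k => (hs1 k).1.2.2.2.1.trans (by norm_num),
    fun k q hq => (hs3 k q hq).le, fun k => ?_, fun k k' h q hq => ?_, fun k t f hex hf => ?_, 
    fun k k' t h h' => ?_, fun β t E hβ hsp hE => ?_⟩
  · have := (hs1 k).2.2.1
    simpa using this
  · exact (le_mx hq).trans (hhist k k' h).1
  · exact (hs1 k).1.2.2.2.2 t f hex hf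
  · simp only at h h'
    rcases lt_trichotomy k k' with h1 | h1 | h1
    · have := (hhist k' k h1).2; omega
    · exact h1
    · have := (hhist k k' h1).2; omega
  · refine ⟨∅, fun _ => True, by simp, fun k _ => ⟨fun i _ h => ?_, fun n =>
      ⟨_, _, Or.inr ⟨trivial, rfl⟩, Or.inr ⟨trivial, rfl⟩, pr_add_left _ _ _⟩⟩⟩
    have h1 := (hsp.1 i).1
    have h2 := (hs1 k).2.1
    change t i = (s k).2 at h
    omega

lemma level3 {Z : Submodule ℝ (ℕ →₀ ℝ)} (hZ : Far Z) (p j : ℕ) :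
    ∃ x ∈ Z, ∃ α, (∀ k ∈ x.support, p < k) ∧ IsTyp j α ∧ Hul α x ∧ pr α x = 1 ∧ N x ≤ 20 ∧
      ∀ t f, t ≠ j → IsTyp t f → |pr f x| ≤ 20 * (mm (min t j) : ℝ)⁻¹ := by
  obtain ⟨v, jt, hv, hvZ⟩ := level2_seq hZ p
  obtain ⟨K, S, hS, hS1, hS2, hS3⟩ := sum_bounds hv j
  have hex : ∀ l, ∃ f, W f ∧ 1 / 2 < pr f (v (K + l)) ∧ Hul f (v (K + l)) :=
    fun l => exists_gt (by norm_num) (hvZ _).2.1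
  choose f hf1 hf2 hf3 using hex
  obtain ⟨ht, hp⟩ := typ_sum j (u := fun l => v (K + l)) hf1 hf3
    (fun a b hab => hv.blk _ _ (by omega))
  rw [← hS] at hp
  set α := (mm j : ℚ)⁻¹ • ∑ r ∈ Finset.range (nn j), f r with hα
  have hn : (0 : ℝ) < nn j := by exact_mod_cast nn_pos j
  have hm : (0 : ℝ) < mm j := by exact_mod_cast mm_pos j
  have h4 : (nn j : ℝ) * (1 / 2) ≤ ∑ r ∈ Finset.range (nn j), pr (f r) (v (K + r)) := by
    calc (nn j : ℝ) * (1 / 2) = ∑ r ∈ Finset.range (nn j), (1 / 2 : ℝ) := by simp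
      _ ≤ _ := Finset.sum_le_sum fun r _ => (hf2 r).le
  set a := pr α S with ha
  set q : ℝ := nn j / mm j with hq
  have hq0 : 0 < q := by positivity
  have ha2 : q / 2 ≤ a := by
    rw [hp, hq]
    calc _ = (mm j : ℝ)⁻¹ * (nn j * (1 / 2)) := by field_simp
      _ ≤ _ := by gcongr
  have ha0 : 0 < a := by linarith
  have hSZ : S ∈ Z := by
    rw [hS]; exact Z.sum_mem fun l _ => (hvZ _).1
  have key : ∀ (g : ℕ →₀ ℚ) (c : ℝ), 0 ≤ c → |pr g S| ≤ 10 * q * c → |pr g (a⁻¹ • S)| ≤ 20 * c := by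
    intro g c hc h
    rw [map_smul, smul_eq_mul, abs_mul, abs_of_pos (by positivity), inv_mul_eq_div,
      div_le_iff₀ ha0]
    nlinarith
  have hsupS : ∀ k ∈ S.support, ∃ l < nn j, k ∈ (v (K + l)).support := by
    intro k hk
    by_contra hcon
    push Not at hcon
    rw [Finsupp.mem_support_iff] at hk
    apply hk
    rw [hS, Finsupp.finsetSum_apply, Finset.sum_eq_zero]
    intro l hl
    exact Finsupp.notMem_support_iff.1 (hcon l (Finset.mem_range.1 hl))
  have hsupS' : ∀ l < nn j, ∀ k ∈ (v (K + l)).support, k ∈ S.support := by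
    intro l hl k hk
    rw [Finsupp.mem_support_iff, hS, Finsupp.finsetSum_apply, Finset.sum_eq_single l]
    · exact Finsupp.mem_support_iff.1 hk
    · intro l' _ hne
      by_contra hcon
      have hk' : k ∈ (v (K + l')).support := Finsupp.mem_support_iff.2 hcon
      rcases lt_or_gt_of_ne hne with h | h
      · exact lt_irrefl _ (hv.blk _ _ (show K + l' < K + l by omega) k hk' k hk)
      · exact lt_irrefl _ (hv.blk _ _ (show K + l < K + l' by omega) k hk k hk')
    · intro h; exact absurd (Finset.mem_range.2 hl) h
  have hsx : (a⁻¹ • S).support = S.support := Finsupp.support_smul_eq (by positivity)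
  refine ⟨a⁻¹ • S, Z.smul_mem _ hSZ, α, ?_, ht, ?_, ?_, ?_, ?_⟩
  · intro k hk
    rw [hsx] at hk
    obtain ⟨l, _, hl⟩ := hsupS k hk
    exact (hvZ _).2.2 k hl
  · intro k hk
    rw [hsx]
    have : ∃ r < nn j, k ∈ (f r).support := by
      by_contra hcon
      push Not at hcon
      rw [Finsupp.mem_support_iff] at hk
      apply hk
      rw [hα, Finsupp.smul_apply, Finsupp.finsetSum_apply, Finset.sum_eq_zero]
      · simp
      · intro l hl
        exact Finsupp.notMem_support_iff.1 (hcon l (Finset.mem_range.1 hl))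
    obtain ⟨r, hr, hkr⟩ := this
    obtain ⟨b, hb, c, hc, h1, h2⟩ := hf3 r k hkr
    exact ⟨b, hsupS' r hr b hb, c, hsupS' r hr c hc, h1, h2⟩
  · rw [map_smul, ← ha, smul_eq_mul]; field_simp
  · apply N_le (by norm_num)
    intro g hg
    have := key g 1 (by norm_num) (by have := hS1 g hg; linarith)
    linarith
  · intro t g htj hg
    apply key _ _ (mm_inv_nonneg _)
    rcases lt_or_gt_of_ne htj with h | h
    · rw [min_eq_left h.le]
      have := hS2 t g h hg
      linarith
    · rw [min_eq_right h.le]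
      have := hS3 t g h hg
      have h5 : 0 ≤ q * (mm j : ℝ)⁻¹ := by positivity
      linarith

end EqPairs


namespace EqPairs

structure Lev4 (x : ℕ → ℕ →₀ ℝ) (α : ℕ → ℕ →₀ ℚ) (t : ℕ → ℕ) : Prop where
  ty : ∀ i, IsTyp (t i) (α i)
  hul : ∀ i, Hul (α i) (x i)
  one : ∀ i, pr (α i) (x i) = 1
  Nle : ∀ i, N (x i) ≤ 20
  bd : ∀ i s f, s ≠ t i → IsTyp s f → |pr f (x i)| ≤ 20 * (mm (min s (t i)) : ℝ)⁻¹
  sp : SpecSeq α t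
  blk : Blk x
  far : ∀ i, ∀ k ∈ (x i).support, i < k
  tge : ∀ i, i ≤ t i
  tlt : ∀ i j, i < j → t i < t j
  tsup : ∀ i j, i < j → ∀ k ∈ (x i).support, k ≤ t j

lemma level4 {Z : Submodule ℝ (ℕ →₀ ℝ)} (hZ : Far Z) :
    ∃ x α t, Lev4 x α t ∧ ∀ i, x i ∈ Z := by
  obtain ⟨s, hs1, hs2, hs3⟩ := far_seq (fun b : (ℕ →₀ ℝ) × (ℕ →₀ ℚ) × ℕ => b.1)
    (fun L b => (b.1 ∈ Z ∧ IsTyp b.2.2 b.2.1 ∧ Hul b.2.1 b.1 ∧ pr b.2.1 b.1 = 1 ∧ N b.1 ≤ 20 ∧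
      ∀ t f, t ≠ b.2.2 → IsTyp t f → |pr f b.1| ≤ 20 * (mm (min t b.2.2) : ℝ)⁻¹) ∧
      (b.2.2 % 2 = 0 ∧ (Nat.unpair (b.2.2 / 2)).1 = cd (L.map fun c => (c.2.1, c.2.2))) ∧
      L.length ≤ b.2.2 ∧ ∀ c ∈ L, mx c.1 ≤ b.2.2 ∧ c.2.2 < b.2.2)
    (fun L q => by
      set u := cd (L.map fun c => (c.2.1, c.2.2))
      set Q := L.length + (L.map fun c => mx c.1 + c.2.2).sum + 1 with hQ
      have hle : Q ≤ Nat.pair u Q := Nat.right_le_pair u Q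
      obtain ⟨x, h1, α, h2, h3⟩ := level3 hZ q (2 * Nat.pair u Q)
      refine ⟨(x, α, 2 * Nat.pair u Q), ⟨⟨h1, h3⟩, ⟨?_, ?_⟩, ?_, ?_⟩, h2⟩
      · simp
      · simp
      · simp only; omega
      · intro c hc
        have : mx c.1 + c.2.2 ≤ (L.map fun c => mx c.1 + c.2.2).sum := by
          apply List.le_sum_of_mem
          exact List.mem_map.2 ⟨c, hc, rfl⟩
        simp only
        constructor <;> omega)
  have hhist : ∀ k k', k' < k → mx (s k').1 ≤ (s k).2.2 ∧ (s k').2.2 < (s k).2.2 := by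
    intro k k' h
    apply (hs1 k).2.2.2
    exact List.mem_map.2 ⟨k', List.mem_range.2 h, rfl⟩
  have hul : ∀ i, Hul (s i).2.1 (s i).1 := fun i => (hs1 i).1.2.2.1
  refine ⟨fun i => (s i).1, fun i => (s i).2.1, fun i => (s i).2.2, ?_, fun i => (hs1 i).1.1⟩
  refine ⟨fun i => (hs1 i).1.2.1, hul, fun i => (hs1 i).1.2.2.2.1, fun i => (hs1 i).1.2.2.2.2.1,
    fun i => (hs1 i).1.2.2.2.2.2, ⟨fun i => ?_, Hul_Blk hul hs2, ?_⟩, hs2, hs3, fun i => ?_,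
    fun i j h => (hhist j i h).2, fun i j h k hk => (le_mx hk).trans (hhist j i h).1⟩
  · have := (hs1 i).2.1
    rw [List.map_map] at this
    exact this
  · intro i j hij p hp
    obtain ⟨_, _, b, hb, _, h⟩ := hul i p hp
    exact h.trans ((le_mx hb).trans (hhist j i hij).1)
  · have := (hs1 i).2.2.1
    simpa using this

lemma pre_eq {β α : ℕ → ℕ →₀ ℚ} {τ t : ℕ → ℕ} {i i' : ℕ} (h : pre β τ i = pre α t i') :
    i = i' ∧ ∀ k < i, β k = α k ∧ τ k = t k := by
  have h1 : i = i' := by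
    have := congrArg List.length h
    simpa [pre] using this
  subst h1
  refine ⟨rfl, fun k hk => ?_⟩
  unfold pre at h
  rw [List.map_inj_left] at h
  have := h k (List.mem_range.2 hk)
  simpa using this

lemma spec_code {β α : ℕ → ℕ →₀ ℚ} {τ t : ℕ → ℕ} (h1 : SpecSeq β τ) (h2 : SpecSeq α t) {i i' : ℕ}
    (h : τ i = t i') : i = i' ∧ ∀ k < i, β k = α k ∧ τ k = t k := by
  have h3 := (h1.1 i).2
  have h4 := (h2.1 i').2
  rw [h] at h3
  exact pre_eq (cd_inj (h3.symm.trans h4))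

lemma cut_two {A : ℕ → Set ℕ} (hA : ∀ i j, i < j → ∀ p ∈ A i, ∀ q ∈ A j, p < q) {E : Set ℕ}
    (hE : E.OrdConnected) : ∃ n1 n2, ∀ n, n ≠ n1 → n ≠ n2 → A n ⊆ E ∨ A n ∩ E = ∅ := by
  classical
  let cut : ℕ → Prop := fun n => (∃ p ∈ A n, p ∈ E) ∧ ∃ q ∈ A n, q ∉ E
  have hcut : ∀ n, ¬ cut n → A n ⊆ E ∨ A n ∩ E = ∅ := by
    intro n hn
    by_cases h : ∃ p ∈ A n, p ∈ E
    · left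
      intro q hq
      by_contra hc
      exact hn ⟨h, q, hq, hc⟩
    · right
      ext p
      simp only [Set.mem_inter_iff, Set.mem_empty_iff_false, iff_false]
      exact fun hp => h ⟨p, hp.1, hp.2⟩
  have h3 : ∀ a b c, a < b → b < c → cut a → cut b → cut c → False := by
    rintro a b c hab hbc ⟨⟨p, hp, hpE⟩, _⟩ ⟨_, q, hq, hqE⟩ ⟨⟨r, hr, hrE⟩, _⟩
    exact hqE (hE.out hpE hrE ⟨(hA a b hab p hp q hq).le, (hA b c hbc q hq r hr).le⟩)
  by_cases hc : ∃ n, cut n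
  · have hn1 := Nat.find_spec hc
    have hmin := fun m => Nat.find_min hc (m := m)
    set n1 := Nat.find hc
    by_cases hc2 : ∃ n, n ≠ n1 ∧ cut n
    · obtain ⟨n2, hne, hn2⟩ := hc2
      refine ⟨n1, n2, fun n h1 h2 => hcut n fun hn => ?_⟩
      have h4 : n1 < n2 := by
        by_contra h; exact hmin n2 (by omega) hn2
      have h5 : n1 < n := by
        by_contra h; exact hmin n (by omega) hn
      rcases lt_or_gt_of_ne h2 with h | h
      · exact h3 n1 n n2 h5 h hn1 hn hn2
      · exact h3 n1 n2 n h4 h hn1 hn2 hn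
    · exact ⟨n1, n1, fun n h1 _ => hcut n fun hn => hc2 ⟨n, h1, hn⟩⟩
  · exact ⟨0, 0, fun n _ _ => hcut n fun hn => hc ⟨n, hn⟩⟩

lemma rs_eq_zero {E : Set ℕ} {f : ℕ →₀ ℚ} (h : ∀ k ∈ f.support, k ∉ E) : rs E f = 0 := by
  ext k
  by_contra hc
  have : k ∈ (rs E f).support := Finsupp.mem_support_iff.2 hc
  rw [mem_rs_support] at this
  exact h k this.2 this.1

lemma rs_eq_self {E : Set ℕ} {f : ℕ →₀ ℚ} (h : ∀ k ∈ f.support, k ∈ E) : rs E f = f := by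
  classical
  ext k
  rw [rs_apply]
  by_cases hk : k ∈ f.support
  · rw [if_pos (h k hk)]
  · rw [Finsupp.notMem_support_iff.1 hk]; simp

lemma sub_supp {x y : ℕ →₀ ℝ} {k : ℕ} (h : k ∈ (x - y).support) : k ∈ x.support ∨ k ∈ y.support := by
  classical
  have := Finsupp.support_sub h
  rwa [Finset.mem_union] at this

lemma good_w {x α t} (h : Lev4 x α t) :
    GoodSeq (fun n => x (2 * n) - x (2 * n + 1)) (fun n => t (2 * n))
      (fun n s => s = t (2 * n) ∨ s = t (2 * n + 1)) 40 := by
  classical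
  have tinj : ∀ i j, t i = t j → i = j := by
    intro i j hij
    rcases lt_trichotomy i j with h1 | h1 | h1
    · have := h.tlt i j h1; omega
    · exact h1
    · have := h.tlt j i h1; omega
  refine ⟨?_, by norm_num, ?_, ?_, ?_, ?_, ?_, ?_, ?_⟩
  · intro i j hij p hp q hq
    rcases sub_supp hp with hp | hp <;> rcases sub_supp hq with hq | hq <;>
      exact h.blk _ _ (by omega) p hp q hq
  · intro k
    refine (N_sub_le _ _).trans ?_
    have := h.Nle (2 * k); have := h.Nle (2 * k + 1); linarith
  · intro k p hp
    rcases sub_supp hp with hp | hp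
    · have := h.far _ p hp; omega
    · have := h.far _ p hp; omega
  · intro k; have := h.tge (2 * k); change k ≤ t (2 * k); omega
  · intro k k' hk p hp
    rcases sub_supp hp with hp | hp
    · exact h.tsup _ _ (by omega) p hp
    · exact h.tsup _ _ (by omega) p hp
  · intro k s f hex hf
    rw [not_or] at hex
    have h1 := h.bd (2 * k) s f hex.1 hf
    have h2 := h.bd (2 * k + 1) s f hex.2 hf
    have h3 : min s (t (2 * k)) ≤ min s (t (2 * k + 1)) :=
      min_le_min le_rfl (h.tlt _ _ (by omega)).le
    have h4 := mm_inv_anti h3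
    rw [map_sub]
    have h5 := abs_sub (pr f (x (2 * k))) (pr f (x (2 * k + 1)))
    linarith
  · intro k k' s h1 h2
    rcases h1 with h1 | h1 <;> rcases h2 with h2 | h2 <;>
      (have := tinj _ _ (h1.symm.trans h2); omega)
  · intro β τ E hβ hsp hE
    let A : ℕ → Set ℕ := fun n => {p | p ∈ (α (2 * n)).support ∨ p ∈ (α (2 * n + 1)).support}
    obtain ⟨n1, n2, hn⟩ := cut_two (A := A) (by
      intro i j hij p hp q hq
      rcases hp with hp | hp <;> rcases hq with hq | hq <;>
        exact h.sp.2.1 _ _ (by omega) p hp q hq) hE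
    let g : ℕ → Prop := fun i => ∃ k ≤ i, ¬ (β k = α k ∧ τ k = t k)
    have hgmono : ∀ i j, i ≤ j → g i → g j := by
      rintro i j hij ⟨k, hk, hk'⟩; exact ⟨k, by omega, hk'⟩
    obtain ⟨i0, hi0⟩ : ∃ i0, ∀ i, g i → (∀ k < i, ¬ g k) → i = i0 := by
      by_cases hg : ∃ i, g i
      · refine ⟨Nat.find hg, fun i hi hk => ?_⟩
        have h1 := Nat.find_spec hg
        have h2 := Nat.find_min' hg hi
        by_contra hc
        exact hk _ (by omega) h1
      · exact ⟨0, fun i hi => absurd ⟨i, hi⟩ hg⟩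
    have hzero : ∀ i l, i ≠ l → pr (rs E (α i)) (x l) = 0 := by
      intro i l hil
      refine Hul_zero (f := fun r => rs E (α r)) (u := x) (fun r k hk => ?_) h.blk hil
      exact h.hul r k (mem_rs_support.1 hk).2
    refine ⟨{i0 / 2, n1, n2}, g, Finset.card_le_three, fun k hk => ?_⟩
    simp only [Finset.mem_insert, Finset.mem_singleton, not_or] at hk
    obtain ⟨hk0, hk1, hk2⟩ := hk
    refine ⟨fun i hgi hex => ?_, fun n => ?_⟩
    · have : ∃ i', τ i = t i' ∧ i' / 2 = k := by
        rcases hex with hex | hex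
        · exact ⟨_, hex, by omega⟩
        · exact ⟨_, hex, by omega⟩
      obtain ⟨i', h1, h2⟩ := this
      obtain ⟨rfl, h4⟩ := spec_code hsp h.sp h1
      have := hi0 i hgi (by
        rintro l hl ⟨r, hr, hr'⟩
        exact hr' (h4 r (by omega)))
      subst this
      exact hk0 h2.symm
    · by_cases hg1 : g (2 * n)
      · exact ⟨_, _, Or.inr ⟨hg1, rfl⟩, Or.inr ⟨hgmono _ _ (by omega) hg1, rfl⟩, pr_add_left _ _ _⟩
      · have he1 : β (2 * n) = α (2 * n) := by
          by_contra hc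
          exact hg1 ⟨2 * n, le_rfl, fun hh => hc hh.1⟩
        by_cases hg2 : g (2 * n + 1)
        · refine ⟨0, _, Or.inl rfl, Or.inr ⟨hg2, rfl⟩, ?_⟩
          have hi := hi0 _ hg2 (fun k hk hgk => hg1 (hgmono _ _ (by omega) hgk))
          rw [pr_add_left, he1, map_sub, hzero _ _ (by omega), hzero _ _ (by omega)]
          simp
        · have he2 : β (2 * n + 1) = α (2 * n + 1) := by
            by_contra hc
            exact hg2 ⟨2 * n + 1, le_rfl, fun hh => hc hh.1⟩
          refine ⟨0, 0, Or.inl rfl, Or.inl rfl, ?_⟩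
          rw [pr_add_left, he1, he2, map_sub, map_sub]
          by_cases hkn : k = n
          · subst hkn
            rw [hzero (2 * k) (2 * k + 1) (by omega), hzero (2 * k + 1) (2 * k) (by omega)]
            rcases hn k hk1 hk2 with h1 | h1
            · rw [rs_eq_self fun p hp => h1 (Or.inl hp), rs_eq_self fun p hp => h1 (Or.inr hp),
                h.one, h.one]
              simp
            · rw [rs_eq_zero fun p hp hpE => (h1 ▸ (⟨Or.inl hp, hpE⟩ : p ∈ A k ∩ E) : p ∈ (∅ : Set ℕ)),
                rs_eq_zero fun p hp hpE => (h1 ▸ (⟨Or.inr hp, hpE⟩ : p ∈ A k ∩ E) : p ∈ (∅ : Set ℕ))]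
              simp [pr_zero_left]
          · rw [hzero _ _ (by omega), hzero _ _ (by omega), hzero _ _ (by omega),
              hzero _ _ (by omega)]
            simp

/-- Output of the construction. -/
structure Out (x : ℕ → ℕ →₀ ℝ) : Prop where
  blk : Blk x
  ne : ∀ i, x i ≠ 0
  Nle : ∀ i, N (x i) ≤ 20
  far : ∀ i, ∀ k ∈ (x i).support, i < k
  low : ∀ (F : Finset ℕ) (ε : ℕ → ℚ), (∀ n, |ε n| ≤ 1) →
    (∀ i, i / 2 ∈ F → ∀ p ∈ (x i).support, F.card ≤ p) →
    ∃ f, W f ∧ ∀ i, pr f (x i) = if i / 2 ∈ F then (ε (i / 2) : ℝ) else 0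
  cnt : ∀ δ : ℝ, 0 < δ → ∃ A k0 : ℕ, ∀ g, W g → ∀ D : Finset ℕ,
    (∀ n ∈ D, k0 ≤ n ∧ δ < |pr g (x (2 * n) - x (2 * n + 1))|) → D.card ≤ A

lemma main_seq {Z : Submodule ℝ (ℕ →₀ ℝ)} (hZ : Far Z) : ∃ x, Out x ∧ ∀ i, x i ∈ Z := by
  classical
  obtain ⟨x, α, t, h, hxZ⟩ := level4 hZ
  refine ⟨x, ⟨h.blk, ?_, h.Nle, h.far, ?_, ?_⟩, hxZ⟩
  · intro i hi
    have := h.one i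
    rw [hi] at this
    simp at this
  · intro F ε hε hF
    have hty := h.ty
    choose L hL1 hL2 hL3 using hty
    refine ⟨_, W.spec α t L F ε Set.univ hL1 hL2 hL3 h.sp hε Set.ordConnected_univ ?_, ?_⟩
    · intro n hn p _ hp
      rw [Finset.mem_union] at hp
      rcases hp with hp | hp
      · obtain ⟨a, ha, _, _, h1, _⟩ := h.hul _ p hp
        exact (hF (2 * n) (by rwa [show 2 * n / 2 = n by omega]) a ha).trans h1
      · obtain ⟨a, ha, _, _, h1, _⟩ := h.hul _ p hp
        exact (hF (2 * n + 1) (by rwa [show (2 * n + 1) / 2 = n by omega]) a ha).trans h1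
    · intro i
      simp only [rs_univ]
      have hzero : ∀ i l, i ≠ l → pr (α i) (x l) = 0 := fun i l hil =>
        Hul_zero (f := α) h.hul h.blk hil
      have hterm : ∀ n, pr (ε n • (α (2 * n) + α (2 * n + 1))) (x i) =
          if n = i / 2 then (ε n : ℝ) else 0 := by
        intro n
        rw [pr_smul_left, pr_add_left]
        split_ifs with hn
        · rcases Nat.mod_two_eq_zero_or_one i with hi | hi
          · have : 2 * n = i := by omega
            rw [this, h.one, hzero _ _ (by omega)]; simp
          · have : 2 * n + 1 = i := by omega
            rw [this, h.one, hzero _ _ (by omega)]; simp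
        · rw [hzero _ _ (by omega), hzero _ _ (by omega)]; simp
      rw [pr_sum_left]
      simp only [hterm]
      rw [Finset.sum_ite_eq']
  · intro δ hδ
    have hw := good_w h
    obtain ⟨j, hj⟩ := exists_nat_gt (160 / δ)
    obtain ⟨k0, hk0⟩ := count hw j
    refine ⟨BB j, k0, fun g hg D hD => hk0 g hg D fun n hn => ⟨(hD n hn).1, ?_⟩⟩
    refine lt_of_le_of_lt ?_ (hD n hn).2
    have hm : (0 : ℝ) < mm j := by exact_mod_cast mm_pos j
    have h1 : j ≤ mm j :=
      (Nat.le_mul_of_pos_right j (by positivity)).trans (mul_two_pow_le_mm j)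
    have h2 : (j : ℝ) ≤ mm j := by exact_mod_cast h1
    rw [div_lt_iff₀ hδ] at hj
    rw [← div_eq_mul_inv, div_le_iff₀ hm]
    nlinarith

end EqPairs


namespace EqPairs

/-! ### Final estimates in the space of finitely supported vectors -/

lemma Blk_ge {z : ℕ → ℕ →₀ ℝ} (hz : Blk z) (h0 : ∀ n, z n ≠ 0) (n : ℕ) :
    ∀ k ∈ (z n).support, n ≤ k := by
  induction n with
  | zero => intro k _; omega
  | succ n ih =>
    intro k hk
    obtain ⟨q, hq⟩ := Finsupp.support_nonempty_iff.2 (h0 n)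
    have h1 := ih q hq
    have h2 := hz n (n + 1) (by omega) q hq k hk
    omega

lemma Far_span {z : ℕ → ℕ →₀ ℝ} (hz : Blk z) (h0 : ∀ n, z n ≠ 0) :
    Far (Submodule.span ℝ (Set.range z)) := by
  intro p
  refine ⟨z (p + 1), Submodule.subset_span ⟨_, rfl⟩, h0 _, fun k hk => ?_⟩
  have := Blk_ge hz h0 (p + 1) k hk
  omega

lemma low_sum {x : ℕ → ℕ →₀ ℝ} (hx : Out x) {φ : ℕ → ℕ} (hφ : Function.Injective φ)
    (a : ℕ → ℝ) (s F : Finset ℕ) (hFs : F ⊆ s) (hF : ∀ i ∈ F, F.card ≤ φ i) (b : ℕ) (hb : b < 2) :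
    ∑ i ∈ F, |a i| ≤ N (∑ i ∈ s, a i • x (2 * φ i + b)) := by
  classical
  let ε : ℕ → ℚ := fun m => if ∃ i ∈ F, φ i = m ∧ a i < 0 then -1 else 1
  obtain ⟨f, hf, hfx⟩ := hx.low (F.image φ) ε
    (fun n => by simp only [ε]; split_ifs <;> simp) (by
      intro i hi p hp
      obtain ⟨l, hl, hl'⟩ := Finset.mem_image.1 hi
      have h1 := hx.far i p hp
      have h2 := hF l hl
      have h3 : (F.image φ).card ≤ F.card := Finset.card_image_le
      omega)
  refine le_trans (le_of_eq ?_) ((le_abs_self _).trans (le_N hf _))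
  rw [map_sum, ← Finset.sum_subset hFs]
  · refine Finset.sum_congr rfl fun i hi => ?_
    rw [map_smul, hfx, show (2 * φ i + b) / 2 = φ i by omega,
      if_pos (Finset.mem_image_of_mem φ hi), smul_eq_mul]
    simp only [ε]
    by_cases hai : a i < 0
    · rw [if_pos ⟨i, hi, rfl, hai⟩, abs_of_neg hai]; push_cast; ring
    · rw [if_neg, abs_of_nonneg (not_lt.1 hai)]
      · push_cast; ring
      · rintro ⟨l, _, hl, hl'⟩
        rw [hφ hl] at hl'
        exact hai hl'
  · intro i _ hi
    rw [map_smul, hfx, show (2 * φ i + b) / 2 = φ i by omega, if_neg, smul_zero]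
    intro h
    obtain ⟨l, hl, hl'⟩ := Finset.mem_image.1 h
    rw [hφ hl'] at hl
    exact hi hl

lemma geom_le (m : ℕ) : ∑ j ∈ Finset.range m, (40 : ℝ) * (1 / 2) ^ j ≤ 80 := by
  rw [← Finset.mul_sum]
  have : ∑ j ∈ Finset.range m, (1 / 2 : ℝ) ^ j ≤ 2 := by
    have h := sum_geometric_two_le m
    simpa using h
  linarith

lemma layer {h : ℝ} (h40 : h ≤ 40) (i : ℕ) :
    h ≤ 40 * (1 / 2 : ℝ) ^ i +
      ∑ j ∈ Finset.range (i + 1), if 40 * (1 / 2 : ℝ) ^ (j + 1) < h then 40 * (1 / 2 : ℝ) ^ j else 0 := by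
  have hnn : ∀ j ∈ Finset.range (i + 1),
      0 ≤ if 40 * (1 / 2 : ℝ) ^ (j + 1) < h then 40 * (1 / 2 : ℝ) ^ j else 0 := by
    intro j _; split_ifs <;> positivity
  by_cases hex : ∃ j, j ≤ i ∧ 40 * (1 / 2 : ℝ) ^ (j + 1) < h
  · classical
    have h1 := Nat.find_spec hex
    have hmin := fun m => Nat.find_min hex (m := m)
    set j := Nat.find hex
    have h2 : h ≤ 40 * (1 / 2 : ℝ) ^ j := by
      rcases Nat.eq_zero_or_pos j with h0 | h0
      · rw [h0]; simpa using h40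
      · by_contra hc
        push Not at hc
        apply hmin (j - 1) (by omega)
        refine ⟨by omega, ?_⟩
        rwa [show j - 1 + 1 = j by omega]
    have h3 := Finset.single_le_sum hnn (Finset.mem_range.2 (show j < i + 1 by omega))
    rw [if_pos h1.2] at h3
    have : (0 : ℝ) ≤ 40 * (1 / 2 : ℝ) ^ i := by positivity
    linarith
  · push Not at hex
    have h1 := hex i le_rfl
    have h2 := Finset.sum_nonneg hnn
    have h3 : (1 / 2 : ℝ) ^ (i + 1) ≤ (1 / 2 : ℝ) ^ i := by
      rw [pow_succ]; have : (0 : ℝ) < (1 / 2 : ℝ) ^ i := by positivity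
      linarith
    linarith

lemma diff_bound {x : ℕ → ℕ →₀ ℝ} (hx : Out x) : ∃ φ : ℕ → ℕ, StrictMono φ ∧
    ∀ (a : ℕ → ℝ) (s : Finset ℕ) (b : ℕ), b < 2 →
      N (∑ i ∈ s, a i • (x (2 * φ i) - x (2 * φ i + 1))) ≤
        160 * N (∑ i ∈ s, a i • x (2 * φ i + b)) := by
  classical
  have hc : ∀ j : ℕ, ∃ A k0 : ℕ, ∀ g, W g → ∀ D : Finset ℕ,
      (∀ n ∈ D, k0 ≤ n ∧ 40 * (1 / 2 : ℝ) ^ (j + 1) < |pr g (x (2 * n) - x (2 * n + 1))|) →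
      D.card ≤ A := fun j => hx.cnt _ (by positivity)
  choose A k0 hA using hc
  let φ : ℕ → ℕ := fun i => 1 + i + ∑ j ∈ Finset.range (i + 1), (A j + k0 j)
  have hφm : StrictMono φ := by
    apply strictMono_nat_of_lt_succ
    intro i
    simp only [φ]
    rw [Finset.sum_range_succ _ (i + 1)]
    omega
  have hφ : ∀ i j, j ≤ i → A j ≤ φ i ∧ k0 j ≤ φ i ∧ 1 ≤ φ i := by
    intro i j hij
    have : A j + k0 j ≤ ∑ j ∈ Finset.range (i + 1), (A j + k0 j) :=
      Finset.single_le_sum (f := fun j => A j + k0 j) (fun _ _ => Nat.zero_le _)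
        (Finset.mem_range.2 (by omega))
    simp only [φ]
    omega
  refine ⟨φ, hφm, fun a s b hb => ?_⟩
  set B := N (∑ i ∈ s, a i • x (2 * φ i + b)) with hB
  have hB0 : 0 ≤ B := N_nonneg _
  have hlow : ∀ F ⊆ s, (∀ i ∈ F, F.card ≤ φ i) → ∑ i ∈ F, |a i| ≤ B :=
    fun F h1 h2 => low_sum hx hφm.injective a s F h1 h2 b hb
  apply N_le (by positivity)
  intro g hg
  set h : ℕ → ℝ := fun i => |pr g (x (2 * φ i) - x (2 * φ i + 1))| with hh
  have h40 : ∀ i, h i ≤ 40 := by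
    intro i
    refine (le_N hg _).trans ((N_sub_le _ _).trans ?_)
    have := hx.Nle (2 * φ i); have := hx.Nle (2 * φ i + 1); linarith
  obtain ⟨m, hm⟩ : ∃ m, ∀ i ∈ s, i < m :=
    ⟨s.sup id + 1, fun i hi => Nat.lt_succ_of_le (Finset.le_sup (f := id) hi)⟩
  have h1 : |pr g (∑ i ∈ s, a i • (x (2 * φ i) - x (2 * φ i + 1)))| ≤ ∑ i ∈ s, |a i| * h i := by
    rw [map_sum]
    refine (Finset.abs_sum_le_sum_abs _ _).trans (Finset.sum_le_sum fun i _ => ?_)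
    rw [map_smul, smul_eq_mul, abs_mul]
  have h2 : ∀ i ∈ s, |a i| * h i ≤ 40 * (1 / 2 : ℝ) ^ i * B +
      ∑ j ∈ Finset.range m, 40 * (1 / 2 : ℝ) ^ j *
        (if j ≤ i ∧ 40 * (1 / 2 : ℝ) ^ (j + 1) < h i then |a i| else 0) := by
    intro i hi
    have hai : |a i| ≤ B := by
      have := hlow {i} (by simpa using hi) (by simpa using (hφ i i le_rfl).2.2)
      simpa using this
    have hl := layer (h40 i) i
    have h3 : ∑ j ∈ Finset.range (i + 1),
        (if 40 * (1 / 2 : ℝ) ^ (j + 1) < h i then 40 * (1 / 2 : ℝ) ^ j else 0) * |a i| ≤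
        ∑ j ∈ Finset.range m, 40 * (1 / 2 : ℝ) ^ j *
        (if j ≤ i ∧ 40 * (1 / 2 : ℝ) ^ (j + 1) < h i then |a i| else 0) := by
      calc _ = ∑ j ∈ Finset.range (i + 1), 40 * (1 / 2 : ℝ) ^ j *
            (if j ≤ i ∧ 40 * (1 / 2 : ℝ) ^ (j + 1) < h i then |a i| else 0) := by
            refine Finset.sum_congr rfl fun j hj => ?_
            have hji : j ≤ i := by have := Finset.mem_range.1 hj; omega
            simp only [hji, true_and]
            split_ifs <;> simp
        _ ≤ _ := by
            apply Finset.sum_le_sum_of_subset_of_nonneg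
            · exact Finset.range_subset_range.2 (hm i hi)
            · intro j _ _
              split_ifs <;> positivity
    rw [← Finset.sum_mul] at h3
    have h4 : |a i| * h i ≤ |a i| * _ := mul_le_mul_of_nonneg_left hl (abs_nonneg _)
    have h5 : 40 * (1 / 2 : ℝ) ^ i * |a i| ≤ 40 * (1 / 2 : ℝ) ^ i * B := by gcongr
    linarith
  have h3 : ∀ j, ∑ i ∈ s, (if j ≤ i ∧ 40 * (1 / 2 : ℝ) ^ (j + 1) < h i then |a i| else 0) ≤ B := by
    intro j
    rw [← Finset.sum_filter]
    apply hlow _ (Finset.filter_subset _ _)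
    have hcard : (s.filter fun i => j ≤ i ∧ 40 * (1 / 2 : ℝ) ^ (j + 1) < h i).card ≤ A j := by
      rw [← Finset.card_image_of_injective _ hφm.injective]
      apply hA j g hg
      intro n hn
      obtain ⟨i, hi, rfl⟩ := Finset.mem_image.1 hn
      rw [Finset.mem_filter] at hi
      exact ⟨(hφ i j hi.2.1).2.1, hi.2.2⟩
    intro i hi
    rw [Finset.mem_filter] at hi
    exact hcard.trans (hφ i j hi.2.1).1
  have h4 : ∑ i ∈ s, 40 * (1 / 2 : ℝ) ^ i * B ≤ 80 * B := by
    rw [← Finset.sum_mul]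
    gcongr
    refine le_trans ?_ (geom_le m)
    apply Finset.sum_le_sum_of_subset_of_nonneg
    · intro i hi; exact Finset.mem_range.2 (hm i hi)
    · intro i _ _; positivity
  have h5 : ∑ i ∈ s, ∑ j ∈ Finset.range m, 40 * (1 / 2 : ℝ) ^ j *
        (if j ≤ i ∧ 40 * (1 / 2 : ℝ) ^ (j + 1) < h i then |a i| else 0) ≤ 80 * B := by
    rw [Finset.sum_comm]
    calc _ ≤ ∑ j ∈ Finset.range m, 40 * (1 / 2 : ℝ) ^ j * B := by
          refine Finset.sum_le_sum fun j _ => ?_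
          rw [← Finset.mul_sum]
          have := h3 j
          gcongr
      _ ≤ 80 * B := by
          rw [← Finset.sum_mul]
          gcongr
          exact geom_le m
  calc _ ≤ _ := h1
    _ ≤ _ := Finset.sum_le_sum h2
    _ = _ := Finset.sum_add_distrib
    _ ≤ 160 * B := by linarith

lemma equiv_part {z : ℕ → ℕ →₀ ℝ} (hz : Blk z) (h0 : ∀ n, z n ≠ 0) :
    ∃ y : ℕ → ℕ →₀ ℝ, Blk y ∧ (∀ n, y n ≠ 0) ∧ (∀ n, y n ∈ Submodule.span ℝ (Set.range z)) ∧
      ∀ (a : ℕ → ℝ) (s : Finset ℕ),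
        N (∑ i ∈ s, a i • y (2 * i)) ≤ 161 * N (∑ i ∈ s, a i • y (2 * i + 1)) ∧
        N (∑ i ∈ s, a i • y (2 * i + 1)) ≤ 161 * N (∑ i ∈ s, a i • y (2 * i)) := by
  obtain ⟨x, hx, hxZ⟩ := main_seq (Far_span hz h0)
  obtain ⟨φ, hφ, hd⟩ := diff_bound hx
  refine ⟨fun n => x (2 * φ (n / 2) + n % 2), ?_, fun n => hx.ne _, fun n => hxZ _, ?_⟩
  · intro i j hij
    apply hx.blk
    rcases Nat.lt_or_ge (i / 2) (j / 2) with h | h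
    · have := hφ h; omega
    · have : i / 2 = j / 2 := by omega
      rw [this]; omega
  · intro a s
    have e1 : ∀ i, 2 * i / 2 = i := fun i => by omega
    have e2 : ∀ i, 2 * i % 2 = 0 := fun i => by omega
    have e3 : ∀ i, (2 * i + 1) / 2 = i := fun i => by omega
    have e4 : ∀ i, (2 * i + 1) % 2 = 1 := fun i => by omega
    simp only [e1, e2, e3, e4]
    have h1 := hd a s 0 (by norm_num)
    have h2 := hd a s 1 (by norm_num)
    simp only [add_zero, smul_sub, Finset.sum_sub_distrib] at h1 h2 ⊢
    set U := ∑ i ∈ s, a i • x (2 * φ i)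
    set V := ∑ i ∈ s, a i • x (2 * φ i + 1)
    constructor
    · have h3 := N_add_le (U - V) V
      rw [sub_add_cancel] at h3
      linarith
    · have h3 := N_sub_le U (U - V)
      rw [sub_sub_cancel] at h3
      linarith

lemma sum_pairs {G : Type*} [AddCommMonoid G] (f : ℕ → G) (n : ℕ) :
    ∑ i ∈ Finset.range (2 * n), f i = ∑ i ∈ Finset.range n, (f (2 * i) + f (2 * i + 1)) := by
  induction n with
  | zero => simp
  | succ n ih =>
    rw [Nat.mul_succ, Finset.sum_range_succ, Finset.sum_range_succ, ih, Finset.sum_range_succ,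
      add_assoc]

/-- Output for the second part. -/
lemma au_part {z : ℕ → ℕ →₀ ℝ} (hz : Blk z) (h0 : ∀ n, z n ≠ 0) {C : ℝ} (hC : 1 ≤ C) :
    ∃ (n : ℕ) (y : ℕ → ℕ →₀ ℝ), Blk y ∧ (∀ i, y i ≠ 0) ∧
      (∀ i, y i ∈ Submodule.span ℝ (Set.range z)) ∧ (∀ i, ∀ k ∈ (y i).support, n < k) ∧
      C * N (∑ i ∈ Finset.range n, (-1 : ℝ) ^ i • y i) < N (∑ i ∈ Finset.range n, y i) := by
  classical
  obtain ⟨x, hx, hxZ⟩ := main_seq (Far_span hz h0)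
  obtain ⟨A, k0, hA⟩ := hx.cnt (1 / C) (by positivity)
  obtain ⟨m, hm⟩ := exists_nat_gt (40 * A * C)
  set K := k0 + m with hK
  refine ⟨2 * m, fun i => x (2 * K + i), fun i j hij => hx.blk _ _ (by omega), fun i => hx.ne _,
    fun i => hxZ _, fun i k hk => ?_, ?_⟩
  · have := hx.far _ k hk; omega
  have hlow : (2 * m : ℝ) ≤ N (∑ i ∈ Finset.range (2 * m), x (2 * K + i)) := by
    obtain ⟨f, hf, hfx⟩ := hx.low (Finset.Ico K (K + m)) (fun _ => 1) (by simp) (by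
      intro i hi p hp
      have h1 := hx.far i p hp
      rw [Finset.mem_Ico] at hi
      simp
      omega)
    refine le_trans (le_of_eq ?_) ((le_abs_self _).trans (le_N hf _))
    rw [map_sum]
    rw [Finset.sum_congr rfl (g := fun _ => (1 : ℝ))]
    · simp
    · intro i hi
      rw [Finset.mem_range] at hi
      rw [hfx, if_pos (Finset.mem_Ico.2 ⟨by omega, by omega⟩)]
      simp
  have hup : N (∑ i ∈ Finset.range (2 * m), (-1 : ℝ) ^ i • x (2 * K + i)) ≤ m * (1 / C) + A * 40 := by
    rw [sum_pairs]
    have hAm : (0 : ℝ) ≤ m * (1 / C) + A * 40 := by positivity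
    have hterm : ∀ i, ((-1 : ℝ) ^ (2 * i) • x (2 * K + 2 * i) +
        (-1 : ℝ) ^ (2 * i + 1) • x (2 * K + (2 * i + 1))) =
        x (2 * (K + i)) - x (2 * (K + i) + 1) := by
      intro i
      rw [pow_succ, pow_mul]
      simp only [even_two, Even.neg_pow, one_pow, one_smul, mul_neg, mul_one, neg_smul]
      rw [← sub_eq_add_neg, show 2 * (K + i) = 2 * K + 2 * i by ring, add_assoc]
    simp only [hterm]
    apply N_le hAm
    intro g hg
    rw [map_sum]
    refine (Finset.abs_sum_le_sum_abs _ _).trans ?_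
    have h1 := sum_except (Finset.range m)
      ((Finset.range m).filter fun i => 1 / C < |pr g (x (2 * (K + i)) - x (2 * (K + i) + 1))|)
      (fun i => |pr g (x (2 * (K + i)) - x (2 * (K + i) + 1))|) (1 / C) 40 A
      (by positivity) (by norm_num)
      (fun i hi hiD => by
        rw [Finset.mem_filter] at hiD
        push Not at hiD
        exact hiD hi)
      (fun i _ => by
        refine (le_N hg _).trans ((N_sub_le _ _).trans ?_)
        have := hx.Nle (2 * (K + i)); have := hx.Nle (2 * (K + i) + 1); linarith)
      (by
        rw [← Finset.card_image_of_injective _ (add_right_injective K)]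
        apply hA g hg
        intro n hn
        obtain ⟨i, hi, rfl⟩ := Finset.mem_image.1 hn
        rw [Finset.mem_filter] at hi
        exact ⟨by omega, hi.2⟩)
    rw [Finset.card_range] at h1
    exact h1
  calc _ ≤ C * (m * (1 / C) + A * 40) := by gcongr
    _ = m + 40 * A * C := by field_simp
    _ < 2 * m := by linarith
    _ ≤ _ := hlow

/-- coefficients of successive vectors in the span of a block sequence are successive -/
lemma span_succ {z : ℕ → ℕ →₀ ℝ} (hz : Blk z) (h0 : ∀ n, z n ≠ 0) {c c' : ℕ →₀ ℝ}
    (h : Sc (c.sum fun i a => a • z i) (c'.sum fun i a => a • z i)) : Sc c c' := by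
  have key : ∀ c : ℕ →₀ ℝ, ∀ s ∈ c.support, ∀ p ∈ (z s).support,
      p ∈ (c.sum fun i a => a • z i).support := by
    intro c s hs p hp
    rw [Finsupp.mem_support_iff, Finsupp.sum, Finsupp.finsetSum_apply, Finset.sum_eq_single s]
    · rw [Finsupp.smul_apply, smul_eq_mul]
      exact mul_ne_zero (Finsupp.mem_support_iff.1 hs) (Finsupp.mem_support_iff.1 hp)
    · intro l _ hl
      rw [Finsupp.smul_apply]
      have : z l p = 0 := by
        by_contra hc
        have hc' : p ∈ (z l).support := Finsupp.mem_support_iff.2 hc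
        rcases lt_or_gt_of_ne hl with h | h
        · exact lt_irrefl _ (hz _ _ h p hc' p hp)
        · exact lt_irrefl _ (hz _ _ h p hp p hc')
      rw [this, smul_zero]
    · intro h; exact absurd hs h
  intro s hs t ht
  obtain ⟨p, hp⟩ := Finsupp.support_nonempty_iff.2 (h0 s)
  obtain ⟨q, hq⟩ := Finsupp.support_nonempty_iff.2 (h0 t)
  have h1 := h p (key c s hs p hp) q (key c' t ht q hq)
  rcases lt_trichotomy s t with h2 | h2 | h2
  · exact h2
  · subst h2
    exact absurd (h p (key c s hs p hp) p (key c' s ht p hp)) (lt_irrefl _)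
  · have := hz t s h2 q hq p hp
    omega

end EqPairs

namespace EqPairs

/-! ### The Banach space -/

abbrev XX : Type := ↥((LinearMap.range Ph).topologicalClosure)

noncomputable def Ps : (ℕ →₀ ℝ) →ₗ[ℝ] XX :=
  Ph.codRestrict _ fun x => Submodule.le_topologicalClosure _ (LinearMap.mem_range_self Ph x)

lemma norm_Ps (x : ℕ →₀ ℝ) : ‖Ps x‖ = N x := rfl

lemma Ps_inj : Function.Injective Ps := by
  intro x y h
  apply Ph_inj
  exact congrArg Subtype.val h

noncomputable def eb (n : ℕ) : XX := Ps (Finsupp.single n 1)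

lemma Ps_single (i : ℕ) (a : ℝ) : Ps (Finsupp.single i a) = a • eb i := by
  rw [eb, ← map_smul, Finsupp.smul_single, smul_eq_mul, mul_one]

lemma Ps_sum_single (s : Finset ℕ) (a : ℕ → ℝ) :
    Ps (∑ i ∈ s, Finsupp.single i (a i)) = ∑ i ∈ s, a i • eb i := by
  rw [map_sum]
  exact Finset.sum_congr rfl fun i _ => Ps_single i (a i)

lemma Ps_eq (x : ℕ →₀ ℝ) : Ps x = ∑ k ∈ x.support, x k • eb k := by
  rw [← Ps_sum_single]
  congr 1
  exact (Finsupp.sum_single x).symm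

lemma sum_single_apply (s : Finset ℕ) (a : ℕ → ℝ) (k : ℕ) :
    (∑ i ∈ s, Finsupp.single i (a i)) k = if k ∈ s then a k else 0 := by
  classical
  rw [Finsupp.finsetSum_apply]
  simp [Finsupp.single_apply]

lemma XX_complete : CompleteSpace XX :=
  (Submodule.isClosed_topologicalClosure _).completeSpace_coe

lemma XX_inf : ¬ FiniteDimensional ℝ XX := by
  intro h
  have := Module.Finite.of_injective Ps Ps_inj
  rcases Module.finite_finsupp_self_iff.1 this with h | h
  · exact not_subsingleton ℝ h
  · exact not_finite ℕ

lemma Ps_mem (x : ℕ →₀ ℝ) : Ps x ∈ Submodule.span ℝ (Set.range eb) := by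
  rw [Ps_eq]
  exact Submodule.sum_mem _ fun k _ => Submodule.smul_mem _ _ (Submodule.subset_span ⟨k, rfl⟩)

lemma eb_basis : IsSchauderBasis eb := by
  refine ⟨fun n h => ?_, ?_, 1, le_rfl, fun a m n hmn => ?_⟩
  · have : Finsupp.single n (1 : ℝ) = 0 := Ps_inj (by rw [map_zero]; exact h)
    simp at this
  · rw [Metric.dense_iff]
    intro x r hr
    have hx : (x : Lp) ∈ closure ((LinearMap.range Ph : Submodule ℝ Lp) : Set Lp) := x.2
    obtain ⟨b, ⟨v, rfl⟩, hb⟩ := Metric.mem_closure_iff.1 hx r hr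
    refine ⟨Ps v, ?_, Ps_mem v⟩
    rw [Metric.mem_ball, dist_comm]
    exact hb
  · rw [one_mul, ← Ps_sum_single, ← Ps_sum_single, norm_Ps, norm_Ps]
    apply N_filter_le _ _ m
    · intro k hk
      rw [sum_single_apply, sum_single_apply, if_pos (Finset.mem_range.2 hk),
        if_pos (Finset.mem_range.2 (by omega))]
    · intro k hk
      rw [sum_single_apply, if_neg (by simpa using hk)]

lemma lift_block {z : ℕ → XX} (hz : IsBlockSeq eb z) :
    ∃ z' : ℕ → ℕ →₀ ℝ, Blk z' ∧ (∀ n, z' n ≠ 0) ∧ z = fun n => Ps (z' n) := by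
  obtain ⟨h0, I, a, h1, h2⟩ := hz
  have hP : ∀ n, z n = Ps (∑ i ∈ I n, Finsupp.single i (a n i)) := fun n => by
    rw [Ps_sum_single, h1]
  have hs : ∀ n k, k ∈ (∑ i ∈ I n, Finsupp.single i (a n i)).support → k ∈ I n := by
    intro n k hk
    rw [Finsupp.mem_support_iff, sum_single_apply] at hk
    by_contra h
    rw [if_neg h] at hk
    exact hk rfl
  refine ⟨fun n => ∑ i ∈ I n, Finsupp.single i (a n i), ?_, ?_, funext hP⟩
  · intro n m hnm i hi j hj
    exact h2 n m hnm i (hs n i hi) j (hs m j hj)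
  · intro n hn
    apply h0 n
    rw [hP]
    exact (congrArg Ps hn).trans (map_zero Ps)

lemma block_of {y : ℕ → ℕ →₀ ℝ} (hy : Blk y) (h0 : ∀ n, y n ≠ 0) :
    IsBlockSeq eb fun n => Ps (y n) := by
  refine ⟨fun n h => h0 n (Ps_inj (h.trans (map_zero Ps).symm)), fun n => (y n).support,
    fun n i => y n i, fun n => Ps_eq _, fun n m hnm i hi j hj => hy n m hnm i hi j hj⟩

lemma Ps_comb (s : Finset ℕ) (a : ℕ → ℝ) (u : ℕ → ℕ →₀ ℝ) :
    ∑ i ∈ s, a i • Ps (u i) = Ps (∑ i ∈ s, a i • u i) := by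
  rw [map_sum]
  exact Finset.sum_congr rfl fun i _ => (map_smul _ _ _).symm

lemma fin_pairs {z : ℕ → XX} (hz : IsBlockSeq eb z) :
    ∃ y : ℕ → XX, IsBlockSeq eb y ∧
      (∀ n, y n ∈ Submodule.span ℝ (Set.range z)) ∧
      SeqEquiv (fun n => y (2 * n)) (fun n => y (2 * n + 1)) := by
  obtain ⟨z', hz', h0, rfl⟩ := lift_block hz
  obtain ⟨y, hy, hy0, hs, hN⟩ := equiv_part hz' h0
  refine ⟨fun n => Ps (y n), block_of hy hy0, fun n => ?_, 1 / 161, 161, by norm_num, ?_⟩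
  · have := Submodule.mem_map_of_mem (f := Ps) (hs n)
    rw [Submodule.map_span, ← Set.range_comp] at this
    exact this
  · intro a s
    have h1 := Ps_comb s a (fun i => y (2 * i))
    have h2 := Ps_comb s a (fun i => y (2 * i + 1))
    simp only [h1, h2, norm_Ps]
    obtain ⟨h3, h4⟩ := hN a s
    exact ⟨by linarith, h4⟩

lemma fin_au {x : ℕ → XX} (hx : IsBlockSeq eb x) : ¬ AsympUncondBlockSeq eb x := by
  rintro ⟨C, hC, H⟩
  obtain ⟨z, hz, h0, rfl⟩ := lift_block hx
  obtain ⟨n, y, hy, hy0, hs, hk, hlt⟩ := au_part hz h0 hC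
  have hs' : ∀ i, ∃ c : ℕ →₀ ℝ, (c.sum fun j a => a • z j) = y i := fun i =>
    Finsupp.mem_span_range_iff_exists_finsupp.1 (hs i)
  choose c hc using hs'
  have hsc : ∀ i i', i < i' → Sc (c i) (c i') := by
    intro i i' hii
    apply span_succ hz h0
    rw [hc, hc]
    exact hy i i' hii
  have key := H n (fun i => Ps (y i))
    (fun i h => hy0 i (Ps_inj (by rw [h, map_zero])))
    ⟨fun i => (c i).support, fun i j => c i j, fun i => by
      rw [← hc i, Finsupp.sum]
      exact (Ps_comb _ _ _).symm,
      fun i i' hii s hs t ht => hsc i i' hii s hs t ht⟩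
    ⟨fun i => (y i).support, fun i j => y i j, fun i => Ps_eq _,
      fun i i' hii s hs t ht => hy i i' hii s hs t ht, fun i j hj => hk i j hj⟩
    (fun i => (-1) ^ (i : ℕ)) (fun i => (-1) ^ (i : ℕ)) (fun i => neg_one_pow_eq_or ℝ _)
  have e1 : ∑ i : Fin n, ((-1 : ℝ) ^ (i : ℕ) * (-1) ^ (i : ℕ)) • Ps (y i) =
      Ps (∑ i ∈ Finset.range n, y i) := by
    rw [Fin.sum_univ_eq_sum_range (fun i => ((-1 : ℝ) ^ i * (-1) ^ i) • Ps (y i)), Ps_comb]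
    congr 1
    apply Finset.sum_congr rfl
    intro i _
    rw [← mul_pow]
    simp
  have e2 : ∑ i : Fin n, ((-1 : ℝ) ^ (i : ℕ)) • Ps (y i) =
      Ps (∑ i ∈ Finset.range n, (-1 : ℝ) ^ i • y i) := by
    rw [Fin.sum_univ_eq_sum_range (fun i => ((-1 : ℝ) ^ i) • Ps (y i)), Ps_comb]
  rw [e1, e2, norm_Ps, norm_Ps] at key
  linarith

end EqPairs

theorem exists_space_equiv_pairs_no_asymp_uncond :
    ∃ (X : Type) (_ : NormedAddCommGroup X) (_ : NormedSpace ℝ X) (e : ℕ → X),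
      CompleteSpace X ∧ ¬FiniteDimensional ℝ X ∧ IsSchauderBasis e ∧
      (∀ z : ℕ → X, IsBlockSeq e z →
        ∃ y : ℕ → X, IsBlockSeq e y ∧
          (∀ n, y n ∈ Submodule.span ℝ (Set.range z)) ∧
          SeqEquiv (fun n => y (2 * n)) (fun n => y (2 * n + 1))) ∧
      (∀ x : ℕ → X, IsBlockSeq e x → ¬ AsympUncondBlockSeq e x) := by
  exact ⟨EqPairs.XX, inferInstance, inferInstance, EqPairs.eb, EqPairs.XX_complete,
    EqPairs.XX_inf, EqPairs.eb_basis, fun _ hz => EqPairs.fin_pairs hz,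
    fun _ hx => EqPairs.fin_au hx⟩
end
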